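/- Let K be an algebraically closed field, Q a finite quiver with no oriented cycles, α a dimension vector for Q, and σ: Q_0 → ℤ a weight. Then the graded ring SI(Q,α,σ) = ⊕_{d≥0} SI(Q,α)_{dσ} is generated by elements of degree ≤ m·n^3, where n = |σ|_α = (1/2)·Σ_{i∈Q_0} |σ(i)|·α_i and m = Σ_{x∈Q_0} Σ_{y∈Q_0} σ_+(x)·b_{x,y}·σ_−(y), with b_{x,y} the number of directed paths from x to y in Q, and σ_+ (resp. σ_−) the positive (resp. negative) part of σ. -/

import Mathlib

open MvPolynomial Matrix

/-- Coordinate functions of a representation of a quiver with arrows `Q1`,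
tail/head maps `ta ha : Q1 → Q0` and dimension vector `α`. -/
def repCoords {K : Type} [Field K] {Q0 Q1 : Type} {ta ha : Q1 → Q0} {α : Q0 → ℕ}
    (v : (a : Q1) → Matrix (Fin (α (ha a))) (Fin (α (ta a))) K) :
    ((a : Q1) × (Fin (α (ha a)) × Fin (α (ta a)))) → K :=
  fun p => v p.1 p.2.1 p.2.2

/-- The ring of quiver invariants `I(Q,α) = K[Rep(Q,α)]^{GL(α)}`. -/
noncomputable def quiverInvariants (K : Type) [Field K] {Q0 Q1 : Type}
    (ta ha : Q1 → Q0) (α : Q0 → ℕ) :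
    Subalgebra K (MvPolynomial ((a : Q1) × (Fin (α (ha a)) × Fin (α (ta a)))) K) :=
  ⨅ (A : (i : Q0) → GeneralLinearGroup (Fin (α i)) K)
    (v : (a : Q1) → Matrix (Fin (α (ha a))) (Fin (α (ta a))) K),
      AlgHom.equalizer
        (aeval (repCoords fun a => (A (ha a)).val * v a * ((A (ta a))⁻¹).val))
        (aeval (repCoords v))

/-- The ring of quiver semi-invariants `SI(Q,α) = K[Rep(Q,α)]^{SL(α)}`. -/
noncomputable def quiverSemiInvariants (K : Type) [Field K] {Q0 Q1 : Type}
    (ta ha : Q1 → Q0) (α : Q0 → ℕ) :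
    Subalgebra K (MvPolynomial ((a : Q1) × (Fin (α (ha a)) × Fin (α (ta a)))) K) :=
  ⨅ (A : (i : Q0) → SpecialLinearGroup (Fin (α i)) K)
    (v : (a : Q1) → Matrix (Fin (α (ha a))) (Fin (α (ta a))) K),
      AlgHom.equalizer
        (aeval (repCoords fun a => (A (ha a)).val * v a * ((A (ta a))⁻¹).val))
        (aeval (repCoords v))

/-- The weight space `SI(Q,α)_σ` of semi-invariants of weight `σ : Q0 → ℤ`:
those `f` with `A · f = (∏ i, det (A i) ^ σ i) • f`, i.e.
`f(A⁻¹ · v) = (∏ i, det (A i) ^ σ i) * f(v)` for all `A ∈ GL(α)`. -/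
noncomputable def quiverSemiInvariantsOfWeight (K : Type) [Field K] {Q0 Q1 : Type}
    [Fintype Q0] (ta ha : Q1 → Q0) (α : Q0 → ℕ) (σ : Q0 → ℤ) :
    Submodule K (MvPolynomial ((a : Q1) × (Fin (α (ha a)) × Fin (α (ta a)))) K) where
  carrier := { f | ∀ (A : (i : Q0) → GeneralLinearGroup (Fin (α i)) K)
      (v : (a : Q1) → Matrix (Fin (α (ha a))) (Fin (α (ta a))) K),
      aeval (repCoords fun a => ((A (ha a))⁻¹).val * v a * (A (ta a)).val) f
        = (∏ i : Q0, ((A i).val.det) ^ (σ i)) * aeval (repCoords v) f }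
  add_mem' := by
    intro f g hf hg A v
    rw [map_add, map_add, hf A v, hg A v, mul_add]
  zero_mem' := by
    intro A v
    simp
  smul_mem' := by
    intro c f hf A v
    rw [_root_.map_smul, _root_.map_smul, hf A v, smul_eq_mul, smul_eq_mul]
    ring

/-- `IsQuiverPath ta ha x y l` : the list of arrows `l` is a directed path from
vertex `x` to vertex `y`. -/
def IsQuiverPath {Q0 Q1 : Type} (ta ha : Q1 → Q0) (x y : Q0) : List Q1 → Prop
  | [] => x = y
  | a :: l =>
      ta a = x ∧ List.Chain' (fun b c => ha b = ta c) (a :: l) ∧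
        ha ((a :: l).getLast (List.cons_ne_nil a l)) = y

/-- The number of directed paths from `x` to `y`. -/
noncomputable def numQuiverPaths {Q0 Q1 : Type} (ta ha : Q1 → Q0) (x y : Q0) : ℕ :=
  Nat.card { l : List Q1 // IsQuiverPath ta ha x y l }

/-- A quiver has no oriented cycles if there is no nonempty directed path from a
vertex to itself. -/
def HasNoOrientedCycles {Q0 Q1 : Type} (ta ha : Q1 → Q0) : Prop :=
  ∀ (x : Q0) (l : List Q1), l ≠ [] → ¬ IsQuiverPath ta ha x x l


open Finset (prod_insert sum_insert univ sum_add_distrib sum_erase_add mem_univ ne_of_mem_erase sum_ite_eq' sum_eq_zero mem_filter sum_comm sum_congr sum_eq_single sum_const card_univ sum_le_sum prod_mul_distrib prod_pow prod_eq_single prod_congr prod_zpow prod_ne_zero_iff prod_eq_one mem_union mem_add prod_bij_ne_one prod_univ_sum sum_const_zero sum_ite_eq prod_eq_zero sum_sub_distrib sum_neg_distrib sum_lt_sum mul_prod_erase mem_erase mem_range prod_const add_sum_erase mem_map smul_sum sum_eq_zero_iff)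
open Equiv (sum_comp Perm prodCongr)
open Function (Injective update update_self update_of_ne Bijective update_apply update_eq_self ne_iff Embedding)
open Set (finite_range mem_ofPred_eq)
open Nat (card_eq_fintype_card exists_eq_succ_of_ne_zero mod_eq_of_lt succ_mul succ_pos le_mul_of_pos_right card_sigma lt_succ_of_le exists_eq_add_of_le)
open Fintype (card_fin sum_prod_type card_prod prod_sigma' prod_sum_type piFinset_univ sum_sum_type sum_sigma card_congr equivFin prod_sigma equivOfCardEq ofFinite)
open Module (finrank_fin_fun finrank finrank_fintype_fun_eq_card finrank_pi_fintype Basis finBasis)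
open HahnSeries (coeff_single)
open Fin (last ofNat val_add lt_def elim0 lastCases)
open Submodule (subset_span finrank_le mem_map_of_mem map_le_iff_le_comap map_comp prodEquivOfIsCompl smul_mem span_le span_induction)
open LinearMap (exists_leftInverse_of_injective ker_eq_bot finrank_le_finrank_of_injective mem_ker funLeft ker_eq_bot' codRestrict)
open RingHom (map_det id_apply coe_coe mapMatrix_apply)
open IsFractionRing (injective lift_algebraMap)
open Polynomial (coe_evalRingHom eval₂RingHom coe_eval₂RingHom eq_zero_of_infinite_isRoot evalRingHom eval₂_reverse_mul_pow coeff_zero_reverse eq_C_of_natDegree_eq_zero natDegree_sum_le_of_forall_le aeval_algHom_apply natDegree_C_mul_le)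
open Subtype (val_injective)
open AlgHom (toRingHom_eq_coe)
open Finsupp (sum_add_index' induction_linear sum_single_index equivFunOnFinite prod_fintype sum_fintype degree_single)
open Units (val_mul coe_prod val_pow_eq_pow_val val_one ne_zero)
open Pi (mulSingle mulSingle_eq_same mulSingle_eq_of_ne mulSingle_mul)
open Int (natAbs_pos ofNat_le exists_least_of_bdd castRingHom cast_zero)
open Sum (elim_inl elim_inr)
open Finite (injective_iff_bijective)
open List (map_cons Chain')
open Relation (TransGen)
open Algebra (adjoin subset_adjoin FiniteType adjoin_range_eq_range_aeval)
open Localization (subalgebra)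
open IsLocalization (AtPrime)
open IsScalarTower (of_algebraMap_eq toAlgHom)
open IsLocalRing (ResidueField)
open Subalgebra (fg_iff_finiteType)
open SetLike (mem_coe)
open IsAlgClosed (instInfinite)
section
variable {Q0 Q1 : Type} (ta ha : Q1 → Q0) (α : Q0 → ℕ) (K R h i hp N d σ e s k V v : ℕ)
set_option hygiene false
notation "Mdk" => Matrix (Fin d) (Fin d) k
notation "Pfs" => MvPolynomial (Fin s) K
notation "Fai" => Fin (α i)
notation "cg1" => congrArg (Sigma.fst (β := fun i => Fin (α i + 1))) hp
notation "NLp" => ∀ e, ta e ≠ ha e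
notation "HTp" => ∀ a, h (ta a) < h (ha a)
notation "fNσ" => fun x => (N : ℤ) * σ x
notation "fdσ" => fun x => (d : ℤ) * σ x
notation "fNd" => fun x => ((d : ℤ) - N) * σ x
notation "FPV" => FractionRing (MvPolynomial V K)
notation "αhe" => α (ha e)
notation "αte" => α (ta e)
notation "v21" => ⟨_, v.2.1⟩
notation "v22" => ⟨_, v.2.2⟩
end

section Lead
structure MFilt {R : Type*} [CommRing R] (F : ℤ → AddSubgroup R) : Prop where
  one : (1 : R) ∈ F 0
  mul : ∀ a b x y, x ∈ F a → y ∈ F b → x * y ∈ F (a + b)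
  anti : ∀ a b, a ≤ b → F b ≤ F a
variable {R : Type*} [CommRing R] {F : ℤ → AddSubgroup R}
theorem MFilt.prod (hF : MFilt F) {ι : Type*} (s : Finset ι) (x : ι → R) (w : ι → ℤ)
    (h : ∀ i ∈ s, x i ∈ F (w i)) : ∏ i ∈ s, x i ∈ F (∑ i ∈ s, w i) := by
  classical
  induction s using Finset.induction_on with
  | empty => simpa using hF.one
  | insert a s ha ih =>
    rw [prod_insert ha, sum_insert ha]
    exact hF.mul _ _ _ _ (h _ (by simp)) (ih fun i hi => h i (by simp [hi]))
theorem MFilt.det (hF : MFilt F) {ι : Type*} [Fintype ι] [DecidableEq ι] (M : Matrix ι ι R)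
    (a b : ι → ℤ) (h : ∀ i j, M i j ∈ F (a i + b j)) : M.det ∈ F (∑ i, a i + ∑ i, b i) := by
  rw [det_apply]
  refine AddSubgroup.sum_mem _ fun π _ => ?_
  rw [Units.smul_def]
  refine AddSubgroup.zsmul_mem _ ?_ _
  have := hF.prod univ (fun i => M (π i) i) (fun i => a (π i) + b i) (fun i _ => h _ _)
  rwa [sum_add_distrib, sum_comp π a] at this
theorem MFilt.det_lead (hF : MFilt F) {ι : Type*} [Fintype ι] [DecidableEq ι] (M : Matrix ι ι R)
    (π0 : Perm ι) (a b : ι → ℤ) (h : ∀ i j, M i j ∈ F (a i + b j))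
    (h' : ∀ i j, i ≠ π0 j → M i j ∈ F (a i + b j + 1)) :
    M.det - (Perm.sign π0 : ℤ) • ∏ i, M (π0 i) i ∈ F (∑ i, a i + ∑ i, b i + 1) := by
  rw [det_apply, ← sum_erase_add _ _ (mem_univ π0)]
  simp only [Units.smul_def, add_sub_cancel_right]
  refine AddSubgroup.sum_mem _ fun π hπ => AddSubgroup.zsmul_mem _ ?_ _
  obtain ⟨i0, hi0⟩ : ∃ i, π i ≠ π0 i := by
    by_contra! hc
    exact (ne_of_mem_erase hπ) (Equiv.ext hc)
  have := hF.prod univ (fun i => M (π i) i)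
    (fun i => a (π i) + b i + if i = i0 then 1 else 0) (fun i _ => by
      split_ifs with hi
      · subst hi; exact h' _ _ hi0
      · rw [add_zero]; exact h _ _)
  rwa [sum_add_distrib, sum_add_distrib, sum_comp π a,
    sum_ite_eq' univ i0, if_pos (mem_univ _)] at this
end Lead
section Minors
variable {k : Type*} [Field k] {m n : Type*} [Fintype m] [Fintype n]
theorem exists_indep_cols (M : Matrix m n k) :
    ∃ g : Fin M.rank → n, Injective g ∧ (M.submatrix id g).rank = M.rank := by
  classical
  obtain ⟨s, hs1, hs2, hs3⟩ := exists_linearIndependent k (Set.range M.col)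
  have hfin : s.Finite := (finite_range _).subset hs1
  have hcard : Nat.card s = M.rank := by
    rw [Matrix.rank_eq_finrank_span_cols, ← hs2]
    have := hfin.fintype
    rw [card_eq_fintype_card, ← Set.toFinset_card]
    exact (finrank_span_set_eq_card hs3).symm
  have := hfin.fintype
  let e : Fin M.rank ≃ s := (finCongr hcard.symm).trans (Finite.equivFin s).symm
  choose g hg using fun x : s => hs1 x.2
  refine ⟨g ∘ e, ?_, ?_⟩
  · refine Injective.comp (fun x y h => Subtype.ext ?_) e.injective
    rw [← hg x, ← hg y, h]
  · have h2 : LinearIndependent k (M.submatrix id (g ∘ e))ᵀ.row := by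
      have : (M.submatrix id (g ∘ e))ᵀ.row = ((↑) : s → m → k) ∘ e := by
        funext i; exact hg (e i)
      rw [this]; exact hs3.comp _ e.injective
    have := h2.rank_matrix
    rwa [rank_transpose, card_fin] at this
theorem exists_minor (M : Matrix m n k) : ∃ (f : Fin M.rank → m) (g : Fin M.rank → n),
    (M.submatrix f g).det ≠ 0 := by
  obtain ⟨g, -, hg⟩ := exists_indep_cols M
  obtain ⟨f, -, hf⟩ := exists_indep_cols (M.submatrix id g)ᵀ
  have e : (M.submatrix id g)ᵀ.rank = M.rank := by rw [rank_transpose, hg]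
  refine ⟨f ∘ finCongr e.symm, g, fun h0 => ?_⟩
  obtain ⟨v, hv, hv0⟩ := exists_mulVec_eq_zero_iff.2 h0
  have hr : (M.submatrix (f ∘ finCongr e.symm) g).rank = M.rank := by
    have : (M.submatrix (f ∘ finCongr e.symm) g)
      = (((M.submatrix id g)ᵀ.submatrix id f)ᵀ).submatrix (finCongr e.symm) (Equiv.refl _) := by
      ext; simp
    rw [this, rank_submatrix, rank_transpose, hf, e]
  have := (M.submatrix (f ∘ finCongr e.symm) g).mulVecLin.finrank_range_add_finrank_ker
  change rank _ + _ = _ at this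
  rw [hr, finrank_fin_fun, Nat.add_eq_left] at this
  rw [Submodule.finrank_eq_zero] at this
  have h3 : v ∈ LinearMap.ker (M.submatrix (f ∘ finCongr e.symm) g).mulVecLin := hv0
  rw [this] at h3; exact hv h3
theorem le_rank_of_minor (M : Matrix m n k) {r : ℕ} (f : Fin r → m) (g : Fin r → n)
    (h : (M.submatrix f g).det ≠ 0) : r ≤ M.rank := by
  have := Matrix.rank_of_det_ne_zero h
  rw [card_fin] at this
  rw [← this]; exact rank_submatrix_le _ _ _
end Minors
section Div
variable {E : Type} [Field E] (s : E →+* E) (d : ℕ) [NeZero d]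
noncomputable def lmap : LaurentSeries E →+* LaurentSeries E where
  toFun x := x.map s
  map_one' := by ext i; simp [HahnSeries.coeff_one, apply_ite s]
  map_zero' := by ext; simp
  map_add' x y := by ext; simp
  map_mul' x y := HahnSeries.map_mul (s : E →ₙ+* E)
noncomputable def tvar : LaurentSeries E := HahnSeries.single (1 : ℤ) 1
theorem lmap_t : lmap s tvar = tvar := by
  ext i; change s _ = _; simp [tvar, coeff_single, apply_ite s]
variable (E) in
noncomputable def cycP : Matrix (Fin d) (Fin d) (LaurentSeries E) :=
  Matrix.of fun i j => if j = i + 1 then (if j = 0 then tvar else 1) else 0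
theorem cycP_mul (M : Matrix (Fin d) (Fin d) (LaurentSeries E)) (i j) :
    (cycP E d * M) i j = (if i + 1 = 0 then tvar else 1) * M (i + 1) j := by
  simp [Matrix.mul_apply, cycP]
theorem mul_cycP (M : Matrix (Fin d) (Fin d) (LaurentSeries E)) (i j) :
    (M * cycP E d) i (j + 1) = M i j * (if j + 1 = 0 then tvar else 1) := by
  simp [Matrix.mul_apply, cycP]
noncomputable def DD : Subring (Matrix (Fin d) (Fin d) (LaurentSeries E)) where
  carrier := {M | (lmap s).mapMatrix M * cycP E d = cycP E d * M}
  mul_mem' {a b} ha hb := by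
    simp only [mem_ofPred_eq, map_mul] at *
    rw [mul_assoc, hb, ← mul_assoc, ha, mul_assoc]
  one_mem' := by simp
  add_mem' {a b} ha hb := by
    simp only [mem_ofPred_eq, map_add, add_mul, mul_add] at *
    rw [ha, hb]
  zero_mem' := by simp
  neg_mem' {a} ha := by
    simp only [mem_ofPred_eq, map_neg, neg_mul, mul_neg] at *
    rw [ha]
theorem mem_DD {M : Matrix (Fin d) (Fin d) (LaurentSeries E)} : M ∈ DD s d ↔ ∀ i j,
    (if i + 1 = 0 then tvar else 1) * M (i + 1) (j + 1) =
      lmap s (M i j) * (if j + 1 = 0 then tvar else 1) := by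
  change _ = _ ↔ _
  rw [← Matrix.ext_iff]
  constructor
  · intro h i j
    rw [← cycP_mul, ← h i (j + 1), mul_cycP]; rfl
  · intro h i j
    obtain ⟨j, rfl⟩ : ∃ j', j = j' + 1 := ⟨j - 1, by simp⟩
    rw [cycP_mul, mul_cycP, h]; rfl
def ordF : ℤ → AddSubgroup (LaurentSeries E) := fun w =>
  { carrier := {x | ∀ e : ℤ, d * e < w → x.coeff e = 0}
    add_mem' := fun ha hb e he => by simp [ha e he, hb e he]
    zero_mem' := by simp
    neg_mem' := fun ha e he => by simp [ha e he] }
theorem ordF_filt : MFilt (ordF (E := E) d) where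
  one e he := by
    rw [HahnSeries.coeff_one, if_neg]; rintro rfl; simp at he
  mul a b x y hx hy e he := by
    rw [HahnSeries.coeff_mul]
    refine sum_eq_zero fun p hp => ?_
    rw [Finset.mem_antidiagonal] at hp
    by_cases h : (d : ℤ) * p.1 < a
    · rw [hx _ h, zero_mul]
    · rw [hy p.2 (by rw [← hp.2.2, mul_add] at he; linarith), mul_zero]
  anti a b h x hx e he := hx e (he.trans_le h)
theorem lmap_mem {x : LaurentSeries E} {w} : lmap s x ∈ ordF d w ↔ x ∈ ordF d w := by
  refine forall₂_congr fun e _ => ?_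
  change s _ = 0 ↔ _
  simp
theorem fin_succ_val (i : Fin d) (h : i + 1 ≠ 0) : (((i + 1 : Fin d) : ℕ) : ℤ) = (i : ℕ) + 1 := by
  obtain ⟨n, rfl⟩ := exists_eq_succ_of_ne_zero (NeZero.ne d)
  have : i ≠ last n := by rintro rfl; simp at h
  rw [Fin.val_add_one, if_neg this]; simp
theorem fin_succ_val' (i : Fin d) (h : i + 1 = 0) : ((i : ℕ) : ℤ) = d - 1 := by
  obtain ⟨n, rfl⟩ := exists_eq_succ_of_ne_zero (NeZero.ne d)
  have : i = last n := by
    have := eq_neg_of_add_eq_zero_left h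
    rw [this]; ext; simp [Fin.coe_neg_one]
  subst this; simp
theorem mul_tvar_mem {x : LaurentSeries E} {w : ℤ} : x * tvar ∈ ordF d (w + d) ↔ x ∈ ordF d w := by
  have key : ∀ e, (x * tvar).coeff (e + 1) = x.coeff e := fun e => by
    rw [tvar, HahnSeries.coeff_mul_single_add, mul_one]
  constructor
  · intro h e he
    rw [← key]; exact h _ (by push_cast [mul_add]; linarith)
  · intro h e he
    have := key (e - 1)
    rw [sub_add_cancel] at this
    rw [this]; exact h _ (by rw [mul_sub]; linarith)
theorem DD_row {M : Matrix (Fin d) (Fin d) (LaurentSeries E)} (hM : M ∈ DD s d) (w : ℤ) (j0 : Fin d)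
    (n : ℕ) : M (ofNat d n) (j0 + ofNat d n) ∈
      ordF d (w + (ofNat d n : ℕ) - (j0 + ofNat d n : Fin d)) ↔
      M 0 j0 ∈ ordF d (w - (j0 : ℕ)) := by
  induction n with
  | zero => simp
  | succ n ih =>
    have e1 : ofNat d (n + 1) = ofNat d n + 1 := by ext; simp [val_add]
    rw [e1, ← add_assoc]
    by_cases hi : ofNat d n + 1 = 0
    · rw [hi, add_assoc, hi, add_zero]; simp
    · have := (mem_DD s d).1 hM (ofNat d n) (j0 + ofNat d n)
      rw [if_neg hi, one_mul] at this
      rw [this, fin_succ_val d _ hi, ← ih]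
      refine Iff.trans ?_ (lmap_mem s d)
      split_ifs with hj
      · rw [hj, fin_succ_val' d _ hj, Fin.val_zero]
        refine Iff.trans ?_ (mul_tvar_mem d)
        ring_nf
      · rw [fin_succ_val d _ hj, mul_one]; ring_nf
theorem notMem_ordF {x : LaurentSeries E} {a : ℤ} :
    x ∉ ordF d (a + 1) ↔ x ≠ 0 ∧ d * x.order ≤ a := by
  constructor
  · intro h
    have : ∃ e : ℤ, d * e < a + 1 ∧ x.coeff e ≠ 0 := by
      by_contra! hc; exact h hc
    obtain ⟨e, he, hx⟩ := this
    refine ⟨by rintro rfl; simp at hx, ?_⟩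
    have := HahnSeries.order_le_of_coeff_ne_zero hx
    nlinarith [this, Int.natCast_nonneg d]
  · rintro ⟨h, h2⟩ h3
    exact HahnSeries.leadingCoeff_ne_zero.2 h (by
      rw [HahnSeries.leadingCoeff_eq]; exact h3 _ (by linarith))
theorem prod_notMem {ι : Type} (S : Finset ι) (x : ι → LaurentSeries E) (a : ι → ℤ)
    (h : ∀ i ∈ S, x i ∉ ordF d (a i + 1)) : ∏ i ∈ S, x i ∉ ordF d (∑ i ∈ S, a i + 1) := by
  classical
  induction S using Finset.induction_on with
  | empty => rw [notMem_ordF]; simp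
  | insert b S hb ih =>
    have h1 := (notMem_ordF d).1 (h b (by simp))
    have h2 := (notMem_ordF d).1 (ih fun i hi => h i (by simp [hi]))
    rw [prod_insert hb, sum_insert hb, notMem_ordF]
    refine ⟨mul_ne_zero h1.1 h2.1, ?_⟩
    rw [HahnSeries.order_mul h1.1 h2.1, mul_add]; linarith
theorem DD_det {M : Matrix (Fin d) (Fin d) (LaurentSeries E)} (hM : M ∈ DD s d) (h0 : M ≠ 0) :
    M.det ≠ 0 := by
  classical
  have hrow : ∃ j, M 0 j ≠ 0 := by
    by_contra! hc
    apply h0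
    have key : ∀ n : ℕ, ∀ j, M (ofNat d n) j = 0 := by
      intro n
      induction n with
      | zero => simpa using hc
      | succ n ih =>
        intro j
        have e1 : ofNat d (n + 1) = ofNat d n + 1 := by ext; simp [val_add]
        have := (mem_DD s d).1 hM (ofNat d n) (j - 1)
        rw [ih, map_zero, zero_mul, sub_add_cancel, ← e1, mul_eq_zero] at this
        refine this.resolve_left ?_
        have : (tvar : LaurentSeries E) ≠ 0 := by simp [tvar]
        split_ifs <;> simp [this]
    ext1 i j
    simpa using key i j
  obtain ⟨j1, hj1⟩ := hrow
  obtain ⟨j0, hj0, hmin⟩ := Finset.exists_min_image (univ.filter fun j => M 0 j ≠ 0)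
    (fun j => (d : ℤ) * (M 0 j).order + (j : ℕ)) ⟨j1, by simpa using hj1⟩
  simp only [mem_filter, mem_univ, true_and] at hj0 hmin
  set w : ℤ := d * (M 0 j0).order + (j0 : ℕ) with hw
  have h1 : ∀ j : Fin d, M 0 j ∈ ordF d (w - (j : ℕ)) := by
    intro j
    by_contra hc
    rw [show w - (j : ℕ) = (w - (j : ℕ) - 1) + 1 by ring, notMem_ordF] at hc
    have := hmin j hc.1
    linarith [hc.2]
  have h2 : ∀ j, j ≠ j0 → M 0 j ∈ ordF d (w + 1 - (j : ℕ)) := by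
    intro j hj
    by_contra hc
    rw [show w + 1 - (j : ℕ) = (w - (j : ℕ)) + 1 by ring, notMem_ordF] at hc
    have h3 := hmin j hc.1
    have h4 : (d : ℤ) * (M 0 j).order + (j : ℕ) = d * (M 0 j0).order + (j0 : ℕ) := by
      linarith [hc.2]
    apply hj
    have h5 : ((j : ℕ) : ℤ) % d = ((j0 : ℕ) : ℤ) % d := by
      have := congrArg (· % (d : ℤ)) h4
      simpa [Int.add_emod, Int.mul_emod_right] using this
    ext
    have := Int.natCast_mod j d
    norm_cast at h5
    rwa [mod_eq_of_lt j.2, mod_eq_of_lt j0.2] at h5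
  have h3 : M 0 j0 ∉ ordF d (w + 1 - (j0 : ℕ)) := by
    rw [show w + 1 - (j0 : ℕ) = (w - (j0 : ℕ)) + 1 by ring, notMem_ordF]
    exact ⟨hj0, by linarith⟩
  have key : ∀ (w' : ℤ) (i j : Fin d), M i j ∈ ordF d (w' + (i : ℕ) - (j : ℕ)) ↔
      M 0 (j - i) ∈ ordF d (w' - ((j - i : Fin d) : ℕ)) := by
    intro w' i j
    have := DD_row s d hM w' (j - i) i
    simpa using this
  intro hdet
  have hl := (ordF_filt d).det_lead M (Equiv.subRight j0) (fun i => w + (i : ℕ)) (fun j => -(j : ℕ))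
    (fun i j => (key w i j).2 (h1 _)) (fun i j hij => by
      have := (key (w + 1) i j).2 (h2 _ (by
        intro h; apply hij; simp [← h]))
      convert this using 2; ring)
  rw [hdet, zero_sub, neg_mem_iff] at hl
  have hp := prod_notMem d univ (fun j => M (Equiv.subRight j0 j) j)
    (fun j => w + ((j - j0 : Fin d) : ℕ) - (j : ℕ)) (fun j _ => by
      have := (key (w + 1) (j - j0) j).not.2 (by simpa using h3)
      convert this using 3 <;> first | rfl | ring)
  apply hp
  have e : ∑ j : Fin d, (w + ((j - j0 : Fin d) : ℕ) - ((j : ℕ) : ℤ)) + 1 =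
      ∑ i : Fin d, (w + ((i : ℕ) : ℤ)) + ∑ j : Fin d, -((j : ℕ) : ℤ) + 1 := by
    rw [← sum_comp (Equiv.subRight j0) (fun i : Fin d => w + ((i : ℕ) : ℤ)),
      ← sum_add_distrib]
    simp [sub_eq_add_neg]
  rw [e]
  rcases Int.units_eq_one_or (Perm.sign (Equiv.subRight j0)) with h | h <;> rw [h] at hl
  · simpa using hl
  · simpa using hl
noncomputable instance : DivisionRing (DD s d) := by
  classical
  exact DivisionRing.ofIsUnitOrEqZero fun a => by
    by_cases ha : a = 0
    · exact Or.inr ha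
    left
    have hd := DD_det s d a.2 (by simpa using ha)
    have hu : IsUnit a.1.det := isUnit_iff_ne_zero.2 hd
    have hmem : a.1⁻¹ ∈ DD s d := by
      have h := a.2
      change _ = _ at h
      change _ = _
      have h2 : (lmap s).mapMatrix a.1⁻¹ * (lmap s).mapMatrix a.1 = 1 := by
        rw [← map_mul, nonsing_inv_mul _ hu, map_one]
      calc _ = (lmap s).mapMatrix a.1⁻¹ * (cycP E d * a.1) * a.1⁻¹ := by
            rw [mul_assoc, mul_assoc, mul_nonsing_inv _ hu, mul_one]
        _ = _ := by rw [← h, ← mul_assoc, h2, one_mul]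
    refine ⟨⟨a, ⟨_, hmem⟩, ?_, ?_⟩, rfl⟩
    · ext1; exact mul_nonsing_inv _ hu
    · ext1; exact nonsing_inv_mul _ hu
end Div
section Flat
variable {E : Type} [Field E] (s : E →+* E) (d : ℕ) [NeZero d] {R C : Type} [Fintype R] [Fintype C]
def flat {R C : Type} (N : Matrix R C (DD s d)) :
    Matrix (R × Fin d) (C × Fin d) (LaurentSeries E) :=
  Matrix.of fun p q => (N p.1 q.1).1 p.2 q.2
theorem flat_mul {R C D : Type} [Fintype C] (A : Matrix R C (DD s d)) (B : Matrix C D (DD s d)) :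
    flat s d (A * B) = flat s d A * flat s d B := by
  ext p q
  simp [flat, Matrix.mul_apply, sum_prod_type, Matrix.sum_apply]
theorem flat_dvd (N : Matrix R C (DD s d)) : d ∣ (flat s d N).rank := by
  classical
  obtain ⟨S, hS1, hS2, hS3⟩ := exists_linearIndependent (DD s d) (Set.range N.row)
  have hfin : S.Finite := (finite_range _).subset hS1
  have := hfin.fintype
  choose g hg using fun x : S => hS1 x.2
  let Nf : Matrix S C (DD s d) := fun x => x.1
  have hB : ∀ i, ∃ c : S → DD s d, ∑ x, c x • (x.1 : C → DD s d) = N.row i := by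
    intro i
    have : N.row i ∈ Submodule.span (DD s d) (Set.range (Subtype.val : S → _)) := by
      rw [Subtype.range_coe, hS2]; exact subset_span ⟨i, rfl⟩
    exact (Submodule.mem_span_range_iff_exists_fun _).1 this
  choose B hB using hB
  have hN : N = (Matrix.of B) * Nf := by
    ext1 i j
    rw [Matrix.mul_apply, ← Matrix.row_apply N, ← hB]
    simp [Nf]
  obtain ⟨G, hG⟩ := exists_leftInverse_of_injective
    (Fintype.linearCombination (DD s d) (Subtype.val : S → C → DD s d))
    (ker_eq_bot.2 ((linearIndependent_iff_injective_fintypeLinearCombination).1 hS3))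
  let Gm : Matrix C S (DD s d) := fun c => G (Pi.single c 1)
  have hGm : Nf * Gm = 1 := by
    ext1 x y
    have h1 : G x.1 = Pi.single x 1 := by
      have := LinearMap.congr_fun hG (Pi.single x 1)
      simpa [Fintype.linearCombination_apply_single] using this
    have h2 : x.1 = ∑ c, x.1 c • (Pi.single c 1 : C → DD s d) := by
      ext1 c; simp [Finset.sum_apply, Pi.single_apply]
    rw [Matrix.mul_apply]
    have h3 := congrFun h1 y
    rw [h2, map_sum, Finset.sum_apply] at h3
    simp only [map_smul, Pi.smul_apply, smul_eq_mul] at h3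
    rw [Matrix.one_apply]
    refine h3.trans ?_
    rw [Pi.single_apply]; simp [eq_comm]
  letI dec : DecidableEq (S × Fin d) := Classical.decEq _
  have hone : flat s d (1 : Matrix S S (DD s d)) = (1 : Matrix (S × Fin d) (S × Fin d) (LaurentSeries E)) := by
    ext1 p q
    simp only [flat, Matrix.of_apply, Matrix.one_apply, Prod.ext_iff]
    by_cases h : p.1 = q.1 <;> simp [h, Matrix.one_apply]
  refine ⟨Fintype.card S, le_antisymm ?_ ?_⟩
  · rw [hN, flat_mul]
    refine (rank_mul_le_left _ _).trans ((rank_le_card_width _).trans ?_)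
    simp [mul_comm]
  · have h1 : flat s d Nf = (flat s d N).submatrix (fun p => (g p.1, p.2)) id := by
      ext p q
      have := congrFun (hg p.1) q.1
      simp only [flat, Matrix.of_apply, Matrix.submatrix_apply, id, Nf]
      rw [← this]; rfl
    calc _ = (flat s d Nf * flat s d Gm).rank := by
          rw [← flat_mul, hGm, hone, Matrix.rank_one]; simp [mul_comm]
      _ ≤ _ := (rank_mul_le_left _ _).trans (by rw [h1]; exact rank_submatrix_le _ _ _)
end Flat
section Blow
variable {κ R C : Type} [Fintype κ]
def bl {k L I J : Type} [CommRing k] [CommRing L] (ι : k →+* L) (X : κ → Matrix R C k)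
    (T : κ → Matrix I J L) : Matrix (R × I) (C × J) L :=
  Matrix.of fun p q => ∑ c, ι (X c p.1 q.1) * T c p.2 q.2
theorem minor_eval {k L : Type} [CommRing k] [CommRing L] (ι : k →+* L) {I J : Type} {r : ℕ}
    (X : κ → Matrix R C k) (T : κ → Matrix I J L) (f : Fin r → R × I) (g : Fin r → C × J) :
    eval₂Hom ι (fun v : κ × I × J => T v.1 v.2.1 v.2.2)
      ((bl (MvPolynomial.C) X (fun c => Matrix.of fun i j => (MvPolynomial.X (c, i, j)))).submatrix f g).det
    = ((bl ι X T).submatrix f g).det := by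
  rw [map_det]
  congr 1
  ext; simp [bl]
theorem reg {k : Type} [Field k] [Infinite k] [Fintype R] [Fintype C] (Xm : κ → Matrix R C k)
    (d : ℕ) [NeZero d] : ∃ T0 : κ → Mdk,
      (∀ T : κ → Mdk,
        (bl (RingHom.id k) Xm T).rank ≤ (bl (RingHom.id k) Xm T0).rank) ∧
      d ∣ (bl (RingHom.id k) Xm T0).rank := by
  classical
  let V := κ × Fin d × Fin d
  let A := MvPolynomial V k
  let E := FractionRing A
  let g : A →+* E := (algebraMap A E).comp
    (rename (fun v : V => (v.1, v.2.1, v.2.2 + 1))).toRingHom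
  have hg : Injective g := (injective A E).comp
    (rename_injective _ (fun v w h => by simp only [Prod.mk.injEq, add_left_inj] at h; exact Prod.ext h.1 (Prod.ext h.2.1 h.2.2)))
  let s : E →+* E := IsFractionRing.lift hg
  have hs : ∀ v : V, s (algebraMap A E (MvPolynomial.X v)) = algebraMap A E (MvPolynomial.X (v.1, v.2.1, v.2.2 + 1)) := by
    intro v
    rw [lift_algebraMap]; exact congrArg (algebraMap A E) (rename_X _ _)
  let Y : κ → Matrix (Fin d) (Fin d) (LaurentSeries E) := fun c => Matrix.of fun i j =>
    HahnSeries.C (algebraMap A E (MvPolynomial.X (c, j - i, i))) * (if j < i then tvar else 1)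
  have hY : ∀ c, Y c ∈ DD s d := by
    intro c
    rw [mem_DD]
    intro i j
    have hC : ∀ x, lmap s (HahnSeries.C x) = HahnSeries.C (s x) := fun x => by
      ext n; change s _ = _; simp [coeff_single, apply_ite s]
    simp only [Y, Matrix.of_apply, add_sub_add_right_eq_sub, map_mul, hC, hs]
    rw [mul_left_comm, mul_assoc]
    congr 1
    rw [apply_ite (lmap s), lmap_t, map_one]
    have hi := fin_succ_val d i
    have hi' := fin_succ_val' d i
    have hj := fin_succ_val d j
    have hj' := fin_succ_val' d j
    have := i.2
    have := j.2
    by_cases h1 : i + 1 = 0 <;> by_cases h2 : j + 1 = 0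
    · have : ¬ j < i := by rw [lt_def]; have := hi' h1; have := hj' h2; omega
      simp [h1, h2, this]
    · have : j < i := by
        rw [lt_def]
        have : j ≠ i := by rintro rfl; exact h2 h1
        have : (j : ℕ) ≠ i := fun h => this (Fin.ext h)
        have := hi' h1; omega
      simp [h1, h2, this]
    · have : ¬ j < i := by rw [lt_def]; have := hj' h2; omega
      simp [h1, h2, this, Fin.pos_iff_ne_zero]
    · have : j + 1 < i + 1 ↔ j < i := by
        rw [lt_def, lt_def]; have := hi h1; have := hj h2; omega
      simp [h1, h2, this]
  let ι : k →+* LaurentSeries E := (HahnSeries.C).comp ((algebraMap A E).comp MvPolynomial.C)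
  have hgen : ∀ p : MvPolynomial V k, p ≠ 0 →
      eval₂Hom ι (fun v : V => Y v.1 v.2.1 v.2.2) p ≠ 0 := by
    intro p hp
    let φ : Polynomial E →+* LaurentSeries E :=
      (HahnSeries.ofPowerSeries ℤ E).comp Polynomial.coeToPowerSeries.ringHom
    let q : Polynomial E := eval₂Hom (Polynomial.C.comp ((algebraMap A E).comp MvPolynomial.C))
      (fun v : V => Polynomial.C (algebraMap A E (MvPolynomial.X (v.1, v.2.2 - v.2.1, v.2.1))) *
        (if v.2.2 < v.2.1 then Polynomial.X else 1)) p
    have h1 : eval₂Hom ι (fun v : V => Y v.1 v.2.1 v.2.2) p = φ q := by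
      simp only [q]
      rw [← RingHom.comp_apply]
      congr 1
      apply ringHom_ext
      · intro r; simp [φ, ι]
      · intro v; by_cases h : v.2.2 < v.2.1 <;> simp [φ, Y, tvar, h]
    rw [h1]
    have hφ : Injective φ := HahnSeries.ofPowerSeries_injective.comp
      (Polynomial.coe_injective E)
    rw [Ne, map_eq_zero_iff φ hφ]
    intro hq
    have h2 : q.eval 1 = algebraMap A E (rename (fun v : V => (v.1, v.2.2 - v.2.1, v.2.1)) p) := by
      simp only [q]
      rw [← coe_evalRingHom, ← RingHom.comp_apply, ← AlgHom.coe_toRingHom,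
        ← RingHom.comp_apply]
      congr 1
      apply ringHom_ext
      · intro r; simp
      · intro v; simp [apply_ite]
    rw [hq, Polynomial.eval_zero, eq_comm, map_eq_zero_iff _ (injective A E),
      map_eq_zero_iff _ (rename_injective _ (fun v w h => by
        simp only [Prod.mk.injEq] at h
        have h3 := h.2.1; rw [h.2.2, sub_left_inj] at h3
        exact Prod.ext h.1 (Prod.ext h.2.2 h3)))] at h2
    exact hp h2
  have hd : d ∣ (bl ι Xm Y).rank := by
    have hm : ∀ r c, ∑ e, ι (Xm e r c) • Y e ∈ DD s d := by
      intro r c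
      refine Subring.sum_mem _ fun e _ => ?_
      have : ι (Xm e r c) • Y e = (Matrix.scalar (Fin d) (ι (Xm e r c))) * Y e := by
        ext i j; simp
      rw [this]
      refine Subring.mul_mem _ ?_ (hY e)
      rw [mem_DD]
      intro i j
      have hl : lmap s (ι (Xm e r c)) = ι (Xm e r c) := by
        ext n; change s _ = _
        simp only [ι, RingHom.comp_apply, HahnSeries.C_apply, coeff_single,
          apply_ite s, map_zero]
        rw [lift_algebraMap]
        split_ifs; exacts [congrArg (algebraMap A E) (rename_C _ _), rfl]
      by_cases hij : i = j
      · subst hij; simp [hl, mul_comm]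
      · simp [hij]
    have : bl ι Xm Y = flat s d (fun r c => ⟨∑ e, ι (Xm e r c) • Y e, hm r c⟩) := by
      ext1 p q; simp [bl, flat, Matrix.sum_apply]
    rw [this]; exact flat_dvd _ _ _
  obtain ⟨f, g', hfg⟩ := exists_minor (bl ι Xm Y)
  rw [← minor_eval] at hfg
  obtain ⟨T0, hT0⟩ : ∃ x, eval x ((bl (MvPolynomial.C) Xm (fun c => Matrix.of fun i j =>
      (MvPolynomial.X (c, i, j)))).submatrix f g').det ≠ 0 := by
    by_contra! hc
    have := MvPolynomial.funext (p := ((bl (MvPolynomial.C) Xm (fun c => Matrix.of fun i j =>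
      (MvPolynomial.X (c, i, j)))).submatrix f g').det) (q := 0) (fun x => by rw [hc, map_zero])
    rw [this, map_zero] at hfg; exact hfg rfl
  have hT0' : (bl ι Xm Y).rank ≤ (bl (RingHom.id k) Xm fun c => Matrix.of fun i j => T0 (c, i, j)).rank := by
    refine le_rank_of_minor _ f g' ?_
    rw [← minor_eval]
    exact hT0
  have hle : ∀ T : κ → Mdk,
      (bl (RingHom.id k) Xm T).rank ≤ (bl ι Xm Y).rank := by
    intro T
    obtain ⟨f, g', hfg⟩ := exists_minor (bl (RingHom.id k) Xm T)
    refine le_rank_of_minor _ f g' ?_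
    rw [← minor_eval] at hfg ⊢
    exact hgen _ (fun h => hfg (by rw [h, map_zero]))
  exact ⟨_, fun T => (hle T).trans hT0', le_antisymm hT0' (hle _) ▸ hd⟩
end Blow
section Chain
variable {k V W : Type} [Field k] [AddCommGroup V] [Module k V] [AddCommGroup W] [Module k W]
def KCh (A : V →ₗ[k] W) (l : ℕ) (B : ℕ → V →ₗ[k] W) : Submodule k (ℕ → V) where
  carrier := {v | (∀ a, A (v a) + B a (v (a + 1)) = 0) ∧ ∀ a, l ≤ a → v a = 0}
  add_mem' := by
    rintro v w ⟨h1, h2⟩ ⟨h3, h4⟩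
    refine ⟨fun a => ?_, fun a ha => by simp [h2 a ha, h4 a ha]⟩
    simp only [Pi.add_apply, map_add]
    rw [add_add_add_comm, h1, h3, add_zero]
  zero_mem' := by simp
  smul_mem' := by
    rintro c v ⟨h1, h2⟩
    refine ⟨fun a => ?_, fun a ha => by simp [h2 a ha]⟩
    simp only [Pi.smul_apply, map_smul, ← smul_add, h1, smul_zero]
variable [FiniteDimensional k V]
def KShift (A : V →ₗ[k] W) (l : ℕ) (B : ℕ → V →ₗ[k] W) :
    KCh A (l + 1) B →ₗ[k] KCh A l (fun a => B (a + 1)) where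
  toFun v := ⟨fun a => v.1 (a + 1), fun a => v.2.1 (a + 1), fun a ha => v.2.2 _ (by omega)⟩
  map_add' _ _ := rfl
  map_smul' _ _ := rfl
theorem KShift_ker (A : V →ₗ[k] W) (l : ℕ) (B : ℕ → V →ₗ[k] W) :
    FiniteDimensional k (LinearMap.ker (KShift A l B)) ∧
    finrank k (LinearMap.ker (KShift A l B)) ≤ finrank k (LinearMap.ker A) := by
  have h0 : ∀ v : LinearMap.ker (KShift A l B), ∀ a, v.1.1 (a + 1) = 0 := fun v a =>
    congrFun (congrArg Subtype.val v.2) a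
  let f : LinearMap.ker (KShift A l B) →ₗ[k] LinearMap.ker A :=
    { toFun := fun v => ⟨v.1.1 0, by
        have := v.1.2.1 0
        rw [h0, map_zero, add_zero] at this; exact this⟩
      map_add' := fun _ _ => rfl
      map_smul' := fun _ _ => rfl }
  have hf : Injective f := by
    intro v w h
    ext a
    cases a with
    | zero => exact congrArg Subtype.val h
    | succ a => rw [h0, h0]
  exact ⟨Module.Finite.of_injective f hf, finrank_le_finrank_of_injective hf⟩
theorem KCh_fin (A : V →ₗ[k] W) (l : ℕ) : ∀ (B : ℕ → V →ₗ[k] W),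
    FiniteDimensional k (KCh A l B) ∧
      finrank k (KCh A l B) ≤ l * finrank k (LinearMap.ker A) := by
  induction l with
  | zero =>
    intro B
    have : KCh A 0 B = ⊥ := by
      rw [eq_bot_iff]; rintro v ⟨-, h⟩
      rw [Submodule.mem_bot]; ext1 a; exact h a (Nat.zero_le _)
    rw [this]; exact ⟨inferInstance, by simp⟩
  | succ l ih =>
    intro B
    obtain ⟨h1, h2⟩ := ih (fun a => B (a + 1))
    obtain ⟨h3, h4⟩ := KShift_ker A l B
    have h0 : FiniteDimensional k (KCh A (l + 1) B ⧸ LinearMap.ker (KShift A l B)) :=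
      Module.Finite.equiv (KShift A l B).quotKerEquivRange.symm
    have h5 : FiniteDimensional k (KCh A (l + 1) B) :=
      Module.Finite.of_submodule_quotient (LinearMap.ker (KShift A l B))
    refine ⟨h5, ?_⟩
    rw [← (KShift A l B).finrank_range_add_finrank_ker]
    have := finrank_le (LinearMap.range (KShift A l B))
    rw [succ_mul]; omega
theorem KShift_surj (A : V →ₗ[k] W) (l : ℕ) (B : ℕ → V →ₗ[k] W)
    (h : (l + 1) * finrank k (LinearMap.ker A) ≤ finrank k (KCh A (l + 1) B)) :
    Function.Surjective (KShift A l B) := by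
  obtain ⟨h1, h2⟩ := KCh_fin A l (fun a => B (a + 1))
  obtain ⟨h3, h4⟩ := KShift_ker A l B
  obtain ⟨h5, h6⟩ := KCh_fin A (l + 1) B
  rw [← LinearMap.range_eq_top]
  apply Submodule.eq_top_of_finrank_eq
  have := (KShift A l B).finrank_range_add_finrank_ker
  have h7 := finrank_le (LinearMap.range (KShift A l B))
  rw [succ_mul] at h
  omega
end Chain
section Shrunk
variable {k κ R C : Type} [Field k] [Fintype κ] [Fintype R] [Fintype C]
abbrev bk {I J : Type} (X : κ → Matrix R C k) (T : κ → Matrix I J k) :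
    Matrix (R × I) (C × J) k := bl (RingHom.id k) X T
theorem bk_mulVec {I J : Type} [Fintype J] (X : κ → Matrix R C k) (T : κ → Matrix I J k)
    (u : C × J → k) (p : R × I) :
    (bk X T *ᵥ u) p = ∑ e, ∑ j, ∑ c, X e p.1 c * T e p.2 j * u (c, j) := by
  simp only [bk, bl, Matrix.mulVec, dotProduct, Matrix.of_apply, sum_prod_type,
    Finset.sum_mul, id_apply]
  rw [sum_comm, sum_congr rfl fun j _ => sum_comm, sum_comm]
theorem bk_rank_reindex {I J : Type} [Fintype I] [Fintype J] (X : κ → Matrix R C k)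
    (T : κ → Matrix I I k) (e : J ≃ I) :
    (bk X (fun c => (T c).submatrix e e)).rank = (bk X T).rank := by
  have : bk X (fun c => (T c).submatrix e e) = (bk X T).submatrix
    (prodCongr (Equiv.refl _) e) (prodCongr (Equiv.refl _) e) := by
    ext; simp [bk, bl]
  rw [this, rank_submatrix]
def Tch {d : ℕ} (l : ℕ) (A : κ → Mdk) (B : ℕ → κ → Mdk) :
    κ → Matrix (Fin l × Fin d) (Fin l × Fin d) k := fun c => Matrix.of fun p q =>
  (if p.1 = q.1 then A c p.2 q.2 else 0) + if (p.1 : ℕ) + 1 = q.1 then B p.1 c p.2 q.2 else 0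
def wch {d : ℕ} (l : ℕ) (u : C × (Fin l × Fin d) → k) : ℕ → C × Fin d → k := fun a p =>
  if h : a < l then u (p.1, (⟨a, h⟩, p.2)) else 0
theorem Tch_mulVec {d : ℕ} (l : ℕ) (X : κ → Matrix R C k) (A : κ → Mdk)
    (B : ℕ → κ → Mdk) (u : C × (Fin l × Fin d) → k) (a : ℕ) (h : a < l)
    (p : R × Fin d) :
    (bk X A *ᵥ wch l u a) p + (bk X (B a) *ᵥ wch l u (a + 1)) p
      = (bk X (Tch l A B) *ᵥ u) (p.1, (⟨a, h⟩, p.2)) := by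
  rw [bk_mulVec, bk_mulVec, bk_mulVec, ← sum_add_distrib]
  refine sum_congr rfl fun e _ => ?_
  simp only [Tch, Matrix.of_apply, mul_add, add_mul, sum_add_distrib,
    sum_prod_type, mul_ite, ite_mul, mul_zero, zero_mul]
  congr 1
  · symm; rw [sum_eq_single (⟨a, h⟩ : Fin l)]
    · simp [wch, h]
    · intro b _ hb; simp [hb.symm]
    · simp
  · by_cases h2 : a + 1 < l
    · symm; rw [sum_eq_single (⟨a + 1, h2⟩ : Fin l)]
      · simp [wch, h2]
      · intro b _ hb
        have : a + 1 ≠ b := fun hh => hb (Fin.ext hh.symm)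
        simp [this]
      · simp
    · have : ∀ b : Fin l, a + 1 ≠ b := fun b hh => h2 (hh ▸ b.2)
      simp [wch, h2, this]
theorem KCh_lower {d : ℕ} (l : ℕ) (X : κ → Matrix R C k) (A : κ → Mdk)
    (B : ℕ → κ → Mdk)
    (h : (bk X (Tch l A B)).rank ≤ l * (bk X A).rank) :
    l * finrank k (LinearMap.ker (bk X A).mulVecLin) ≤
      finrank k (KCh (bk X A).mulVecLin l (fun a => (bk X (B a)).mulVecLin)) := by
  have hA := (bk X A).mulVecLin.finrank_range_add_finrank_ker
  have hT := (bk X (Tch l A B)).mulVecLin.finrank_range_add_finrank_ker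
  change rank _ + _ = _ at hA hT
  simp only [finrank_fintype_fun_eq_card, card_prod, card_fin] at hA hT
  have := (KCh_fin (bk X A).mulVecLin l (fun a => (bk X (B a)).mulVecLin)).1
  let f : LinearMap.ker (bk X (Tch l A B)).mulVecLin →ₗ[k]
      KCh (bk X A).mulVecLin l (fun a => (bk X (B a)).mulVecLin) :=
    { toFun := fun u => ⟨wch l u.1, fun a => by
        ext p
        by_cases ha : a < l
        · refine (Tch_mulVec l X A B u.1 a ha p).trans ?_
          have := u.2
          rw [mem_ker, Matrix.mulVecLin_apply] at this
          rw [this]; rfl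
        · have h1 : wch l u.1 a = 0 := by ext; simp [wch, ha]
          have h2 : wch l u.1 (a + 1) = 0 := by
            ext; simp [wch, show ¬ a + 1 < l by omega]
          rw [h1, h2]; simp, fun a ha => by ext; simp [wch, ha]⟩
      map_add' := fun u v => by
        ext a p; simp only [wch]; split_ifs <;> simp [wch, *]
      map_smul' := fun c u => by
        ext a p; simp only [wch]; split_ifs <;> simp [wch, *] }
  have hf : Injective f := by
    intro u v huv
    ext ⟨c, a, i⟩
    have := congrFun (congrFun (congrArg Subtype.val huv) a) (c, i)
    simpa [f, wch] using this
  have := finrank_le_finrank_of_injective hf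
  refine le_trans ?_ this
  have e : l * (Fintype.card C * d) = Fintype.card C * (l * d) := by ring
  rw [← hT, ← hA, mul_add] at e
  omega
theorem exists_full (X : κ → Matrix R C k) [Infinite k]
    (hs : ∀ U : Submodule k (C → k), finrank k U ≤
      finrank k (⨆ e, U.map (X e).mulVecLin : Submodule k (R → k))) :
    ∃ (d : ℕ) (_ : 0 < d) (A : κ → Mdk),
      LinearMap.ker (bk X A).mulVecLin = ⊥ := by
  classical
  choose T0 hT1 hT2 using fun d : ℕ => reg X (d + 1)
  choose s hs2 using hT2
  have hsb : ∀ d, s d ≤ Fintype.card R := by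
    intro d
    have := rank_le_card_height (bl (RingHom.id k) X (T0 d))
    rw [hs2, card_prod, card_fin, mul_comm] at this
    exact Nat.le_of_mul_le_mul_right this (succ_pos _)
  obtain ⟨d, hd⟩ : ∃ d, ∀ d', s d' ≤ s d := by
    obtain ⟨x, ⟨d, rfl⟩, h⟩ := Set.exists_max_image (Set.range s) id
      ((Set.finite_Iic (Fintype.card R)).subset (by rintro _ ⟨d, rfl⟩; exact hsb d)) ⟨_, 0, rfl⟩
    exact ⟨d, fun d' => h _ ⟨d', rfl⟩⟩
  refine ⟨d + 1, succ_pos _, T0 d, ?_⟩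
  set A := T0 d
  set Al := (bk X A).mulVecLin with hAl
  have hrank : ∀ l (B : ℕ → κ → Matrix (Fin (d + 1)) (Fin (d + 1)) k),
      (bk X (Tch l A B)).rank ≤ l * (bk X A).rank := by
    intro l B
    rcases Nat.eq_zero_or_pos l with rfl | hl
    · have := rank_le_card_height (bk X (Tch 0 A B))
      simpa using this
    obtain ⟨D, hD⟩ : ∃ D, l * (d + 1) = D + 1 := ⟨l * (d + 1) - 1, by
      have : 0 < l * (d + 1) := by positivity
      omega⟩
    have e : Fin (D + 1) ≃ Fin l × Fin (d + 1) := (finCongr hD.symm).trans finProdFinEquiv.symm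
    rw [← bk_rank_reindex X _ e]
    refine (hT1 D _).trans ?_
    change _ ≤ l * (bl (RingHom.id k) X (T0 d)).rank
    rw [hs2, hs2, ← mul_assoc, hD]
    exact Nat.mul_le_mul_left _ (hd D)
  let G : Set (C × Fin (d + 1) → k) := {u | ∃ l, ∃ B : ℕ → κ → Matrix (Fin (d + 1)) (Fin (d + 1)) k, ∃ v ∈ KCh Al l (fun a => (bk X (B a)).mulVecLin), v 0 = u}
  let U := Submodule.span k G
  have hker : LinearMap.ker Al ≤ U := by
    intro u hu
    refine subset_span ⟨1, fun _ => 0, fun a => if a = 0 then u else 0, ⟨fun a => ?_, fun a ha => ?_⟩, rfl⟩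
    · rcases Nat.eq_zero_or_pos a with rfl | ha
      · simpa using hu
      · simp [ha.ne']
    · simp [show a ≠ 0 by omega]
  have hU : ∀ T : κ → Matrix (Fin (d + 1)) (Fin (d + 1)) k,
      U.map (bk X T).mulVecLin ≤ U.map Al := by
    intro T
    rw [Submodule.map_span_le]
    rintro u ⟨l, B, v, hv, rfl⟩
    let B' : ℕ → κ → Matrix (Fin (d + 1)) (Fin (d + 1)) k := fun a => Nat.casesOn a T B
    obtain ⟨w, hw⟩ := KShift_surj Al l (fun a => (bk X (B' a)).mulVecLin)
      (KCh_lower (l + 1) X A B' (hrank _ _)) ⟨v, hv⟩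
    have h1 := w.2.1 0
    have h2 : w.1 1 = v 0 := congrFun (congrArg Subtype.val hw) 0
    rw [zero_add, h2] at h1
    refine ⟨-w.1 0, U.neg_mem (subset_span ⟨_, B', w.1, w.2, rfl⟩), ?_⟩
    rw [map_neg, neg_eq_iff_add_eq_zero]; exact h1
  let sl (i : Fin (d + 1)) : (C × Fin (d + 1) → k) →ₗ[k] (C → k) :=
    funLeft k k (fun c => (c, i))
  let U0 : Submodule k (C → k) := ⨆ i, U.map (sl i)
  let W0 : Submodule k (R → k) := ⨆ e, U0.map (X e).mulVecLin
  have h1 : finrank k U ≤ (d + 1) * finrank k U0 := by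
    let f : U →ₗ[k] (Fin (d + 1) → U0) := LinearMap.pi fun i =>
      (sl i).restrict (p := U) (q := U0) (fun u hu =>
        (le_iSup (fun i => U.map (sl i)) i) (mem_map_of_mem hu))
    have hf : Injective f := by
      intro u v h
      ext ⟨c, i⟩
      exact congrFun (congrArg Subtype.val (congrFun h i)) c
    have := finrank_le_finrank_of_injective hf
    rwa [finrank_pi_fintype, sum_const, card_univ, card_fin,
      smul_eq_mul] at this
  have h2 : (d + 1) * finrank k W0 ≤ finrank k (U.map Al) := by
    let emb (j : Fin (d + 1)) : (R → k) →ₗ[k] (R × Fin (d + 1) → k) :=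
      { toFun := fun w p => if p.2 = j then w p.1 else 0
        map_add' := fun _ _ => by ext; simp only [Pi.add_apply]; split_ifs <;> simp
        map_smul' := fun _ _ => by ext; simp }
    have hemb : ∀ j, W0 ≤ (U.map Al).comap (emb j) := by
      intro j
      refine iSup_le fun e => ?_
      rw [map_le_iff_le_comap]
      refine iSup_le fun i => ?_
      rw [map_le_iff_le_comap]
      intro u hu
      simp only [Submodule.mem_comap]
      refine hU (fun e' => if e' = e then Matrix.single j i 1 else 0) ⟨u, hu, ?_⟩
      ext p
      rw [Matrix.mulVecLin_apply, bk_mulVec, sum_eq_single e]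
      · rw [sum_eq_single i]
        · by_cases hp : p.2 = j
          · simp [emb, sl, hp, Matrix.mulVec, dotProduct, funLeft]
          · simp [emb, hp, Matrix.single_apply, Ne.symm hp]
        · intro b _ hb
          simp [Matrix.single_apply, hb.symm]
        · simp
      · intro b _ hb; simp [hb]
      · simp
    let f : (Fin (d + 1) → W0) →ₗ[k] U.map Al :=
      { toFun := fun w => ⟨fun p => (w p.2).1 p.1, by
          have : (fun p : R × Fin (d + 1) => (w p.2).1 p.1) = ∑ j, emb j (w j).1 := by
            ext p; simp [emb, Finset.sum_apply]
          rw [this]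
          exact Submodule.sum_mem _ fun j _ => hemb j (w j).2⟩
        map_add' := fun _ _ => rfl
        map_smul' := fun _ _ => rfl }
    have hf : Injective f := by
      intro u v h
      ext j r
      exact congrFun (congrArg Subtype.val h) (r, j)
    have := finrank_le_finrank_of_injective hf
    rwa [finrank_pi_fintype, sum_const, card_univ, card_fin,
      smul_eq_mul] at this
  have h3 : finrank k (U.map Al) + finrank k (LinearMap.ker Al) = finrank k U := by
    have := (Al.domRestrict U).finrank_range_add_finrank_ker
    rw [LinearMap.range_domRestrict, LinearMap.ker_domRestrict] at this
    rw [← this, (Submodule.comapSubtypeEquivOfLe hker).finrank_eq]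
  have h4 : (d + 1) * finrank k U0 ≤ (d + 1) * finrank k W0 :=
    Nat.mul_le_mul_left _ (hs U0)
  exact Submodule.finrank_eq_zero.1 (by omega)
end Shrunk
section Descent
variable {k κ R C : Type} [Field k] [Fintype κ] [Fintype R] [Fintype C]
theorem rank_eq_of_ker {m n : Type} [Fintype m] [Fintype n] (M : Matrix m n k) :
    LinearMap.ker M.mulVecLin = ⊥ ↔ M.rank = Fintype.card n := by
  have := M.mulVecLin.finrank_range_add_finrank_ker
  change M.rank + _ = _ at this
  rw [finrank_fintype_fun_eq_card] at this
  rw [← Submodule.finrank_eq_zero (R := k)]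
  omega
theorem li_rows {m n : Type} [Fintype m] [Fintype n] (M : Matrix m n k)
    (h : M.rank = Fintype.card m) : LinearIndependent k M.row := by
  rw [linearIndependent_iff_card_eq_finrank_span, ← h, Matrix.rank_eq_finrank_span_row]; rfl
theorem full_mult (X : κ → Matrix R C k) (d l : ℕ) (A : κ → Mdk)
    (hA : LinearMap.ker (bk X A).mulVecLin = ⊥) :
    ∃ T : κ → Matrix (Fin (l * d)) (Fin (l * d)) k, (bk X T).rank = Fintype.card C * (l * d) := by
  refine ⟨fun c => (Tch l A 0 c).submatrix finProdFinEquiv.symm finProdFinEquiv.symm, ?_⟩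
  rw [bk_rank_reindex]
  have := (rank_eq_of_ker (bk X (Tch l A 0))).1 (by
    rw [ker_eq_bot']
    intro u hu
    ext ⟨c, a, i⟩
    have h : wch l u a = 0 := by
      rw [ker_eq_bot'] at hA
      apply hA
      ext p
      have := Tch_mulVec l X A 0 u a a.2 p
      rw [Matrix.mulVecLin_apply] at hu ⊢
      rw [hu] at this
      have h0 : bk X ((0 : ℕ → κ → Mdk) a) = 0 := by ext; simp [bk, bl]
      rw [h0] at this
      simpa using this
    have := congrFun h (c, i)
    simpa [wch] using this)
  simpa using this
theorem full_desc [Infinite k] (X : κ → Matrix R C k) (hRC : Fintype.card R = Fintype.card C)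
    (d : ℕ) (hd : Fintype.card C ≤ d) (hC : 0 < Fintype.card C)
    (T : κ → Matrix (Fin (d + 1)) (Fin (d + 1)) k) (hT : (bk X T).rank = Fintype.card C * (d + 1)) :
    ∃ T : κ → Mdk, (bk X T).rank = Fintype.card C * d := by
  classical
  set n := Fintype.card C
  let M := (bk X T).submatrix (fun p : R × Fin d => (p.1, p.2.castSucc)) id
  have hM : M.rank = n * d := by
    have h1 : LinearIndependent k (bk X T).row := li_rows _ (by rw [hT]; simp [hRC, n])
    have h2 : LinearIndependent k M.row := h1.comp (fun p : R × Fin d => (p.1, p.2.castSucc))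
      (fun p q h => by simpa [Prod.ext_iff] using h)
    rw [h2.rank_matrix]; simp [hRC, n]
  obtain ⟨g, hg1, hg2⟩ := exists_indep_cols M
  have hli : LinearIndependent k (M.submatrix id g)ᵀ.row := li_rows _ (by rw [rank_transpose, hg2]; simp)
  obtain ⟨b, hb⟩ : ∃ b : Fin (d + 1), (univ.filter fun i => (g i).2 = b).card < n := by
    by_contra! hc
    have := Finset.card_eq_sum_card_fiberwise (s := (univ : Finset (Fin M.rank)))
      (t := (univ : Finset (Fin (d + 1)))) (f := fun i => (g i).2) (by simp)
    have h2 := sum_le_sum (fun b (_ : b ∈ (univ : Finset (Fin (d + 1)))) => hc b)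
    rw [← this] at h2
    simp [hM] at h2
    nlinarith
  let T' : κ → Mdk := fun e => (T e).submatrix Fin.castSucc b.succAbove
  have hT' : n * d < (bk X T').rank + n := by
    let S := {i : Fin M.rank // (g i).2 ≠ b}
    have hS : n * d < Fintype.card S + n := by
      have := Fintype.card_subtype_compl (fun i : Fin M.rank => (g i).2 = b)
      rw [card_fin] at this
      have h2 := Fintype.card_subtype (fun i : Fin M.rank => (g i).2 = b)
      change Fintype.card S = _ at this
      omega
    choose z hz using fun i : S => Fin.exists_succAbove_eq i.2
    have h1 : (fun i : S => (M.submatrix id g)ᵀ.row i.1) =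
        ((bk X T').submatrix id (fun i : S => ((g i.1).1, z i)))ᵀ.row := by
      ext i p
      simp only [Matrix.row, M, bk, bl, T', Matrix.transpose_apply, Matrix.submatrix_apply, Matrix.of_apply, hz, id]
      rfl
    have h2 := hli.comp (Subtype.val : S → _) val_injective
    change LinearIndependent k (fun i : S => (M.submatrix id g)ᵀ.row i.1) at h2
    rw [h1] at h2
    have h3 := h2.rank_matrix
    rw [rank_transpose] at h3
    have h4 := rank_submatrix_le (bk X T') id (fun i : S => ((g i.1).1, z i))
    omega
  have : NeZero d := ⟨by omega⟩
  obtain ⟨T0, h1, q, h2⟩ := reg X d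
  refine ⟨T0, ?_⟩
  have h3 := h1 T'
  have h4 := rank_le_card_width (bk X T0)
  rw [card_prod, card_fin] at h4
  change _ ≤ n * d at h4
  change (bk X T0).rank = d * q at h2
  change (bk X T').rank ≤ (bk X T0).rank at h3
  have h5 : q = n := by
    rw [h2] at h3 h4
    have : q ≤ n := by nlinarith [NeZero.pos d]
    by_contra hne
    have : q + 1 ≤ n := by omega
    have : d * (q + 1) ≤ d * n := Nat.mul_le_mul_left _ this
    nlinarith
  rw [h2, h5, mul_comm]
theorem nc_rank [Infinite k] (X : κ → Matrix R C k) (hRC : Fintype.card R = Fintype.card C)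
    (hC : 0 < Fintype.card C)
    (hs : ∀ U : Submodule k (C → k), finrank k U ≤
      finrank k (⨆ e, U.map (X e).mulVecLin : Submodule k (R → k))) :
    ∃ T : κ → Matrix (Fin (Fintype.card C)) (Fin (Fintype.card C)) k,
      LinearMap.ker (bk X T).mulVecLin = ⊥ := by
  obtain ⟨d, hd, A, hA⟩ := exists_full X hs
  obtain ⟨T, hT⟩ := full_mult X d (Fintype.card C) A hA
  have key : ∀ j, (∃ T : κ → Matrix (Fin (Fintype.card C + j)) (Fin (Fintype.card C + j)) k,
      (bk X T).rank = Fintype.card C * (Fintype.card C + j)) →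
      ∃ T : κ → Matrix (Fin (Fintype.card C)) (Fin (Fintype.card C)) k,
        (bk X T).rank = Fintype.card C * Fintype.card C := by
    intro j
    induction j with
    | zero => exact id
    | succ j ih =>
      rintro ⟨T, hT⟩
      exact ih (full_desc X hRC _ (by omega) hC T hT)
  obtain ⟨j, hj⟩ : ∃ j, Fintype.card C * d = Fintype.card C + j :=
    ⟨Fintype.card C * d - Fintype.card C, by
      have := le_mul_of_pos_right (Fintype.card C) hd
      omega⟩
  have hT' : ∃ T : κ → Matrix (Fin (Fintype.card C * d)) (Fin (Fintype.card C * d)) k,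
    (bk X T).rank = Fintype.card C * (Fintype.card C * d) := ⟨T, hT⟩
  rw [hj] at hT'
  obtain ⟨T, hT⟩ := key j hT'
  exact ⟨T, (rank_eq_of_ker _).2 (by simpa using hT)⟩
end Descent
section Base
variable {Q0 Q1 : Type} (ta ha : Q1 → Q0) (α : Q0 → ℕ)
abbrev Vr := (a : Q1) × (Fin (α (ha a)) × Fin (α (ta a)))
section
variable {Q0 Q1 : Type} (ta ha : Q1 → Q0) (α : Q0 → ℕ) (K R h i hp N d σ e s k V v : ℕ)
set_option hygiene false
notation "VV" => Vr ta ha α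
notation "PK" => MvPolynomial (Vr ta ha α) K
notation "PR" => MvPolynomial (Vr ta ha α) R
end
abbrev Mt (R : Type) := (i : Q0) → Matrix Fai Fai R
variable {ta ha α}
def cact {R : Type} [CommRing R] (B A : Mt α R) (v : VV → R) : VV → R := fun p =>
  (B (ha p.1) * (Matrix.of fun r c => v ⟨p.1, (r, c)⟩) * A (ta p.1)) p.2.1 p.2.2
theorem cact_cact {R : Type} [CommRing R] (B A B' A' : Mt α R) (v : VV → R) :
    cact B' A' (cact B A v) = cact (fun i => B' i * B i) (fun i => A i * A' i) v := by
  ext p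
  have : (Matrix.of fun r c => cact B A v ⟨p.1, (r, c)⟩) =
    B (ha p.1) * (Matrix.of fun r c => v ⟨p.1, (r, c)⟩) * A (ta p.1) := by ext; rfl
  simp only [cact] at this ⊢
  rw [this]; simp only [Matrix.mul_assoc]
theorem cact_map {R R' : Type} [CommRing R] [CommRing R'] (φ : R →+* R') (B A : Mt α R)
    (v : VV → R) : (fun p => φ (cact B A v p)) =
      cact (fun i => (B i).map φ) (fun i => (A i).map φ) (fun p => φ (v p)) := by
  ext p
  simp [cact, Matrix.mul_apply]
variable [DecidableEq Q0]
def wtm (m : VV →₀ ℕ) (i : Q0) (k : Fai) : ℤ :=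
  m.sum fun p e => (e : ℤ) * ((if (⟨ta p.1, p.2.2⟩ : Σ i, Fai) = ⟨i, k⟩ then 1 else 0)
    - if (⟨ha p.1, p.2.1⟩ : Σ i, Fai) = ⟨i, k⟩ then 1 else 0)
def tvm {R : Type} [CommRing R] (i : Q0) (k l : Fai) (z : R) : Mt α R :=
  update 1 i (Matrix.transvection k l z)
def tva {R : Type} [CommRing R] (i : Q0) (k l : Fai) (z : R) (v : VV → R) :
    VV → R := cact (tvm i k l (-z)) (tvm i k l z) v
theorem tva_map {R R' : Type} [CommRing R] [CommRing R'] (φ : R →+* R') (i : Q0) (k l : Fai)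
    (z : R) (v : VV → R) : (fun p => φ (tva i k l z v p)) =
      tva i k l (φ z) (fun p => φ (v p)) := by
  have h : ∀ z, (fun j => (tvm (α := α) i k l z j).map φ) = tvm i k l (φ z) := by
    intro z; funext j
    by_cases hj : j = i
    · subst hj
      ext a b
      simp only [tvm, update_self, Matrix.transvection, Matrix.map_apply, Matrix.add_apply,
        Matrix.one_apply, Matrix.single_apply, map_add, apply_ite φ, map_one, map_zero]
    · simp only [tvm, update_of_ne hj, Pi.one_apply]
      exact Matrix.map_one φ φ.map_zero φ.map_one
  rw [tva, cact_map, h, h, map_neg]; rfl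
noncomputable abbrev tvX (R : Type) [CommRing R] (i : Q0) (k l : Fai) :
    VV → Polynomial PR :=
  tva (R := Polynomial PR) i k l Polynomial.X (fun p => Polynomial.C (X p))
def IsL {R : Type} [CommRing R] (χ : Q0 → ℤ) (f : PR) : Prop :=
  (∀ m ∈ f.support, ∀ i k, wtm m i k = χ i) ∧ ∀ (i : Q0) (k l : Fai), k ≠ l →
    aeval (tvX R i k l) f = Polynomial.C f
theorem IsL.tv {R R' : Type} [CommRing R] [CommRing R'] [Algebra R R'] {χ : Q0 → ℤ}
    {f : PR} (hf : IsL χ f) (i : Q0) (k l : Fai) (h : k ≠ l) (z : R')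
    (v : VV → R') : aeval (tva i k l z v) f = aeval v f := by
  have := congrArg (eval₂RingHom (aeval v).toRingHom z) (hf.2 i k l h)
  rw [coe_eval₂RingHom, Polynomial.eval₂_C] at this
  refine Eq.trans ?_ this
  rw [← coe_eval₂RingHom]
  change _ = ((eval₂RingHom (aeval v).toRingHom z).comp (aeval (tvX R i k l)).toRingHom) f
  change (aeval (tva i k l z v)).toRingHom f = _
  congr 1
  apply ringHom_ext
  · intro r; simp [algebraMap_eq, Polynomial.algebraMap_apply]
  · intro p
    have := congrFun (tva_map (R := Polynomial (MvPolynomial VV _)) (eval₂RingHom (aeval v).toRingHom z) i k l Polynomial.X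
      (fun p : VV => Polynomial.C (X p : MvPolynomial _ R))) p
    simp only [coe_eval₂RingHom, Polynomial.eval₂_X, Polynomial.eval₂_C] at this
    simp only [toRingHom_eq_coe, coe_coe, aeval_X, RingHom.comp_apply,
      coe_eval₂RingHom]
    rw [toRingHom_eq_coe] at this
    rw [this]; simp
theorem tv_of_scalars {K : Type} [Field K] [Infinite K] {f : PK}
    (i : Q0) (k l : Fai) (h : ∀ z : K, aeval (tva i k l (C z) (fun p => (X p))) f = f) :
    aeval (tvX K i k l) f = Polynomial.C f := by
  rw [← sub_eq_zero]
  apply eq_zero_of_infinite_isRoot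
  refine Set.Infinite.mono (s := Set.range (C : K → PK)) ?_
    (Set.infinite_range_of_injective (C_injective _ _))
  rintro _ ⟨z, rfl⟩
  change Polynomial.eval _ _ = 0
  rw [Polynomial.eval_sub, Polynomial.eval_C, sub_eq_zero]
  refine Eq.trans ?_ (h z)
  rw [← coe_evalRingHom]
  change ((evalRingHom (C z)).comp (aeval (tvX K i k l)).toRingHom) f = (aeval (tva i k l (C z) fun p => X p)).toRingHom f
  congr 1
  apply ringHom_ext
  · intro r; simp [algebraMap_eq, Polynomial.algebraMap_apply]
  · intro p
    have := congrFun (tva_map (R := Polynomial (MvPolynomial VV _)) (evalRingHom (C z)) i k l Polynomial.X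
      (fun p : VV => Polynomial.C (X p : MvPolynomial _ K))) p
    simpa using this
end Base
section Base2
variable {Q0 Q1 : Type} [Fintype Q0] [DecidableEq Q0] {ta ha : Q1 → Q0} {α : Q0 → ℕ}
theorem wtm_add (m m' : VV →₀ ℕ) (i : Q0) (k : Fai) :
    wtm (m + m') i k = wtm m i k + wtm m' i k := by
  rw [wtm, sum_add_index']
  · rfl
  · simp
  · intros; push_cast; ring
theorem wtm_zero (i : Q0) (k : Fai) : wtm (0 : VV →₀ ℕ) i k = 0 := by simp [wtm]
theorem prod_wtm {G : Type} [CommGroup G] (D : (i : Q0) → Fai → G) (m : VV →₀ ℕ) :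
    m.prod (fun p e => ((D (ha p.1) p.2.1)⁻¹ * D (ta p.1) p.2.2) ^ e) =
      ∏ i, ∏ k, D i k ^ wtm m i k := by
  induction m using induction_linear with
  | zero => simp [wtm_zero]
  | add m m' h h' =>
    rw [Finsupp.prod_add_index' (by simp) (by intros; rw [pow_add]), h, h']
    simp only [wtm_add, _root_.zpow_add, prod_mul_distrib]
  | single p e =>
    rw [Finsupp.prod_single_index (by simp)]
    have : ∀ i k, wtm (Finsupp.single p e) i k = (e : ℤ) *
      ((if (⟨ta p.1, p.2.2⟩ : Σ i, Fai) = ⟨i, k⟩ then 1 else 0)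
    - if (⟨ha p.1, p.2.1⟩ : Σ i, Fai) = ⟨i, k⟩ then 1 else 0) := by
      intro i k; rw [wtm, sum_single_index]; simp
    simp only [this]
    rw [← prod_sigma' (fun i k => D i k ^ ((e : ℤ) *
      ((if (⟨ta p.1, p.2.2⟩ : Σ i, Fai) = ⟨i, k⟩ then 1 else 0)
    - if (⟨ha p.1, p.2.1⟩ : Σ i, Fai) = ⟨i, k⟩ then 1 else 0)))]
    simp only [mul_comm (e : ℤ), _root_.zpow_mul, zpow_natCast, _root_.zpow_sub, prod_pow,
      prod_mul_distrib, Finset.prod_inv_distrib, Sigma.eta]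
    rw [prod_eq_single (⟨ta p.1, p.2.2⟩ : Σ i, Fai),
      prod_eq_single (⟨ha p.1, p.2.1⟩ : Σ i, Fai)]
    · simp [mul_comm]
    · intro b _ hb; simp [hb.symm]
    · simp
    · intro b _ hb; simp [hb.symm]
    · simp
theorem cact_diag {R : Type} [CommRing R] (D : (i : Q0) → Fai → Rˣ) (v : VV → R)
    (p : VV) :
    cact (fun i => diagonal fun k => ((D i k)⁻¹ : Rˣ).1) (fun i => diagonal fun k => (D i k).1) v p
      = ((((D (ha p.1) p.2.1)⁻¹ * D (ta p.1) p.2.2 : Rˣ)) : R) * v p := by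
  simp only [cact, Matrix.mul_diagonal, Matrix.diagonal_mul, Matrix.of_apply, val_mul]
  ring
theorem aeval_diag {R R' : Type} [CommRing R] [CommRing R'] [Algebra R R']
    (f : PR) (D : (i : Q0) → Fai → R'ˣ) (v : VV → R') :
    aeval (cact (fun i => diagonal fun k => ((D i k)⁻¹ : R'ˣ).1)
      (fun i => diagonal fun k => (D i k).1) v) f =
    ∑ m ∈ f.support, ((∏ i, ∏ k, D i k ^ wtm m i k : R'ˣ) : R') *
      aeval v (monomial m (f.coeff m)) := by
  conv_lhs => rw [f.as_sum, map_sum]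
  refine sum_congr rfl fun m _ => ?_
  rw [aeval_monomial, aeval_monomial, ← prod_wtm]
  simp only [cact_diag, mul_pow, Finsupp.prod_mul]
  rw [mul_left_comm]
  congr 2
  simp only [Finsupp.prod, ← prod_mul_distrib, ← mul_pow, coe_prod, val_pow_eq_pow_val, ← mul_pow]
theorem IsL.diag {R R' : Type} [CommRing R] [CommRing R'] [Algebra R R'] {χ : Q0 → ℤ}
    {f : PR} (hf : IsL χ f) (D : (i : Q0) → Fai → R'ˣ)
    (v : VV → R') :
    aeval (cact (fun i => diagonal fun k => ((D i k)⁻¹ : R'ˣ).1)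
      (fun i => diagonal fun k => (D i k).1) v) f = ((∏ i, (∏ k, D i k) ^ χ i : R'ˣ) : R') * aeval v f := by
  rw [aeval_diag]
  conv_rhs => rw [f.as_sum, map_sum, Finset.mul_sum]
  refine sum_congr rfl fun m hm => ?_
  congr 2
  refine prod_congr rfl fun i _ => ?_
  rw [← prod_zpow]
  exact prod_congr rfl fun k _ => by rw [hf.1 m hm]
theorem cact_one {R : Type} [CommRing R] (v : VV → R) : cact 1 1 v = v := by
  ext p; simp [cact]
abbrev GLa (α : Q0 → ℕ) (F : Type) [Field F] := (i : Q0) → GeneralLinearGroup Fai F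
def chr {F : Type} [Field F] (χ : Q0 → ℤ) (A : GLa α F) : F := ∏ i, (A i).val.det ^ χ i
theorem chr_mul {F : Type} [Field F] (χ : Q0 → ℤ) (A B : GLa α F) :
    chr χ (A * B) = chr χ A * chr χ B := by
  simp [chr, mul_zpow, prod_mul_distrib]
theorem chr_one {F : Type} [Field F] (χ : Q0 → ℤ) : chr χ (1 : GLa α F) = 1 := by
  simp [chr]
def gact {F : Type} [Field F] (A : GLa α F) (v : VV → F) : VV → F :=
  cact (fun i => ((A i)⁻¹).val) (fun i => (A i).val) v
theorem gact_mul {F : Type} [Field F] (A B : GLa α F) (v : VV → F) :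
    gact (A * B) v = gact B (gact A v) := by
  rw [gact, gact, gact, cact_cact]
  congr 1
theorem gact_one {F : Type} [Field F] (v : VV → F) : gact (1 : GLa α F) v = v := by
  rw [gact]; convert cact_one v <;> simp <;> rfl
def goodG {K F : Type} [Field K] [Field F] [Algebra K F] (χ : Q0 → ℤ) (f : PK) :
    Submonoid (GLa α F) where
  carrier := {A | ∀ v : VV → F, aeval (gact A v) f = chr χ A * aeval v f}
  one_mem' v := by rw [gact_one, chr_one, one_mul]
  mul_mem' {A B} hA hB v := by rw [gact_mul, hB, hA, chr_mul]; ring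
theorem IsL.gl {K F : Type} [Field K] [Field F] [Algebra K F] {χ : Q0 → ℤ}
    {f : PK} (hf : IsL χ f) (A : GLa α F) (v : VV → F) :
    aeval (gact A v) f = chr χ A * aeval v f := by
  suffices h : A ∈ goodG χ f from h v
  apply Submonoid.pi_mem_of_mulSingle_mem
  intro i
  have key : ∀ (M : Matrix Fai Fai F), M.det ≠ 0 → ∀ (B : GeneralLinearGroup Fai F),
      B.val = M → (mulSingle i B : GLa α F) ∈ goodG (ta := ta) (ha := ha) χ f := by
    intro M hM
    refine Matrix.diagonal_transvection_induction_of_det_ne_zero (fun M =>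
      ∀ (B : GeneralLinearGroup Fai F),
      B.val = M → (mulSingle i B : GLa α F) ∈ goodG (ta := ta) (ha := ha) χ f) M hM ?_ ?_ ?_
    · intro D hD B hB v
      rw [Matrix.det_diagonal, prod_ne_zero_iff] at hD
      let D' : Fai → Fˣ := fun k => Units.mk0 (D k) (hD k (by simp))
      have := hf.diag (R' := F) (mulSingle i D') v
      have hB0 : B = ⟨diagonal D, diagonal (fun k => (D' k)⁻¹.1), by
          rw [diagonal_mul_diagonal, ← diagonal_one]; congr 1; funext k; exact (D' k).mul_inv, by
          rw [diagonal_mul_diagonal, ← diagonal_one]; congr 1; funext k; exact (D' k).inv_mul⟩ := by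
        ext1; exact hB
      convert this using 2
      · rw [gact]
        refine congrArg (fun w => aeval w) (congrArg₂ (fun a b => cact a b v) ?_ ?_) <;> funext j <;> by_cases hj : j = i
        · subst hj; simp only [mulSingle_eq_same]; rw [hB0]; rfl
        · simp only [mulSingle_eq_of_ne hj]; simp
        · subst hj; simp only [mulSingle_eq_same]; rw [hB0]; rfl
        · simp only [mulSingle_eq_of_ne hj]; simp
      · rw [chr, coe_prod]
        refine prod_congr rfl fun j _ => ?_
        by_cases hj : j = i
        · subst hj; simp only [mulSingle_eq_same]; rw [hB]; simp [D', coe_prod]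
        · simp only [mulSingle_eq_of_ne hj]; simp
    · intro t B hB v
      have hB0 : B = ⟨transvection t.i t.j t.c, transvection t.i t.j (-t.c), by
          rw [transvection_mul_transvection_same _ _ t.hij]; simp, by
          rw [transvection_mul_transvection_same _ _ t.hij]; simp⟩ := by
        ext1; exact hB
      have h1 : gact (mulSingle i B) v = tva i t.i t.j t.c v := by
        rw [gact, tva]
        refine congrArg₂ (fun a b => cact a b v) ?_ ?_ <;> funext j <;> by_cases hj : j = i
        · subst hj; simp only [mulSingle_eq_same, tvm, update_self]; rw [hB0]; rfl
        · simp only [mulSingle_eq_of_ne hj, tvm, update_of_ne hj]; simp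
        · subst hj; simp only [mulSingle_eq_same, tvm, update_self]; rw [hB0]
        · simp only [mulSingle_eq_of_ne hj, tvm, update_of_ne hj]; simp
      have h2 : chr χ (mulSingle i B : GLa α F) = 1 := by
        refine prod_eq_one fun j _ => ?_
        by_cases hj : j = i
        · subst hj; simp only [mulSingle_eq_same]; rw [hB, TransvectionStruct.det]; simp
        · simp only [mulSingle_eq_of_ne hj]; simp
      rw [h1, h2, one_mul, hf.tv _ _ _ t.hij]
    · intro M N hM hN h1 h2 B hB
      let B1 := GeneralLinearGroup.mkOfDetNeZero M hM
      let B2 := GeneralLinearGroup.mkOfDetNeZero N hN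
      have : B = B1 * B2 := by ext1; rw [hB]; rfl
      rw [this, mulSingle_mul]
      exact Submonoid.mul_mem _ (h1 B1 rfl) (h2 B2 rfl)
  exact key _ (by exact (A i).det.ne_zero) (A i) rfl
end Base2
section Base3
variable {Q0 Q1 : Type} [Fintype Q0] [DecidableEq Q0] {ta ha : Q1 → Q0} {α : Q0 → ℕ}
def dgl {F : Type} [Field F] (D : (i : Q0) → Fai → Fˣ) : GLa α F := fun i =>
  ⟨diagonal fun k => (D i k).1, diagonal fun k => (D i k)⁻¹.1,
    by rw [diagonal_mul_diagonal, ← diagonal_one]; congr 1; funext k; exact (D i k).mul_inv,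
    by rw [diagonal_mul_diagonal, ← diagonal_one]; congr 1; funext k; exact (D i k).inv_mul⟩
def tgl {F : Type} [Field F] (i : Q0) (k l : Fai) (h : k ≠ l) (z : F) : GLa α F :=
  mulSingle i ⟨transvection k l z, transvection k l (-z),
    by rw [transvection_mul_transvection_same _ _ h]; simp,
    by rw [transvection_mul_transvection_same _ _ h]; simp⟩
theorem gact_tgl {F : Type} [Field F] (i : Q0) (k l : Fai) (h : k ≠ l) (z : F)
    (v : VV → F) : gact (tgl i k l h z) v = tva i k l z v := by
  rw [gact, tva, tgl]
  refine congrArg₂ (fun a b => cact a b v) ?_ ?_ <;> funext j <;> by_cases hj : j = i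
  · subst hj; simp only [mulSingle_eq_same, tvm, update_self]; rfl
  · simp only [mulSingle_eq_of_ne hj, tvm, update_of_ne hj]; simp
  · subst hj; simp only [mulSingle_eq_same, tvm, update_self]
  · simp only [mulSingle_eq_of_ne hj, tvm, update_of_ne hj]; simp
theorem chr_tgl {F : Type} [Field F] (χ : Q0 → ℤ) (i : Q0) (k l : Fai) (h : k ≠ l) (z : F) :
    chr χ (tgl i k l h z) = 1 := by
  refine prod_eq_one fun j _ => ?_
  by_cases hj : j = i
  · subst hj; simp only [tgl, mulSingle_eq_same]; rw [det_transvection_of_ne _ _ h]; simp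
  · simp only [tgl, mulSingle_eq_of_ne hj]; simp
theorem zpow_inj_of_infinite {K : Type} [Field K] [Infinite K] {a b : ℤ}
    (h : ∀ t : Kˣ, t ^ a = t ^ b) : a = b := by
  by_contra hab
  have h1 : ∀ t : Kˣ, t ^ (a - b).natAbs = 1 := by
    intro t
    have : t ^ (a - b) = 1 := by rw [_root_.zpow_sub, h, mul_inv_cancel]
    rcases Int.natAbs_eq (a - b) with h' | h' <;> rw [h'] at this
    · simpa using this
    · simpa using this
  have h0 : 0 < (a - b).natAbs := natAbs_pos.2 (sub_ne_zero.2 hab)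
  have h2 : (Polynomial.X ^ ((a - b).natAbs + 1) - Polynomial.X : Polynomial K) = 0 := by
    apply eq_zero_of_infinite_isRoot
    refine Set.infinite_univ.mono fun t _ => ?_
    change Polynomial.eval _ _ = 0
    simp only [Polynomial.eval_sub, Polynomial.eval_pow, Polynomial.eval_X]
    by_cases ht : t = 0
    · simp [ht]
    · have := congrArg Units.val (h1 (Units.mk0 t ht))
      simp only [val_pow_eq_pow_val, Units.val_mk0, val_one] at this
      rw [pow_succ, this]; ring
  have h3 := congrArg (fun q => Polynomial.coeff q 1) h2
  simp only [Polynomial.coeff_sub, Polynomial.coeff_X_pow, Polynomial.coeff_X_one, Polynomial.coeff_zero] at h3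
  rw [if_neg (by omega)] at h3
  simp at h3
theorem isL_of_gl {K : Type} [Field K] [Infinite K] {χ : Q0 → ℤ} {f : PK}
    (h : ∀ (A : GLa α K) (v : VV → K), aeval (gact A v) f = chr χ A * aeval v f) :
    IsL χ f := by
  classical
  constructor
  · intro m hm i k
    apply zpow_inj_of_infinite (K := K)
    intro t
    let D : (i : Q0) → Fai → Kˣ := fun i' k' => if (⟨i', k'⟩ : Σ i, Fai) = ⟨i, k⟩ then t else 1
    have h1 : (∑ m ∈ f.support, C ((∏ i, ∏ k, D i k ^ wtm m i k : Kˣ) : K) * monomial m (f.coeff m))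
       = C (chr χ (dgl D)) * f := by
      apply MvPolynomial.funext
      intro v
      have := h (dgl D) v
      rw [show gact (dgl D) v = cact (fun i => diagonal fun k => ((D i k)⁻¹ : Kˣ).1)
        (fun i => diagonal fun k => (D i k).1) v from rfl, aeval_diag] at this
      simp only [map_sum, map_mul, eval_C]
      exact this
    have h2 := congrArg (coeff m) h1
    rw [coeff_C_mul, coeff_sum, sum_eq_single m] at h2
    · rw [coeff_C_mul, coeff_monomial, if_pos rfl] at h2
      have h3 := mul_right_cancel₀ (mem_support_iff.1 hm) h2
      rw [show chr χ (dgl D) = ((∏ i, (∏ k, D i k) ^ χ i : Kˣ) : K) by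
        simp [chr, dgl, coe_prod]] at h3
      have h4 := Units.ext h3
      simp only [← prod_zpow] at h4
      rw [← prod_sigma' (fun i k => D i k ^ wtm m i k),
        ← prod_sigma' (fun i k => D i k ^ χ i), prod_eq_single (⟨i, k⟩ : Σ i, Fai),
        prod_eq_single (⟨i, k⟩ : Σ i, Fai)] at h4
      · simpa [D] using h4
      · rintro b - hb; simp only [D]; rw [if_neg hb, _root_.one_zpow]
      · simp
      · rintro b - hb; simp only [D]; rw [if_neg hb, _root_.one_zpow]
      · simp
    · intro b _ hb; rw [coeff_C_mul, coeff_monomial, if_neg hb, mul_zero]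
    · intro h; exact absurd hm h
  · intro i k l hkl
    apply tv_of_scalars
    intro z
    apply MvPolynomial.funext
    intro v
    have := h (tgl i k l hkl z) v
    rw [gact_tgl, chr_tgl, one_mul] at this
    refine Eq.trans ?_ this
    change (aeval v) ((aeval (tva i k l (C z) (fun p => (X p)))) f) = _
    rw [← AlgHom.comp_apply, comp_aeval]
    have h2 := tva_map (aeval v : PK →ₐ[K] K).toRingHom i k l (C z) (fun p => X p)
    congr 2
    simpa using h2
theorem mem_SI_iff {K : Type} [Field K] [Infinite K] {χ : Q0 → ℤ} {f : PK} :
    f ∈ quiverSemiInvariantsOfWeight K ta ha α χ ↔ IsL χ f :=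
  ⟨fun h => isL_of_gl fun A v => h A (fun a => of fun r c => v ⟨a, (r, c)⟩),
    fun h A v => h.gl A (repCoords v)⟩
section cl
variable {R : Type} [CommRing R] {χ χ' : Q0 → ℤ} {f g : PR}
theorem IsL.zero : IsL χ (0 : PR) := ⟨by simp, by simp⟩
theorem IsL.add (hf : IsL χ f) (hg : IsL χ g) : IsL χ (f + g) := by
  classical
  refine ⟨fun m hm => ?_, fun i k l h => by rw [map_add, hf.2 i k l h, hg.2 i k l h, map_add]⟩
  rcases mem_union.1 (support_add hm) with h | h
  exacts [hf.1 m h, hg.1 m h]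
theorem IsL.C_ (r : R) : IsL 0 (C r : PR) := by
  classical
  refine ⟨fun m hm i k => ?_, fun i k l h => by simp [Polynomial.algebraMap_apply, algebraMap_eq]⟩
  rw [mem_support_iff, coeff_C] at hm
  rw [← (ite_ne_right_iff.1 hm).1, wtm_zero]; rfl
theorem IsL.mul (hf : IsL χ f) (hg : IsL χ' g) : IsL (χ + χ') (f * g) := by
  classical
  refine ⟨fun m hm i k => ?_, fun i k l h => by rw [map_mul, hf.2 i k l h, hg.2 i k l h, map_mul]⟩
  obtain ⟨a, ha, b, hb, rfl⟩ := mem_add.1 (support_mul f g hm)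
  rw [wtm_add, hf.1 a ha, hg.1 b hb]; rfl
theorem IsL.congr (hf : IsL χ f) (h : χ = χ') : IsL χ' f := h ▸ hf
theorem IsL.smul (r : R) (hf : IsL χ f) : IsL χ (C r * f) := ((IsL.C_ r).mul hf).congr (zero_add _)
theorem IsL.pow (hf : IsL χ f) (e : ℕ) : IsL ((e : ℤ) • χ) (f ^ e) := by
  induction e with
  | zero => simpa using IsL.C_ (1 : R)
  | succ e ih => rw [pow_succ]; exact (ih.mul hf).congr (by push_cast; rw [add_smul, one_smul])
end cl
end Base3
section Resum
theorem resum {S sl T : Type} [CommRing S] [Fintype sl] [DecidableEq sl] [Fintype T] [DecidableEq T]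
    (Ω : sl → Type) [∀ s, Fintype (Ω s)] [∀ s, DecidableEq (Ω s)] [∀ s, Nonempty (Ω s)]
    (g1 g2 : T → sl)
    (hg : ∀ s, Nontrivial (Ω s) → ∃! p : T ⊕ T, Sum.elim g1 g2 p = s)
    (ρ : ∀ s, Ω s → S) (hρ : ∀ s, Subsingleton (Ω s) → ∀ x, ρ s x = 1)
    (D : ∀ t, Ω (g1 t) → Ω (g2 t) → S) :
    ∑ L : ∀ s, Ω s, (∏ t, D t (L (g1 t)) (L (g2 t))) * ∏ s, ρ s (L s) =
      ∏ t, ∑ x : Ω (g1 t), ∑ y : Ω (g2 t), D t x y * ρ _ x * ρ _ y := by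
  have hbij : Bijective (fun (L : ∀ s, Ω s) (t : T) => (L (g1 t), L (g2 t))) := by
    constructor
    · intro L L' h
      funext s
      rcases subsingleton_or_nontrivial (Ω s) with hs | hs
      · exact Subsingleton.elim _ _
      · obtain ⟨p, hp, -⟩ := hg s hs
        rcases p with t | t
        · cases hp; exact (Prod.ext_iff.1 (congrFun h t)).1
        · cases hp; exact (Prod.ext_iff.1 (congrFun h t)).2
    · intro f
      have : ∀ s, ∃ x : Ω s, ∀ t, (∀ h : g1 t = s, x = h ▸ (f t).1) ∧ (∀ h : g2 t = s, x = h ▸ (f t).2) := by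
        intro s
        rcases subsingleton_or_nontrivial (Ω s) with hs | hs
        · exact ⟨Classical.arbitrary _, fun t => ⟨fun _ => Subsingleton.elim _ _, fun _ => Subsingleton.elim _ _⟩⟩
        · obtain ⟨p, hp, hu⟩ := hg s hs
          rcases p with t | t
          · refine ⟨hp ▸ (f t).1, fun t' => ⟨fun h => ?_, fun h => ?_⟩⟩
            · have := hu (Sum.inl t') h; cases this; rfl
            · have := hu (Sum.inr t') h; cases this
          · refine ⟨hp ▸ (f t).2, fun t' => ⟨fun h => ?_, fun h => ?_⟩⟩
            · have := hu (Sum.inl t') h; cases this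
            · have := hu (Sum.inr t') h; cases this; rfl
      choose L hL using this
      exact ⟨L, funext fun t => Prod.ext ((hL _ t).1 rfl) ((hL _ t).2 rfl)⟩
  have h1 : ∀ L : ∀ s, Ω s, ∏ s, ρ s (L s) = (∏ t, ρ _ (L (g1 t))) * ∏ t, ρ _ (L (g2 t)) := by
    intro L
    have : ∏ p : T ⊕ T, ρ _ (L (Sum.elim g1 g2 p)) = ∏ s, ρ s (L s) := by
      refine prod_bij_ne_one (fun p _ _ => Sum.elim g1 g2 p) (by simp) ?_ ?_ (by simp)
      · intro p _ hp q _ hq h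
        have hs : Nontrivial (Ω (Sum.elim g1 g2 p)) := by
          rcases subsingleton_or_nontrivial (Ω (Sum.elim g1 g2 p)) with hs | hs
          · exact absurd (hρ _ hs _) hp
          · exact hs
        exact (hg _ hs).unique rfl h.symm
      · intro s _ hs
        rcases subsingleton_or_nontrivial (Ω s) with hs' | hs'
        · exact absurd (hρ _ hs' _) hs
        · obtain ⟨p, hp, -⟩ := hg s hs'
          exact ⟨p, mem_univ _, by subst hp; exact hs, hp⟩
    rw [← this, prod_sum_type]; rfl
  simp_rw [← Fintype.sum_prod_type' (f := fun x y => D _ x y * ρ _ x * ρ _ y)]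
  rw [prod_univ_sum, piFinset_univ]
  refine Fintype.sum_bijective _ hbij _ _ fun L => ?_
  simp only [h1, prod_mul_distrib, mul_assoc]
def colop {S I : Type} [CommRing S] [DecidableEq I] (ι0 ι1 : I) (z : S) (M : Matrix I I S) : Matrix I I S :=
  of fun r c => M r c + if c = ι1 then z * M r ι0 else 0
theorem det_colop {S I n : Type} [CommRing S] [DecidableEq I] [Fintype n] [DecidableEq n]
    (ι0 ι1 : I) (z : S) (M : Matrix I I S) (R F : n → I) (hF : Injective F) :
    det (of fun p q => colop ι0 ι1 z M (R p) (F q)) = det (of fun p q => M (R p) (F q)) +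
      ∑ q, if F q = ι1 then z * det (of fun p q' => M (R p) (update F q ι0 q')) else 0 := by
  by_cases h : ∃ q, F q = ι1
  · obtain ⟨q0, hq0⟩ := h
    rw [sum_eq_single q0 (fun q _ hq => if_neg fun h => hq (hF (h.trans hq0.symm))) (by simp),
      if_pos hq0]
    have h1 : (of fun p q => colop ι0 ι1 z M (R p) (F q)) = updateCol (of fun p q => M (R p) (F q)) q0
        ((fun p => M (R p) (F q0)) + z • fun p => M (R p) ι0) := by
      ext p q
      by_cases hq : q = q0
      · subst hq; simp [colop, hq0]
      · have : F q ≠ ι1 := fun h => hq (hF (h.trans hq0.symm))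
        simp [colop, hq, this]
    rw [h1, det_updateCol_add, det_updateCol_smul]
    congr 2
    · congr 1; ext p q
      by_cases hq : q = q0
      · subst hq; simp
      · simp [hq]
    · congr 1; ext p q
      by_cases hq : q = q0
      · subst hq; simp
      · simp [hq]
  · push Not at h
    simp [h, colop]
end Resum
section Frames
variable {Q0 : Type} [DecidableEq Q0] {α : Q0 → ℕ}
abbrev Sl (α : Q0 → ℕ) := Σ i, Fin (α i + 1)
abbrev Om (s : Sl α) := Fin s.2.1 ↪o Fin (α s.1)
abbrev II (α : Q0 → ℕ) := Σ i, Fai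
section
variable (α S : ℕ)
set_option hygiene false
notation "MII" => Matrix (II α) (II α) S
end
def emb {s : Sl α} (J : Om s) : Fin s.2.1 → II α := fun j => ⟨s.1, J j⟩
theorem emb_inj {s : Sl α} (J : Om s) : Injective (emb J) := fun a b h => by
  simpa [emb] using h
theorem emb_inj' {s : Sl α} {J L : Om s} (h : emb J = emb L) : J = L := by
  ext j; have := congrFun h j; simp only [emb, Sigma.mk.injEq, heq_eq_eq, true_and] at this; rw [this]
def NN (ι0 ι1 : II α) {s : Sl α} (L J : Om s) : Prop :=
  ∃ j, emb J j = ι1 ∧ emb L = update (emb J) j ι0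
def Adj (ι0 ι1 : II α) : Prop := ∃ i, ∃ l0 l1 : Fai, ι0 = ⟨i, l0⟩ ∧ ι1 = ⟨i, l1⟩ ∧
  (l0.1 + 1 = l1.1 ∨ l1.1 + 1 = l0.1)
theorem exists_upd {ι0 ι1 : II α} (h : Adj ι0 ι1) {s : Sl α} (J : Om s) (j : Fin s.2.1)
    (hj : emb J j = ι1) (h0 : ∀ j', emb J j' ≠ ι0) : ∃ L : Om s, emb L = update (emb J) j ι0 := by
  obtain ⟨i, l0, l1, rfl, rfl, hl⟩ := h
  obtain ⟨i', k⟩ := s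
  have hi : i' = i := congrArg Sigma.fst hj
  subst hi
  simp only [emb, Sigma.mk.injEq, heq_eq_eq, true_and, ne_eq] at hj h0
  have hm : StrictMono (update (⇑J) j l0) := by
    intro a b hab
    have h1 := J.strictMono hab
    simp only [update_apply]
    have ha := h0 a; have hb := h0 b
    rw [Fin.ext_iff] at ha hb hj
    rw [lt_def] at h1 ⊢
    split_ifs with h2 h3 h3
    · rw [h2, h3] at hab; exact absurd hab (lt_irrefl _)
    · rw [h2] at h1; omega
    · rw [h3] at h1; omega
    · exact h1
  obtain ⟨L, hL⟩ : ∃ L : Om ⟨i', k⟩, ⇑L = update (⇑J) j l0 := ⟨OrderEmbedding.ofStrictMono _ hm, rfl⟩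
  · refine ⟨L, ?_⟩
    funext j'
    have := congrFun hL j'
    by_cases hj' : j' = j
    · subst hj'
      rw [update_self]; rw [update_self] at this; exact congrArg (Sigma.mk i') this
    · rw [update_of_ne hj']; rw [update_of_ne hj'] at this; exact congrArg (Sigma.mk i') this
open Classical in
noncomputable def rho {S : Type} [CommRing S] (ι0 ι1 : II α) (z : S) {s : Sl α} (L J : Om s) : S :=
  (if L = J then 1 else 0) + if NN ι0 ι1 L J then z else 0
theorem sum_rho {S : Type} [CommRing S] {ι0 ι1 : II α} (h : Adj ι0 ι1) (z : S) {s : Sl α} (J : Om s)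
    (G : (Fin s.2.1 → II α) → S) (hG : ∀ f, ¬ Injective f → G f = 0) :
    ∑ L : Om s, G (emb L) * rho ι0 ι1 z L J =
      G (emb J) + ∑ j, if emb J j = ι1 then z * G (update (emb J) j ι0) else 0 := by
  classical
  have hne : ι0 ≠ ι1 := by
    obtain ⟨i, l0, l1, rfl, rfl, hl⟩ := h
    simp only [ne_eq, Sigma.mk.injEq, heq_eq_eq, true_and]
    rintro rfl; omega
  simp only [rho, mul_add, sum_add_distrib]
  congr 1
  · rw [sum_eq_single J (fun L _ hL => by simp [hL]) (by simp)]; simp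
  by_cases h1 : ∃ j, emb J j = ι1
  · obtain ⟨j, hj⟩ := h1
    rw [sum_eq_single j (fun j' _ hj' => if_neg fun h' => hj' (emb_inj J (h'.trans hj.symm)))
      (by simp), if_pos hj]
    have hN : ∀ L : Om s, NN ι0 ι1 L J ↔ emb L = update (emb J) j ι0 := fun L =>
      ⟨fun ⟨j', h1, h2⟩ => by rw [h2, emb_inj J (h1.trans hj.symm)], fun h => ⟨j, hj, h⟩⟩
    by_cases h2 : ∃ j', emb J j' = ι0
    · obtain ⟨j', hj'⟩ := h2
      have hjj : j' ≠ j := by rintro rfl; exact hne (hj'.symm.trans hj)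
      have hni : ¬ Injective (update (emb J) j ι0) := fun hi =>
        hjj (hi (by simp [hjj, hj']))
      rw [hG _ hni, mul_zero]
      refine sum_eq_zero fun L _ => ?_
      rw [if_neg, mul_zero]
      rw [hN]; intro h; exact hni (h ▸ emb_inj L)
    · push Not at h2
      obtain ⟨L, hL⟩ := exists_upd h J j hj h2
      rw [sum_eq_single L]
      · rw [if_pos ((hN L).2 hL), hL, mul_comm]
      · intro L' _ hL'
        rw [if_neg, mul_zero]
        rw [hN, ← hL]; exact fun h => hL' (emb_inj' h)
      · simp
  · push Not at h1
    simp only [h1, if_false, sum_const_zero]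
    refine sum_eq_zero fun L _ => ?_
    rw [if_neg, mul_zero]
    rintro ⟨j, hj, -⟩; exact h1 j hj
theorem NN_symm {ι0 ι1 : II α} {s : Sl α} {L J : Om s} : NN ι0 ι1 L J ↔ NN ι1 ι0 J L := by
  have : ∀ {ι0 ι1 : II α} {L J : Om s}, NN ι0 ι1 L J → NN ι1 ι0 J L := by
    rintro ι0 ι1 L J ⟨j, hj, h⟩
    exact ⟨j, by rw [h]; simp, by rw [h, Function.update_idem, ← hj, update_eq_self]⟩
  exact ⟨this, this⟩
theorem rho_symm {S : Type} [CommRing S] {ι0 ι1 : II α} {z : S} {s : Sl α} {L J : Om s} :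
    rho ι0 ι1 z L J = rho ι1 ι0 z J L := by
  rw [rho, rho, propext (NN_symm (ι0 := ι0) (L := L))]
  congr 2; exact propext eq_comm
end Frames
section Fac
variable {Q0 : Type} [DecidableEq Q0] {α : Q0 → ℕ} {S : Type} [CommRing S]
theorem col_core {n : Type} [Fintype n] [DecidableEq n] {ι0 ι1 : II α} (h : Adj ι0 ι1) (z : S)
    (M : MII) (R : n → II α) {s t : Sl α} (hst : s.1 ≠ t.1)
    (E : n ≃ Fin s.2.1 ⊕ Fin t.2.1) (J : Om s) (J' : Om t) :
    det (of fun p q => colop ι0 ι1 z M (R p) (Sum.elim (emb J) (emb J') (E q))) =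
      ∑ x : Om s, ∑ y : Om t, det (of fun p q => M (R p) (Sum.elim (emb x) (emb y) (E q))) *
        rho ι0 ι1 z x J * rho ι0 ι1 z y J' := by
  classical
  let H : (Fin s.2.1 ⊕ Fin t.2.1 → II α) → S := fun u => det (of fun p q => M (R p) (u (E q)))
  have hH : ∀ u, ¬ Injective u → H u = 0 := by
    intro u hu
    simp only [Injective, not_forall] at hu
    obtain ⟨a, b, hab, hne⟩ := hu
    refine det_zero_of_column_eq (i := E.symm a) (j := E.symm b) (by simpa using hne) fun k => ?_
    simp [hab]
  have hinj : Injective (fun q => Sum.elim (emb J) (emb J') (E q)) := by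
    refine Injective.comp (Injective.sumElim (emb_inj _) (emb_inj _) ?_) E.injective
    intro a b hab; have : (emb J a).1 = (emb J' b).1 := by rw [hab]
    exact hst this
  rw [det_colop ι0 ι1 z M R _ hinj]
  have h1 : ∀ q, det (of fun p q' => M (R p)
      (update (fun q => Sum.elim (emb J) (emb J') (E q)) q ι0 q')) =
      H (update (Sum.elim (emb J) (emb J')) (E q) ι0) := by
    intro q
    simp only [H]
    congr 1; ext p q'
    simp only [of_apply]
    by_cases hq : q' = q
    · subst hq; simp
    · rw [update_of_ne hq, update_of_ne (fun h => hq (E.injective h))]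
  simp only [h1]
  rw [sum_comp E (fun q => if Sum.elim (emb J) (emb J') q = ι1 then
    z * H (update (Sum.elim (emb J) (emb J')) q ι0) else 0), sum_sum_type]
  simp only [elim_inl, elim_inr, Sum.update_elim_inl, Sum.update_elim_inr]
  change H (Sum.elim (emb J) (emb J')) + _ = ∑ x : Om s, ∑ y : Om t, H (Sum.elim (emb x) (emb y)) * _ * _
  have hr : ∀ x : Om s, ∑ y : Om t, H (Sum.elim (emb x) (emb y)) * rho ι0 ι1 z x J * rho ι0 ι1 z y J' =
    (∑ y : Om t, H (Sum.elim (emb x) (emb y)) * rho ι0 ι1 z y J') * rho ι0 ι1 z x J := by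
    intro x; rw [Finset.sum_mul]; exact sum_congr rfl fun _ _ => by ring
  simp only [hr]
  have hG1 : ∀ (v) (f : Fin s.2.1 → II α), ¬ Injective f → H (Sum.elim f v) = 0 := fun v f hf =>
    hH _ fun hi => hf (hi.comp Sum.inl_injective)
  have hG2 : ∀ (v) (f : Fin t.2.1 → II α), ¬ Injective f → H (Sum.elim v f) = 0 := fun v f hf =>
    hH _ fun hi => hf (hi.comp Sum.inr_injective)
  have hs2 := fun x : Om s => sum_rho h z J' (fun f => H (Sum.elim (emb x) f)) (hG2 _)
  have hs1 := fun v => sum_rho h z J (fun f => H (Sum.elim f v)) (hG1 v)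
  beta_reduce at hs1 hs2
  simp only [hs2]
  by_cases hi : t.1 = ι1.1
  · have hn : ∀ j, emb J j ≠ ι1 := fun j hj => hst ((congrArg Sigma.fst hj).trans hi.symm)
    simp only [hn, if_false, sum_const_zero, add_zero, zero_add] at hs1 ⊢
    simp only [add_mul, sum_add_distrib, hs1]
    congr 1
    simp only [Finset.sum_mul]
    rw [sum_comm]
    refine sum_congr rfl fun j _ => ?_
    split_ifs
    · simp only [mul_assoc]; rw [← Finset.mul_sum, hs1]
    · simp
  · have hn : ∀ j, emb J' j ≠ ι1 := fun j hj => hi (congrArg Sigma.fst hj)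
    simp only [hn, if_false, sum_const_zero, add_zero]
    rw [hs1]
structure Fac (α : Q0 → ℕ) where
  (h1 h2 g1 g2 : Sl α)
  e1 : h1.1 = g1.1
  e2 : h2.1 = g2.1
  ne : h1.1 ≠ h2.1
  sum : h1.2.1 + h2.2.1 = g1.2.1 + g2.2.1
  le : h2.2.1 ≤ g2.2.1
def Fac.E0 (f : Fac α) : Fin f.h1.2.1 ⊕ Fin f.h2.2.1 → Fin f.g1.2.1 ⊕ Fin f.g2.2.1
  | .inl r => if h : r.1 < f.g1.2.1 then .inl ⟨r.1, h⟩ else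
      .inr ⟨r.1 - f.g1.2.1 + f.h2.2.1, by have := f.sum; have := r.2; omega⟩
  | .inr j => .inr ⟨j.1, j.2.trans_le f.le⟩
theorem Fac.E0_bij (f : Fac α) : Bijective f.E0 := by
  rw [Fintype.bijective_iff_injective_and_card]
  constructor
  · have := f.sum
    rintro (a | a) (b | b) h <;> simp only [Fac.E0] at h
    · split_ifs at h <;> simp only [Sum.inl.injEq, Sum.inr.injEq, Fin.mk.injEq, reduceCtorEq] at h
      · simp [Fin.ext_iff, h]
      · simp only [Sum.inl.injEq, Fin.ext_iff]; omega
    · split_ifs at h; simp only [Sum.inr.injEq, Fin.mk.injEq] at h; omega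
    · split_ifs at h; simp only [Sum.inr.injEq, Fin.mk.injEq] at h; omega
    · simp only [Sum.inr.injEq, Fin.mk.injEq] at h; simp [Fin.ext_iff, h]
  · simp [f.sum]
noncomputable def Fac.E (f : Fac α) := Equiv.ofBijective f.E0 f.E0_bij
noncomputable def Fac.D (f : Fac α) (M : MII) (J' : Om f.h1) (I' : Om f.h2)
    (J : Om f.g1) (I : Om f.g2) : S :=
  det (of fun p q => M (Sum.elim (emb J') (emb I') p) (Sum.elim (emb J) (emb I) (f.E q)))
theorem Fac.D_col (f : Fac α) {ι0 ι1 : II α} (h : Adj ι0 ι1) (z : S) (M : MII)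
    (J' : Om f.h1) (I' : Om f.h2) (J : Om f.g1) (I : Om f.g2) :
    f.D (colop ι0 ι1 z M) J' I' J I =
      ∑ x, ∑ y, f.D M J' I' x y * rho ι0 ι1 z x J * rho ι0 ι1 z y I :=
  col_core h z M _ (by rw [← f.e1, ← f.e2]; exact f.ne) f.E J I
def rowop {I : Type} [DecidableEq I] (ι0 ι1 : I) (z : S) (M : Matrix I I S) : Matrix I I S :=
  (colop ι1 ι0 z Mᵀ)ᵀ
theorem Fac.D_row (f : Fac α) {ι0 ι1 : II α} (h : Adj ι0 ι1) (z : S) (M : MII)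
    (J' : Om f.h1) (I' : Om f.h2) (J : Om f.g1) (I : Om f.g2) :
    f.D (rowop ι0 ι1 z M) J' I' J I =
      ∑ x, ∑ y, f.D M x y J I * rho ι0 ι1 z J' x * rho ι0 ι1 z I' y := by
  have h' : Adj ι1 ι0 := by
    obtain ⟨i, l0, l1, h0, h1, h2⟩ := h; exact ⟨i, l1, l0, h1, h0, h2.symm⟩
  have := col_core h' z Mᵀ (fun q => Sum.elim (emb J) (emb I) (f.E q)) f.ne (Equiv.refl _) J' I'
  rw [Fac.D, ← det_transpose]
  refine Eq.trans this ?_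
  refine sum_congr rfl fun x _ => sum_congr rfl fun y _ => ?_
  rw [rho_symm (L := x), rho_symm (L := y)]
  congr 2
  rw [Fac.D, ← det_transpose]; rfl
end Fac
section Theta
variable {Q0 : Type} [DecidableEq Q0] [Fintype Q0] {α : Q0 → ℕ} {S : Type} [CommRing S]
abbrev JJ (α : Q0 → ℕ) := ∀ s : Sl α, Om s
def Om.plus (s : Sl α) : Om s := Fin.castLEOrderEmb (by omega)
instance (s : Sl α) : Nonempty (Om s) := ⟨Om.plus s⟩
theorem rho_triv (ι0 ι1 : II α) (h : ι0 ≠ ι1) (z : S) {s : Sl α} (hs : Subsingleton (Om s)) (L J : Om s) :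
    rho ι0 ι1 z L J = 1 := by
  rw [rho, if_pos (Subsingleton.elim _ _), if_neg, add_zero]
  rintro ⟨j, hj, h'⟩
  rw [Subsingleton.elim L J] at h'
  have := congrFun h' j
  rw [update_self, hj] at this
  exact h this.symm
noncomputable def RR (ι0 ι1 : II α) (z : S) : Matrix (JJ α) (JJ α) S := of fun L J => ∏ s, rho ι0 ι1 z (L s) (J s)
noncomputable def Theta {T : Type} [Fintype T] (f : T → Fac α) (M : MII) :
    Matrix (JJ α) (JJ α) S :=
  of fun J' J => ∏ t, (f t).D M (J' _) (J' _) (J _) (J _)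
theorem Adj.ne {ι0 ι1 : II α} (h : Adj ι0 ι1) : ι0 ≠ ι1 := by
  obtain ⟨i, l0, l1, rfl, rfl, hl⟩ := h
  simp only [ne_eq, Sigma.mk.injEq, heq_eq_eq, true_and]
  rintro rfl; omega
theorem Theta_col {T : Type} [Fintype T] [DecidableEq T] (f : T → Fac α)
    (hf : ∀ s : Sl α, Nontrivial (Om s) → ∃! p : T ⊕ T, Sum.elim (fun t => (f t).g1) (fun t => (f t).g2) p = s)
    {ι0 ι1 : II α} (h : Adj ι0 ι1) (z : S) (M : MII) :
    Theta f (colop ι0 ι1 z M) = Theta f M * RR ι0 ι1 z := by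
  ext J' J
  rw [mul_apply]
  simp only [Theta, RR, of_apply]
  rw [resum (Om (α := α)) (fun t => (f t).g1) (fun t => (f t).g2) hf (fun s L => rho ι0 ι1 z L (J s))
    (fun s hs x => rho_triv _ _ h.ne _ hs _ _) (fun t x y => (f t).D M (J' _) (J' _) x y)]
  exact prod_congr rfl fun t _ => (f t).D_col h z M _ _ _ _
theorem Theta_row {T : Type} [Fintype T] [DecidableEq T] (f : T → Fac α)
    (hf : ∀ s : Sl α, Nontrivial (Om s) → ∃! p : T ⊕ T, Sum.elim (fun t => (f t).h1) (fun t => (f t).h2) p = s)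
    {ι0 ι1 : II α} (h : Adj ι0 ι1) (z : S) (M : MII) :
    Theta f (rowop ι0 ι1 z M) = RR ι0 ι1 z * Theta f M := by
  ext J' J
  rw [mul_apply]
  simp only [Theta, RR, of_apply]
  simp only [mul_comm (∏ s, rho ι0 ι1 z (J' s) _)]
  rw [resum (Om (α := α)) (fun t => (f t).h1) (fun t => (f t).h2) hf (fun s L => rho ι0 ι1 z (J' s) L)
    (fun s hs x => rho_triv _ _ h.ne _ hs _ _) (fun t x y => (f t).D M x y (J _) (J _))]
  exact prod_congr rfl fun t _ => (f t).D_row h z M _ _ _ _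
theorem RR_mul {ι0 ι1 : II α} (h : Adj ι0 ι1) (z : S) : RR ι0 ι1 z * RR ι0 ι1 (-z) = 1 := by
  classical
  ext L J
  rw [mul_apply]
  simp only [RR, of_apply, ← prod_mul_distrib]
  have h1 := prod_univ_sum (fun s : Sl α => (univ : Finset (Om s)))
    (fun s x => rho ι0 ι1 z (L s) x * rho ι0 ι1 (-z) x (J s))
  rw [piFinset_univ] at h1
  rw [← h1]
  have h2 : ∀ s, ∑ x, rho ι0 ι1 z (L s) x * rho ι0 ι1 (-z) x (J s) = if L s = J s then 1 else 0 := by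
    intro s
    have hN : ∀ A B C : Om s, NN ι0 ι1 A B → ¬ NN ι0 ι1 B C := by
      rintro A B C ⟨j, hj, -⟩ ⟨j', hj', h'⟩
      rw [h'] at hj
      by_cases hjj : j = j'
      · subst hjj; rw [update_self] at hj; exact h.ne hj
      · rw [update_of_ne hjj] at hj; exact hjj (emb_inj _ (hj.trans hj'.symm))
    have e : ∀ x, rho ι0 ι1 z (L s) x * rho ι0 ι1 (-z) x (J s) =
        (if L s = x then (if x = J s then (1 : S) else 0) else 0) +
        ((if L s = x then (if NN ι0 ι1 x (J s) then -z else 0) else 0) +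
          if x = J s then (if NN ι0 ι1 (L s) x then z else 0) else 0) := by
      intro x
      have := hN (L s) x (J s)
      simp only [rho]
      by_cases h1 : NN ι0 ι1 (L s) x
      · simp only [h1, this h1, if_true, if_false]; split_ifs <;> ring
      · simp only [h1, if_false]; split_ifs <;> ring
    simp only [e, sum_add_distrib, sum_ite_eq, sum_ite_eq', mem_univ, if_true]
    split_ifs <;> ring
  simp only [h2, one_apply]
  by_cases hLJ : L = J
  · subst hLJ; simp
  · rw [if_neg hLJ]
    obtain ⟨s, hs⟩ := ne_iff.1 hLJ
    exact prod_eq_zero (mem_univ s) (if_neg hs)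
end Theta
section Fam
variable {Q0 : Type} [DecidableEq Q0] {α : Q0 → ℕ}
abbrev TT (α : Q0 → ℕ) (x y : Q0) := Fin (α y + α x + 1) ⊕ {s : Sl α // s.1 ≠ x ∧ s.1 ≠ y}
def fac {x y : Q0} (hxy : x ≠ y) : TT α x y → Fac α
  | .inl t => ⟨⟨y, ⟨min (α y) (α y + α x - t), by omega⟩⟩, ⟨x, ⟨t - α y, by omega⟩⟩, ⟨y, ⟨α y - t, by omega⟩⟩,
      ⟨x, ⟨min (α x) t, by omega⟩⟩, rfl, rfl, hxy.symm, by simp only; omega, by simp only; omega⟩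
  | .inr s => ⟨s.1, ⟨y, 0⟩, s.1, ⟨y, 0⟩, rfl, rfl, s.2.2, rfl, le_rfl⟩
section
variable (hne t s : ℕ)
set_option hygiene false
notation "fl1" => fac hne (.inl t)
notation "fr1" => fac hne (.inr s)
end
theorem Om_nontriv {s : Sl α} (h' : Nontrivial (Om s)) : 0 < s.2.1 ∧ s.2.1 < α s.1 := by
  obtain ⟨i, ⟨k, hk⟩⟩ := s
  by_contra hc
  simp only [not_and, not_lt] at hc
  refine not_subsingleton_iff_nontrivial.2 h' ?_
  rcases Nat.eq_zero_or_pos k with h0 | h0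
  · subst h0
    exact ⟨fun a b => by ext j; exact j.elim0⟩
  · have : k = α i := by have := hc h0; omega
    subst this
    refine ⟨fun a b => ?_⟩
    have ha := (injective_iff_bijective.1 a.injective).2
    have hb := (injective_iff_bijective.1 b.injective).2
    have : ∀ c : Fai ↪o Fai, ⇑c = id := by
      intro c
      have hc := (injective_iff_bijective.1 c.injective).2
      have := Subsingleton.elim (RelIso.ofSurjective c hc : Fai ≃o Fai) (OrderIso.refl _)
      ext j; have := congrArg (fun f : Fai ≃o Fai => (f j).1) this; simpa using this
    apply DFunLike.coe_injective; exact (this a).trans (this b).symm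
theorem fac_g {x y : Q0} (hxy : x ≠ y) (s : Sl α) (hs : Nontrivial (Om s)) :
    ∃! p : TT α x y ⊕ TT α x y, Sum.elim (fun t => (fac hxy t).g1) (fun t => (fac hxy t).g2) p = s := by
  have h := Om_nontriv hs
  obtain ⟨i, ⟨k, hk⟩⟩ := s
  simp only at h
  by_cases hy : i = y
  · subst hy
    refine ⟨.inl (.inl ⟨α i - k, by omega⟩), by simp [fac]; omega, ?_⟩
    rintro ((t | t) | (t | t)) hp
    · simp only [fac, elim_inl, Sigma.mk.injEq, heq_eq_eq, Fin.mk.injEq, true_and] at hp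
      simp only [Sum.inl.injEq, Fin.ext_iff]; omega
    · exact absurd cg1 t.2.2
    · exact absurd cg1 hxy
    · simp [fac, Fin.ext_iff] at hp; omega
  by_cases hx : i = x
  · subst hx
    refine ⟨.inr (.inl ⟨k, by omega⟩), by simp [fac]; omega, ?_⟩
    rintro ((t | t) | (t | t)) hp
    · exact absurd cg1 hxy.symm
    · exact absurd cg1 t.2.1
    · simp only [fac, elim_inr, Sigma.mk.injEq, heq_eq_eq, Fin.mk.injEq, true_and] at hp
      simp only [Sum.inr.injEq, Sum.inl.injEq, Fin.ext_iff]; omega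
    · exact absurd cg1 hxy.symm
  · refine ⟨.inl (.inr ⟨⟨i, ⟨k, hk⟩⟩, hx, hy⟩), rfl, ?_⟩
    rintro ((t | t) | (t | t)) hp
    · exact absurd (cg1).symm hy
    · have : t.1 = _ := hp
      simp only [Sum.inl.injEq, Sum.inr.injEq]; exact Subtype.ext this
    · exact absurd (cg1).symm hx
    · exact absurd (cg1).symm hy
theorem fac_h {x y : Q0} (hxy : x ≠ y) (s : Sl α) (hs : Nontrivial (Om s)) :
    ∃! p : TT α x y ⊕ TT α x y, Sum.elim (fun t => (fac hxy t).h1) (fun t => (fac hxy t).h2) p = s := by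
  have h := Om_nontriv hs
  obtain ⟨i, ⟨k, hk⟩⟩ := s
  simp only at h
  by_cases hy : i = y
  · subst hy
    refine ⟨.inl (.inl ⟨α i + α x - k, by omega⟩), by simp [fac]; omega, ?_⟩
    rintro ((t | t) | (t | t)) hp
    · simp only [fac, elim_inl, Sigma.mk.injEq, heq_eq_eq, Fin.mk.injEq, true_and] at hp
      simp only [Sum.inl.injEq, Fin.ext_iff]; omega
    · exact absurd cg1 t.2.2
    · exact absurd cg1 hxy
    · simp [fac, Fin.ext_iff] at hp; omega
  by_cases hx : i = x
  · subst hx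
    refine ⟨.inr (.inl ⟨α y + k, by omega⟩), by simp [fac], ?_⟩
    rintro ((t | t) | (t | t)) hp
    · exact absurd cg1 hxy.symm
    · exact absurd cg1 t.2.1
    · simp only [fac, elim_inr, Sigma.mk.injEq, heq_eq_eq, Fin.mk.injEq, true_and] at hp
      simp only [Sum.inr.injEq, Sum.inl.injEq, Fin.ext_iff]; omega
    · exact absurd cg1 hxy.symm
  · refine ⟨.inl (.inr ⟨⟨i, ⟨k, hk⟩⟩, hx, hy⟩), rfl, ?_⟩
    rintro ((t | t) | (t | t)) hp
    · exact absurd (cg1).symm hy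
    · have : t.1 = _ := hp
      simp only [Sum.inl.injEq, Sum.inr.injEq]; exact Subtype.ext this
    · exact absurd (cg1).symm hx
    · exact absurd (cg1).symm hy
end Fam
section MMs
variable {Q0 Q1 : Type} [Fintype Q0] [DecidableEq Q0] {ta ha : Q1 → Q0} {α : Q0 → ℕ} {S : Type} [CommRing S]
def In (α : Q0 → ℕ) (S : Type) [CommRing S] (i : Q0) : Matrix (II α) Fai S := of fun p k => if p = ⟨i, k⟩ then 1 else 0
def YY (e : Q1) (v : VV → S) : MII :=
  In α S (ha e) * (of fun r c => v ⟨e, (r, c)⟩) * (In α S (ta e))ᵀ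
def MM (e : Q1) (v : VV → S) : MII := 1 + YY e v
theorem In_mul {n : Type} [Fintype n] (i : Q0) (M : Matrix Fai n S) (r : Fai) (c : n) :
    (In α S i * M) (⟨i, r⟩ : II α) c = M r c := by
  rw [mul_apply, sum_eq_single r]
  · simp [In]
  · intro b _ hb; simp [In, hb.symm]
  · simp
theorem In_mul_ne {n : Type} [Fintype n] (i : Q0) (M : Matrix Fai n S) (p : II α) (hp : p.1 ≠ i) (c : n) :
    (In α S i * M) p c = 0 := by
  rw [mul_apply]
  refine sum_eq_zero fun k _ => ?_
  rw [In, of_apply, if_neg (fun h => hp (congrArg Sigma.fst h)), zero_mul]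
theorem YY_apply (e : Q1) (v : VV → S) (r : Fin αhe) (c : Fin αte) :
    YY e v ⟨ha e, r⟩ ⟨ta e, c⟩ = v ⟨e, (r, c)⟩ := by
  rw [YY, ← transpose_apply (In α S (ha e) * _ * _), transpose_mul, transpose_transpose, In_mul, transpose_apply, In_mul]; rfl
theorem YY_ne (e : Q1) (v : VV → S) (p q : II α) (h : p.1 ≠ ha e ∨ q.1 ≠ ta e) : YY e v p q = 0 := by
  rw [YY]
  rcases h with h | h
  · rw [Matrix.mul_assoc, In_mul_ne _ _ _ h]
  · rw [← transpose_apply (In α S (ha e) * _ * _), transpose_mul, transpose_transpose, In_mul_ne _ _ _ h]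
theorem bd_In (i : Q0) (B : Mt α S) : blockDiagonal' B * In α S i = In α S i * B i := by
  ext ⟨p, r⟩ k
  have h1 : (blockDiagonal' B * In α S i) ⟨p, r⟩ k = blockDiagonal' B ⟨p, r⟩ ⟨i, k⟩ := by
    rw [mul_apply, sum_eq_single ⟨i, k⟩] <;> simp +contextual [In]
  rw [h1]
  by_cases hp : p = i
  · subst hp; rw [In_mul, blockDiagonal'_apply_eq]
  · rw [In_mul_ne _ _ _ hp, blockDiagonal'_apply_ne _ _ _ hp]
theorem YY_cact (e : Q1) (B A : Mt α S) (v : VV → S) :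
    YY e (cact B A v) = blockDiagonal' B * YY e v * blockDiagonal' A := by
  have h : (In α S (ta e))ᵀ * blockDiagonal' A = A (ta e) * (In α S (ta e))ᵀ := by
    rw [← transpose_inj, transpose_mul, transpose_mul, transpose_transpose, blockDiagonal'_transpose]
    exact bd_In (S := S) (ta e) (fun k => (A k)ᵀ)
  have h2 : (of fun r c => cact B A v ⟨e, (r, c)⟩) = B (ha e) * (of fun r c => v ⟨e, (r, c)⟩) * A (ta e) := by
    ext; rfl
  rw [YY, YY, h2]
  simp only [Matrix.mul_assoc, h]
  simp only [← Matrix.mul_assoc, bd_In]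
theorem bd_tvm (i : Q0) (l0 l1 : Fai) (z : S) :
    blockDiagonal' (tvm i l0 l1 z) = transvection (⟨i, l0⟩ : II α) ⟨i, l1⟩ z := by
  ext ⟨p, r⟩ ⟨q, c⟩
  by_cases hpq : p = q
  · subst hpq
    rw [blockDiagonal'_apply_eq]
    by_cases hi : p = i
    · subst hi
      simp [tvm, transvection, one_apply, single_apply]
    · have : ∀ x : Fin (α p), ∀ y : Fai, (⟨i, y⟩ : II α) ≠ ⟨p, x⟩ := fun x y h => hi (congrArg Sigma.fst h).symm
      simp [tvm, transvection, one_apply, single_apply, hi, this, Ne.symm hi]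
  · rw [blockDiagonal'_apply_ne _ _ _ hpq]
    have h2 : ¬ ((⟨i, l0⟩ : II α) = ⟨p, r⟩ ∧ (⟨i, l1⟩ : II α) = ⟨q, c⟩) := fun h =>
      hpq ((congrArg Sigma.fst h.1).symm.trans (congrArg Sigma.fst h.2))
    have h3 : (⟨p, r⟩ : II α) ≠ ⟨q, c⟩ := fun h => hpq (congrArg Sigma.fst h)
    rw [transvection, Matrix.add_apply, one_apply, single_apply, if_neg h2, if_neg h3, add_zero]
theorem colop_eq (ι0 ι1 : II α) (z : S) (M : MII) : colop ι0 ι1 z M = M * transvection ι0 ι1 z := by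
  ext p q
  by_cases hq : q = ι1
  · subst hq; simp [colop]
  · simp [colop, hq]
theorem rowop_eq (ι0 ι1 : II α) (z : S) (M : MII) : rowop ι0 ι1 z M = transvection ι0 ι1 z * M := by
  ext p q
  by_cases hq : p = ι0
  · subst hq; simp [rowop, colop]
  · simp [rowop, colop, hq]
theorem MM_tva (e : Q1) (i : Q0) (l0 l1 : Fai) (hl : l0 ≠ l1) (z : S) (v : VV → S) :
    MM e (tva i l0 l1 z v) = rowop ⟨i, l0⟩ ⟨i, l1⟩ (-z) (colop ⟨i, l0⟩ ⟨i, l1⟩ z (MM e v)) := by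
  rw [MM, tva, YY_cact, bd_tvm, bd_tvm, colop_eq, rowop_eq, MM, add_mul, mul_add, Matrix.one_mul,
    transvection_mul_transvection_same _ _ (by simpa using hl)]
  simp [Matrix.mul_assoc]
theorem MM_map {S' : Type} [CommRing S'] (φ : S →+* S') (e : Q1) (v : VV → S) :
    (MM e v).map φ = MM e (fun p => φ (v p)) := by
  ext p q
  rw [map_apply, MM, Matrix.add_apply, map_add, MM, Matrix.add_apply]
  congr 1
  · simp [one_apply, apply_ite φ]
  · by_cases h : p.1 = ha e ∧ q.1 = ta e
    · obtain ⟨p, r⟩ := p; obtain ⟨q, c⟩ := q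
      obtain ⟨rfl, rfl⟩ := h
      simp only [YY_apply]
    · rw [not_and_or] at h
      simp [YY_ne e _ p q h]
theorem Theta_map {S' : Type} [CommRing S'] (φ : S →+* S') {T : Type} [Fintype T] (f : T → Fac α) (M : MII) :
    (Theta f M).map φ = Theta f (M.map φ) := by
  ext J' J
  simp only [Theta, map_apply, of_apply, map_prod, Fac.D, map_det]
  rfl
noncomputable def Th (hl : NLp) (v : VV → S) (e : Q1) : Matrix (JJ α) (JJ α) S :=
  Theta (fac (hl e)) (MM e v)
theorem Th_tva (hl : NLp) (v : VV → S) (e : Q1) (i : Q0) (l0 l1 : Fai)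
    (h : l0.1 + 1 = l1.1) (z : S) : Th hl (tva i l0 l1 z v) e =
      RR ⟨i, l0⟩ ⟨i, l1⟩ (-z) * Th hl v e * RR ⟨i, l0⟩ ⟨i, l1⟩ z := by
  classical
  have hA : Adj (α := α) ⟨i, l0⟩ ⟨i, l1⟩ := ⟨i, l0, l1, rfl, rfl, .inl h⟩
  rw [Th, MM_tva _ _ _ _ (by rintro rfl; omega), Theta_row _ (fac_h _) hA, Theta_col _ (fac_g _) hA, ← Matrix.mul_assoc]; rfl
noncomputable def PP (hl : NLp) (v : VV → S) (l : List Q1) := (l.map (Th hl v)).prod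
theorem PP_tva (hl : NLp) (v : VV → S) (l : List Q1) (i : Q0) (l0 l1 : Fai)
    (h : l0.1 + 1 = l1.1) (z : S) : PP hl (tva i l0 l1 z v) l =
      RR ⟨i, l0⟩ ⟨i, l1⟩ (-z) * PP hl v l * RR ⟨i, l0⟩ ⟨i, l1⟩ z := by
  have hA : Adj (α := α) ⟨i, l0⟩ ⟨i, l1⟩ := ⟨i, l0, l1, rfl, rfl, .inl h⟩
  have h1 := RR_mul hA z
  have h2 := RR_mul hA (-z)
  rw [neg_neg] at h2
  induction l with
  | nil => simp [PP, h2]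
  | cons e l ih =>
    have : ∀ v : VV → S, PP hl v (e :: l) = Th hl v e * PP hl v l := fun v => by simp [PP]
    rw [this, this, ih, Th_tva _ _ _ _ _ _ h]
    simp only [Matrix.mul_assoc]
    rw [← Matrix.mul_assoc (RR _ _ z) (RR _ _ (-z)), h1, Matrix.one_mul]
theorem PP_map {S' : Type} [CommRing S'] (φ : S →+* S') (hl : NLp) (v : VV → S) (l : List Q1) :
    (PP hl v l).map φ = PP hl (fun p => φ (v p)) l := by
  rw [PP, ← mapMatrix_apply, map_list_prod, List.map_map, PP]
  congr 2; funext e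
  simp only [Function.comp, mapMatrix_apply, Th, Theta_map, MM_map]
abbrev pls : JJ α := fun s => Om.plus s
theorem emb_plus {s : Sl α} (j) : emb (Om.plus s) j = ⟨s.1, ⟨j.1, by have := j.2; omega⟩⟩ := rfl
theorem RR_plus (i : Q0) (l0 l1 : Fai) (h : l0.1 + 1 = l1.1) (z : S) (L : JJ α) :
    RR ⟨i, l0⟩ ⟨i, l1⟩ z L pls = if L = pls then 1 else 0 := by
  classical
  have hN : ∀ s (L : Om s), ¬ NN (⟨i, l0⟩ : II α) ⟨i, l1⟩ L (Om.plus s) := by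
    rintro ⟨i', k⟩ L ⟨j, hj, h'⟩
    rw [emb_plus] at hj
    obtain rfl : i' = i := congrArg Sigma.fst hj
    simp only [Sigma.mk.injEq, heq_eq_eq, true_and, Fin.ext_iff] at hj
    have hi := emb_inj L
    rw [h'] at hi
    have hlt := j.2
    have : (⟨l0.1, by simp only at hlt ⊢; omega⟩ : Fin k.1) = j := hi (by
      rw [update_self, update_of_ne, emb_plus]
      simp only [ne_eq, Fin.ext_iff]; omega)
    rw [Fin.ext_iff] at this; simp only at this; omega
  simp only [RR, of_apply, rho, hN, if_false, add_zero]
  by_cases hL : L = pls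
  · subst hL; simp
  · obtain ⟨s, hs⟩ := ne_iff.1 hL
    rw [if_neg hL]; exact prod_eq_zero (mem_univ s) (if_neg hs)
theorem plus_RR (i : Q0) (l0 l1 : Fai) (h : l0.1 + 1 = l1.1) (L : JJ α) :
    ∃ a b : S, ∀ z : S, RR ⟨i, l0⟩ ⟨i, l1⟩ z pls L = a + z * b := by
  classical
  let s0 : Sl α := ⟨i, ⟨l1.1, by omega⟩⟩
  have hN : ∀ s ≠ s0, ¬ NN (⟨i, l0⟩ : II α) ⟨i, l1⟩ (Om.plus s) (L s) := by
    rintro ⟨i', k⟩ hs hn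
    rw [NN_symm] at hn
    obtain ⟨j, hj, h'⟩ := hn
    rw [emb_plus] at hj
    obtain rfl : i' = i := congrArg Sigma.fst hj
    simp only [Sigma.mk.injEq, heq_eq_eq, true_and, Fin.ext_iff] at hj
    have hi := emb_inj (L ⟨i', k⟩)
    rw [h'] at hi
    have hlt := j.2
    have hk : k.1 ≠ l1.1 := fun hk => hs (by simp only [s0]; congr 1; exact Fin.ext hk)
    have : (⟨l1.1, by simp only at hlt ⊢; omega⟩ : Fin k.1) = j := hi (by
      rw [update_self, update_of_ne, emb_plus]
      simp only [ne_eq, Fin.ext_iff]; omega)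
    rw [Fin.ext_iff] at this; simp only at this; omega
  refine ⟨(∏ s ∈ univ.erase s0, if pls s = L s then 1 else 0) * if pls s0 = L s0 then 1 else 0,
    (∏ s ∈ univ.erase s0, if pls s = L s then 1 else 0) *
      if NN (⟨i, l0⟩ : II α) ⟨i, l1⟩ (Om.plus s0) (L s0) then 1 else 0, fun z => ?_⟩
  rw [RR, of_apply, ← Finset.prod_erase_mul _ _ (mem_univ s0)]
  have : ∏ s ∈ univ.erase s0, rho (⟨i, l0⟩ : II α) ⟨i, l1⟩ z (pls s) (L s) =
      ∏ s ∈ univ.erase s0, if pls s = L s then 1 else 0 := by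
    refine prod_congr rfl fun s hs => ?_
    rw [rho, if_neg (hN s (ne_of_mem_erase hs)), add_zero]
  rw [this, rho]
  split_ifs <;> ring
theorem PP_lin {K : Type} [Field K] (hl : NLp) (l : List Q1) (i : Q0) (l0 l1 : Fai)
    (h : l0.1 + 1 = l1.1) : ∃ a b : PK, ∀ z : K,
    aeval (tva i l0 l1 (C z) (fun p => X p)) (PP hl (fun p => (X p : PK)) l pls pls) = a + C z * b := by
  choose a b hab using plus_RR (S := PK) i l0 l1 h
  have key : ∀ z : K, aeval (tva i l0 l1 (C z) (fun p => X p)) (PP hl (fun p => (X p : PK)) l pls pls) =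
     (RR ⟨i, l0⟩ ⟨i, l1⟩ (-C z) * PP hl (fun p => (X p : PK)) l : Matrix (JJ α) (JJ α) PK) pls pls := by
    intro z
    have := congrFun₂ (PP_map (aeval (R := K) (tva i l0 l1 (C z) (fun p : VV => (X p : PK)))).toRingHom hl (fun p => X p) l) pls pls
    rw [map_apply] at this
    refine Eq.trans this ?_
    have h2 : (fun p => (aeval (R := K) (tva i l0 l1 (C z) (fun p : VV => (X p : PK)))).toRingHom (X p)) =
      tva i l0 l1 (C z) (fun p => X p) := by ext p; simp
    rw [h2, PP_tva _ _ _ _ _ _ h, mul_apply, sum_eq_single pls]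
    · rw [RR_plus _ _ _ h, if_pos rfl, mul_one]
    · intro L _ hL; rw [RR_plus _ _ _ h, if_neg hL, mul_zero]
    · simp
  refine ⟨∑ L, a L * PP hl (fun p => X p) l L pls, ∑ L, - b L * PP hl (fun p => X p) l L pls, fun z => ?_⟩
  rw [key, mul_apply, Finset.mul_sum, ← sum_add_distrib]
  refine sum_congr rfl fun L _ => ?_
  rw [hab]; ring
end MMs
section WF
variable {ι K : Type} [CommRing K]
def mw (w : ι → ℤ) (m : ι →₀ ℕ) : ℤ := m.sum fun v e => (e : ℤ) * w v
theorem mw_add (w : ι → ℤ) (m m' : ι →₀ ℕ) : mw w (m + m') = mw w m + mw w m' :=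
  sum_add_index' (by simp) (by intros; push_cast; ring)
theorem mw_neg (w : ι → ℤ) (m : ι →₀ ℕ) : mw (-w) m = - mw w m := by
  simp [mw, Finsupp.sum]
def wF (K : Type) [CommRing K] (w : ι → ℤ) (c : ℤ) : AddSubgroup (MvPolynomial ι K) where
  carrier := {f | ∀ m ∈ f.support, c ≤ mw w m}
  zero_mem' := by simp
  add_mem' := by
    classical
    intro f g hf hg m hm
    rcases mem_union.1 (support_add hm) with h | h
    exacts [hf m h, hg m h]
  neg_mem' := by intro f hf m hm; exact hf m (by simpa using hm)
theorem wF_filt (w : ι → ℤ) : MFilt (wF K w) := by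
  classical
  refine ⟨?_, ?_, ?_⟩
  · intro m hm
    have := support_monomial_subset (R := K) (s := (0 : ι →₀ ℕ)) (a := 1) hm
    simp at this; simp [this, mw]
  · intro a b x y hx hy m hm
    obtain ⟨p, hp, q, hq, rfl⟩ := mem_add.1 (support_mul x y hm)
    rw [mw_add]; exact add_le_add (hx p hp) (hy q hq)
  · intro a b h f hf m hm; exact h.trans (hf m hm)
theorem wF_C (w : ι → ℤ) (r : K) : C r ∈ wF K w 0 := by
  classical
  intro m hm
  have := support_monomial_subset (R := K) (s := (0 : ι →₀ ℕ)) (a := r) hm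
  simp at this; simp [this, mw]
theorem wF_X (w : ι → ℤ) (v : ι) : X v ∈ wF K w (w v) := by
  classical
  intro m hm
  have := support_monomial_subset (R := K) (s := Finsupp.single v 1) (a := 1) hm
  simp at this; simp [this, mw]
theorem wF_coeff {w : ι → ℤ} {c : ℤ} {f : MvPolynomial ι K} (hf : f ∈ wF K w c) {m : ι →₀ ℕ} (h : mw w m < c) :
    coeff m f = 0 := by
  by_contra hc; exact absurd (hf m (mem_support_iff.2 hc)) (not_le.2 h)
variable {R : Type} [CommRing R] {F : ℤ → AddSubgroup R}
theorem MFilt.pow (hF : MFilt F) {x : R} {a : ℤ} (h : x ∈ F a) (q : ℕ) : x ^ q ∈ F (q * a) := by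
  simpa using hF.prod (univ : Finset (Fin q)) (fun _ => x) (fun _ => a) (fun _ _ => h)
theorem MFilt.mul_cong (hF : MFilt F) {a b : ℤ} {x x' y y' : R} (hx : x ∈ F a) (h1 : x - x' ∈ F (a + 1))
    (hy' : y' ∈ F b) (h2 : y - y' ∈ F (b + 1)) : x * y - x' * y' ∈ F (a + b + 1) := by
  have : x * y - x' * y' = x * (y - y') + (x - x') * y' := by ring
  rw [this]
  refine AddSubgroup.add_mem _ ?_ ?_
  · rw [add_assoc]; exact hF.mul _ _ _ _ hx h2
  · rw [add_right_comm]; exact hF.mul _ _ _ _ h1 hy'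
theorem MFilt.prod_cong (hF : MFilt F) {J : Type} (s : Finset J) (x y : J → R) (w : J → ℤ)
    (h : ∀ i ∈ s, x i ∈ F (w i)) (h' : ∀ i ∈ s, x i - y i ∈ F (w i + 1)) :
    ∏ i ∈ s, x i - ∏ i ∈ s, y i ∈ F (∑ i ∈ s, w i + 1) := by
  classical
  induction s using Finset.induction_on with
  | empty => simp [AddSubgroup.zero_mem]
  | insert a s ha ih =>
    rw [prod_insert ha, prod_insert ha, sum_insert ha]
    refine hF.mul_cong (h _ (by simp)) (h' _ (by simp)) (hF.prod _ _ _ fun i hi => ?_)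
      (ih (fun i hi => h i (by simp [hi])) fun i hi => h' i (by simp [hi]))
    have := (F (w i)).sub_mem (h i (by simp [hi])) (hF.anti (w i) _ (by omega) (h' i (by simp [hi])))
    simpa using this
theorem MFilt.pow_cong (hF : MFilt F) {x y : R} {a : ℤ} (h : x ∈ F a) (h' : x - y ∈ F (a + 1)) (q : ℕ) :
    x ^ q - y ^ q ∈ F (q * a + 1) := by
  simpa using hF.prod_cong (univ : Finset (Fin q)) (fun _ => x) (fun _ => y) (fun _ => a) (fun _ _ => h) (fun _ _ => h')
end WF
section ThW
variable {Q0 Q1 : Type} [Fintype Q0] [DecidableEq Q0] {ta ha : Q1 → Q0} {α : Q0 → ℕ} {K : Type} [CommRing K]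
noncomputable abbrev gX : VV → PK := fun p => X p
section
variable (ta ha α K : ℕ)
set_option hygiene false
notation "gXK" => gX (K := K) (ta := ta) (ha := ha)
notation "gX1" => gX (K := K)
end
def HH (w : II α → ℤ) (J : JJ α) : ℤ := ∑ s, ∑ j, w (emb (J s) j)
theorem sum_slots {T : Type} [Fintype T] (g1 g2 : T → Sl α)
    (hg : ∀ s : Sl α, Nontrivial (Om s) → ∃! p : T ⊕ T, Sum.elim g1 g2 p = s) (h : ∀ s : Sl α, Om s → ℤ) (J J' : JJ α) :
    ∑ t, (h _ (J (g1 t)) + h _ (J (g2 t))) - ∑ t, (h _ (J' (g1 t)) + h _ (J' (g2 t))) = ∑ s, h s (J s) - ∑ s, h s (J' s) := by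
  have : ∑ p : T ⊕ T, (h _ (J (Sum.elim g1 g2 p)) - h _ (J' (Sum.elim g1 g2 p))) = ∑ s, (h s (J s) - h s (J' s)) := by
    have hn : ∀ s, h s (J s) - h s (J' s) ≠ 0 → Nontrivial (Om s) := fun s hs => by
      rcases subsingleton_or_nontrivial (Om s) with hs' | hs'
      · rw [Subsingleton.elim (J s) (J' s), sub_self] at hs; exact absurd rfl hs
      · exact hs'
    refine Finset.sum_bij_ne_zero (fun p _ _ => Sum.elim g1 g2 p) (by simp) ?_ ?_ (by simp)
    · intro p _ hp q _ hq h
      exact (hg _ (hn _ hp)).unique rfl h.symm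
    · intro s _ hs
      obtain ⟨p, hp, -⟩ := hg s (hn _ hs)
      exact ⟨p, mem_univ _, by subst hp; exact hs, hp⟩
  rw [← sum_sub_distrib, ← sum_sub_distrib (s := (univ : Finset (Sl α))), ← this, sum_sum_type, ← sum_add_distrib]
  exact sum_congr rfl fun t _ => by simp only [elim_inl, elim_inr]; ring
theorem MM_mem (e : Q1) (w : II α → ℤ) (W : VV → ℤ) (hW : ∀ r c, W ⟨e, (r, c)⟩ = w ⟨ta e, c⟩ - w ⟨ha e, r⟩)
    (hne : ta e ≠ ha e) (p q : II α) :
    MM e gX1 p q ∈ wF K W (-w p + w q) := by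
  by_cases h : p.1 = ha e ∧ q.1 = ta e
  · obtain ⟨p, r⟩ := p; obtain ⟨q, c⟩ := q
    obtain ⟨rfl, rfl⟩ := h
    rw [MM, Matrix.add_apply, one_apply_ne (fun h => hne (congrArg Sigma.fst h).symm), zero_add, YY_apply]
    have := wF_X (K := K) W ⟨e, (r, c)⟩
    rwa [hW, sub_eq_neg_add] at this
  · rw [not_and_or] at h
    rw [MM, Matrix.add_apply, YY_ne e _ p q h, add_zero, one_apply]
    split_ifs with h
    · rw [h, neg_add_cancel]; exact (wF_filt W).one
    · exact AddSubgroup.zero_mem _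
theorem D_mem (f : Fac α) (e : Q1) (w : II α → ℤ) (W : VV → ℤ)
    (hW : ∀ r c, W ⟨e, (r, c)⟩ = w ⟨ta e, c⟩ - w ⟨ha e, r⟩) (hne : ta e ≠ ha e) (J' I' J I) :
    f.D (MM e gX1) J' I' J I ∈ wF K W ((∑ j, w (emb J j) + ∑ j, w (emb I j)) - (∑ j, w (emb J' j) + ∑ j, w (emb I' j))) := by
  have := (wF_filt (K := K) W).det (of fun p q => MM e gX1 (Sum.elim (emb J') (emb I') p) (Sum.elim (emb J) (emb I) (f.E q)))
    (fun p => - w (Sum.elim (emb J') (emb I') p)) (fun q => w (Sum.elim (emb J) (emb I) (f.E q)))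
    (fun p q => MM_mem e w W hW hne _ _)
  rw [sum_comp f.E (fun q => w (Sum.elim (emb J) (emb I) q)), sum_sum_type, sum_sum_type] at this
  rw [Fac.D]
  convert this using 2
  simp only [elim_inl, elim_inr, sum_neg_distrib]; ring
def cst (hl : NLp) (e : Q1) (w : II α → ℤ) : ℤ :=
  ∑ t, (∑ j, w (emb (pls (fac (hl e) t).g1) j) + ∑ j, w (emb (pls (fac (hl e) t).g2) j)) -
    ∑ t, (∑ j, w (emb (pls (fac (hl e) t).h1) j) + ∑ j, w (emb (pls (fac (hl e) t).h2) j))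
theorem cst_neg (hl : NLp) (e : Q1) (w : II α → ℤ) : cst hl e (-w) = - cst hl e w := by
  simp only [cst, Pi.neg_apply, sum_neg_distrib, ← neg_add]; ring
theorem Th_mem (hl : NLp) (e : Q1) (w : II α → ℤ) (W : VV → ℤ)
    (hW : ∀ r c, W ⟨e, (r, c)⟩ = w ⟨ta e, c⟩ - w ⟨ha e, r⟩) (J' J : JJ α) :
    Th hl gX1 e J' J ∈ wF K W (cst hl e w + HH w J - HH w J') := by
  have h1 := sum_slots _ _ (fac_g (α := α) (hl e)) (fun s L => ∑ j, w (emb L j)) J pls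
  have h2 := sum_slots _ _ (fac_h (α := α) (hl e)) (fun s L => ∑ j, w (emb L j)) J' pls
  have := (wF_filt (K := K) W).prod univ _ _ fun t _ =>
    D_mem (K := K) (fac (hl e) t) e w W hW (hl e) (J' _) (J' _) (J _) (J _)
  rw [Th, Theta, of_apply]
  convert this using 2
  rw [sum_sub_distrib, cst, HH, HH]
  rw [sub_eq_iff_eq_add] at h1 h2
  rw [h1, h2]; ring
theorem PP_nil {S : Type} [CommRing S] (hl : NLp) (v : VV → S) : PP hl v [] = 1 := by simp [PP]
theorem PP_cons {S : Type} [CommRing S] (hl : NLp) (v : VV → S) (e l) :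
    PP hl v (e :: l) = Th hl v e * PP hl v l := by simp [PP]
theorem PP_mem (hl : NLp) (w : II α → ℤ) (W : VV → ℤ) (l : List Q1)
    (hW : ∀ e ∈ l, ∀ r c, W ⟨e, (r, c)⟩ = w ⟨ta e, c⟩ - w ⟨ha e, r⟩) (J' J : JJ α) :
    PP hl gX1 l J' J ∈ wF K W ((l.map (cst hl · w)).sum + HH w J - HH w J') := by
  induction l generalizing J' J with
  | nil =>
    rw [PP_nil, one_apply]
    split_ifs with h
    · subst h; simpa using (wF_filt W).one
    · exact AddSubgroup.zero_mem _
  | cons e l ih =>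
    rw [PP_cons, mul_apply]
    refine AddSubgroup.sum_mem _ fun L _ => ?_
    have := (wF_filt (K := K) W).mul _ _ _ _ (Th_mem hl e w W (hW e (by simp)) J' L) (ih (fun e' he' => hW e' (by simp [he'])) L J)
    convert this using 2
    simp only [map_cons, List.sum_cons]; ring
end ThW
section LeadT
variable {Q0 Q1 : Type} [Fintype Q0] [DecidableEq Q0] {ta ha : Q1 → Q0} {α : Q0 → ℕ} {K : Type} [CommRing K]
def Wq : VV → ℤ := fun v => ((v.2.2.1 : ℤ) - v.2.1.1) ^ 2
section
variable (ta ha α : ℕ)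
set_option hygiene false
notation "Wq2" => Wq (ta := ta) (ha := ha) (α := α)
notation "Wq1" => Wq (ta := ta) (ha := ha)
end
def omg (ha : Q1 → Q0) (e : Q1) (δ : ℤ) (p : II α) : ℤ := 2 * δ * p.2.1 + if p.1 = ha e then δ ^ 2 else 0
def Dg (ta ha : Q1 → Q0) (e : Q1) (δ : ℤ) (P Q : II α) : Prop := P = Q ∨ (P.1 = ha e ∧ Q.1 = ta e ∧ (Q.2.1 : ℤ) = P.2.1 + δ)
theorem ent (e : Q1) (hne : ta e ≠ ha e) (δ : ℤ) (P Q : II α) :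
    MM e gX1 P Q ∈ wF K Wq1 (-omg ha e δ P + omg ha e δ Q) ∧
    (Dg ta ha e δ P Q → MM e gX1 P Q ∈ wF K (-Wq1) (-(-omg ha e δ P + omg ha e δ Q))) ∧
    (¬ Dg ta ha e δ P Q → MM e gX1 P Q ∈ wF K Wq1 (-omg ha e δ P + omg ha e δ Q + 1)) := by
  by_cases h : P.1 = ha e ∧ Q.1 = ta e
  · obtain ⟨p, r⟩ := P; obtain ⟨q, c⟩ := Q
    obtain ⟨rfl, rfl⟩ := h
    have hPQ : (⟨ha e, r⟩ : II α) ≠ ⟨ta e, c⟩ := fun h => hne (congrArg Sigma.fst h).symm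
    rw [MM, Matrix.add_apply, one_apply_ne hPQ, zero_add, YY_apply]
    have h1 := wF_X (K := K) Wq2 ⟨e, (r, c)⟩
    have h2 := wF_X (K := K) (-Wq2) ⟨e, (r, c)⟩
    simp only [Dg, hPQ, false_or, true_and, omg, if_true, if_neg hne]
    simp only [Wq, Pi.neg_apply] at h1 h2
    refine ⟨(wF_filt _).anti _ _ ?_ h1, fun h => (wF_filt _).anti _ _ ?_ h2, fun h => (wF_filt _).anti _ _ ?_ h1⟩
    · nlinarith [sq_nonneg ((c : ℤ) - r - δ)]
    · rw [h]; nlinarith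
    · have : 0 < ((c : ℤ) - r - δ) ^ 2 := by
        have : (c : ℤ) - r - δ ≠ 0 := fun h' => h (by linarith)
        positivity
      nlinarith
  · rw [not_and_or] at h
    rw [MM, Matrix.add_apply, YY_ne e _ P Q h, add_zero, one_apply]
    split_ifs with hPQ
    · subst hPQ
      refine ⟨?_, fun _ => ?_, fun h => absurd (.inl rfl) h⟩
      · rw [neg_add_cancel]; exact (wF_filt _).one
      · rw [neg_add_cancel, neg_zero]; exact (wF_filt _).one
    · exact ⟨AddSubgroup.zero_mem _, fun _ => AddSubgroup.zero_mem _, fun _ => AddSubgroup.zero_mem _⟩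
theorem Dg_same (e : Q1) (hne : ta e ≠ ha e) (δ : ℤ) (i : Q0) (a b : Fai) : Dg ta ha e δ ⟨i, a⟩ ⟨i, b⟩ ↔ a.1 = b.1 := by
  constructor
  · rintro (h | ⟨h1, h2, -⟩)
    · cases h; rfl
    · exact absurd (h2.symm.trans h1) hne
  · intro h; exact .inl (by rw [Fin.ext h])
theorem Dg_xy (e : Q1) (hne : ta e ≠ ha e) (δ : ℤ) (a : Fin αhe) (b : Fin αte) :
    Dg ta ha e δ ⟨ha e, a⟩ ⟨ta e, b⟩ ↔ (b.1 : ℤ) = a.1 + δ := by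
  constructor
  · rintro (h | ⟨h1, h2, h3⟩)
    · exact absurd (congrArg Sigma.fst h).symm hne
    · exact h3
  · intro h; exact .inr ⟨rfl, rfl, h⟩
theorem Dg_yx (e : Q1) (hne : ta e ≠ ha e) (δ : ℤ) (a : Fin αte) (b : Fin αhe) :
    ¬ Dg ta ha e δ ⟨ta e, a⟩ ⟨ha e, b⟩ := by
  rintro (h | ⟨h1, h2, h3⟩)
  · exact absurd (congrArg Sigma.fst h) hne
  · exact hne h1
theorem dg_iff (e : Q1) (hne : ta e ≠ ha e) (t : Fin (αhe + αte + 1)) (p q) :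
    Dg ta ha e ((t.1 : ℤ) - αhe) (Sum.elim (emb (pls (fl1).h1)) (emb (pls (fl1).h2)) p)
      (Sum.elim (emb (pls (fl1).g1)) (emb (pls (fl1).g2)) ((fl1).E q)) ↔ p = q := by
  have ht := t.2
  have hE : (fl1).E q = (fl1).E0 q := rfl
  have hg : (fl1).g1.2.1 = αhe - t.1 := rfl
  have hh : (fl1).h2.2.1 = t.1 - αhe := rfl
  rw [hE]
  rcases p with r | j <;> rcases q with r' | j'
  · have h0 : r.1 < min αhe (αhe + αte - t) := r.2
    have h1 : r'.1 < min αhe (αhe + αte - t) := r'.2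
    rw [Sum.inl.injEq, Fin.ext_iff]
    simp only [Fac.E0, elim_inl, emb_plus]
    by_cases h : r'.1 < (fl1).g1.2.1
    · rw [dif_pos h, elim_inl, emb_plus]
      exact Dg_same e hne _ (ha e) ⟨r.1, by omega⟩ ⟨r'.1, by omega⟩
    · rw [dif_neg h, elim_inr, emb_plus]
      refine (Dg_xy e hne _ ⟨r.1, by omega⟩ ⟨r'.1 - (fl1).g1.2.1 + (fl1).h2.2.1, by omega⟩).trans ?_
      simp only [hg, hh] at h ⊢
      omega
  · have h1 : j'.1 < t - αhe := j'.2
    have h0 : r.1 < min αhe (αhe + αte - t) := r.2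
    simp only [Fac.E0, elim_inl, elim_inr, emb_plus, reduceCtorEq, iff_false]
    intro h
    have := (Dg_xy e hne _ ⟨r.1, by omega⟩ ⟨j'.1, by omega⟩).1 h
    simp only at this; omega
  · have h1 : j.1 < t - αhe := j.2
    have h0 : r'.1 < min αhe (αhe + αte - t) := r'.2
    simp only [Fac.E0, elim_inl, elim_inr, emb_plus, reduceCtorEq, iff_false]
    by_cases h : r'.1 < (fl1).g1.2.1
    · rw [dif_pos h, elim_inl, emb_plus]
      exact Dg_yx e hne _ ⟨j.1, by omega⟩ ⟨r'.1, by omega⟩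
    · rw [dif_neg h, elim_inr, emb_plus]
      intro h'
      have := (Dg_same e hne _ (ta e) ⟨j.1, by omega⟩ ⟨r'.1 - (fl1).g1.2.1 + (fl1).h2.2.1, by omega⟩).1 h'
      simp only [hg, hh] at this h; omega
  · have h0 : j.1 < t - αhe := j.2
    have h1 : j'.1 < t - αhe := j'.2
    rw [Sum.inr.injEq, Fin.ext_iff]
    simp only [Fac.E0, elim_inr, emb_plus]
    exact Dg_same e hne _ (ta e) ⟨j.1, by omega⟩ ⟨j'.1, by omega⟩
theorem D_lead (e : Q1) (hne : ta e ≠ ha e) (t : Fin (αhe + αte + 1)) : ∃ c : ℤ,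
    (fl1).D (MM e gX1) (pls _) (pls _) (pls _) (pls _) ∈ wF K Wq1 c ∧
    (fl1).D (MM e gX1) (pls _) (pls _) (pls _) (pls _) -
      (∏ r : Fin (fl1).h1.2.1, if h : r.1 < αhe - t then 1 else
        X (⟨e, (⟨r.1, lt_of_lt_of_le r.2 (min_le_left _ _)⟩, ⟨r.1 + t - αhe, by
          have h1 : r.1 < min αhe (αhe + αte - t) := r.2
          omega⟩)⟩ : VV)) ∈ wF K Wq1 (c + 1) ∧
    (∏ r : Fin (fl1).h1.2.1, if h : r.1 < αhe - t then 1 else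
        X (⟨e, (⟨r.1, lt_of_lt_of_le r.2 (min_le_left _ _)⟩, ⟨r.1 + t - αhe, by
          have h1 : r.1 < min αhe (αhe + αte - t) := r.2
          omega⟩)⟩ : VV)) ∈ wF K (-Wq1) (-c) := by
  have ht := t.2
  set f := fl1 with hf
  let M : Matrix _ _ PK := of fun p q => MM e gXK (Sum.elim (emb (pls f.h1)) (emb (pls f.h2)) p)
      (Sum.elim (emb (pls f.g1)) (emb (pls f.g2)) (f.E q))
  let a : _ → ℤ := fun p => - omg ha e ((t.1 : ℤ) - αhe) (Sum.elim (emb (pls f.h1)) (emb (pls f.h2)) p)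
  let b : _ → ℤ := fun q => omg ha e ((t.1 : ℤ) - αhe) (Sum.elim (emb (pls f.g1)) (emb (pls f.g2)) (f.E q))
  have h1 : ∀ p q, M p q ∈ wF K Wq1 (a p + b q) := fun p q => (ent e hne _ _ _).1
  have h2 : ∀ p q, p ≠ q → M p q ∈ wF K Wq1 (a p + b q + 1) := fun p q hpq =>
    (ent e hne _ _ _).2.2 (fun h => hpq ((dg_iff e hne t p q).1 h))
  have h3 : ∀ p, M p p ∈ wF K (-Wq1) (-(a p + b p)) := fun p =>
    (ent e hne _ _ _).2.1 ((dg_iff e hne t p p).2 rfl)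
  have hd : ∏ p, M p p = ∏ r : Fin (fl1).h1.2.1, if h : r.1 < αhe - t then 1 else
        X (⟨e, (⟨r.1, lt_of_lt_of_le r.2 (min_le_left _ _)⟩, ⟨r.1 + t - αhe, by
          have h1 : r.1 < min αhe (αhe + αte - t) := r.2
          omega⟩)⟩ : VV) := by
    rw [prod_sum_type]
    have hdiag : ∀ P : II α, MM e gXK P P = 1 := by
      intro P
      rw [MM, Matrix.add_apply, one_apply_eq, YY_ne, add_zero]
      by_contra hc; push Not at hc; exact hne (hc.2.symm.trans hc.1)
    have hj : ∏ j, M (.inr j) (.inr j) = 1 := prod_eq_one fun j _ => by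
      change MM e gXK _ _ = 1
      exact hdiag _
    rw [hj, mul_one]
    refine prod_congr rfl fun r _ => ?_
    change MM e gXK (emb (pls f.h1) r) (Sum.elim (emb (pls f.g1)) (emb (pls f.g2)) (f.E0 (.inl r))) = _
    simp only [Fac.E0]
    have hr : r.1 < min αhe (αhe + αte - t) := r.2
    by_cases h : r.1 < αhe - t
    · rw [dif_pos h, dif_pos (by exact h)]; exact hdiag _
    · rw [dif_neg h, dif_neg (by exact h), elim_inr, emb_plus, emb_plus]
      have hP : (⟨f.h1.1, ⟨r.1, by have := r.2; omega⟩⟩ : II α) = ⟨ha e, ⟨r.1, by omega⟩⟩ := rfl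
      have hQ : (⟨f.g2.1, ⟨r.1 - f.g1.2.1 + f.h2.2.1, by
        have h1 : f.g1.2.1 = αhe - t := rfl
        have h2 : f.h2.2.1 = t - αhe := rfl
        change _ < αte
        omega⟩⟩ : II α) = ⟨ta e, ⟨r.1 + t - αhe, by omega⟩⟩ := by
        have h1 : f.g1.2.1 = αhe - t := rfl
        have h2 : f.h2.2.1 = t - αhe := rfl
        have : r.1 - f.g1.2.1 + f.h2.2.1 = r.1 + t - αhe := by omega
        simp only [this]; rfl
      refine Eq.trans (congrArg₂ _ hP hQ) ?_
      rw [MM, Matrix.add_apply, one_apply_ne (fun h => hne (congrArg Sigma.fst h).symm), zero_add, YY_apply]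
  refine ⟨∑ p, a p + ∑ q, b q, (wF_filt _).det M a b h1, ?_, ?_⟩
  · have := (wF_filt _).det_lead M 1 a b h1 (by simpa using h2)
    simp only [Perm.sign_one, val_one, one_smul, Perm.one_apply, hd] at this
    exact this
  · rw [← hd]
    have := (wF_filt _).prod univ _ _ fun p _ => h3 p
    rwa [sum_neg_distrib, sum_add_distrib] at this
end LeadT
section LeadU
variable {Q0 Q1 : Type} [Fintype Q0] [DecidableEq Q0] {ta ha : Q1 → Q0} {α : Q0 → ℕ} {K : Type} [CommRing K]
noncomputable def mE (ta ha : Q1 → Q0) (α : Q0 → ℕ) (e : Q1) : VV →₀ ℕ :=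
  ∑ rc : Fin αhe × Fin αte, Finsupp.single ⟨e, rc⟩ 1
theorem sig_ext {n : ℕ} {f : Fin n → ℕ} (t : Fin n) (r : Fin (f t)) (t' r' : ℕ) (h1 : t' = t.1) (h2 : r' = r.1)
    (h3 : t' < n) (h4 : r' < f ⟨t', h3⟩) : (⟨⟨t', h3⟩, ⟨r', h4⟩⟩ : Σ t, Fin (f t)) = ⟨t, r⟩ := by
  subst h1; subst h2; rfl
theorem D_off (e : Q1) (hne : ta e ≠ ha e) (s) :
    (fr1).D (MM e (gX (K := K) (ta := ta) (ha := ha) (α := α))) (pls _) (pls _) (pls _) (pls _) = 1 := by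
  have : (of fun p q => MM e (gX (K := K) (ta := ta) (ha := ha) (α := α)) (Sum.elim (emb (pls (fr1).h1)) (emb (pls (fr1).h2)) p)
      (Sum.elim (emb (pls (fr1).g1)) (emb (pls (fr1).g2)) ((fr1).E q))) = 1 := by
    ext1 p q
    have hE : (fr1).E q = (fr1).E0 q := rfl
    rcases p with r | r
    · rcases q with r' | r'
      · rw [of_apply, hE]
        have hr : r'.1 < s.1.2.1 := r'.2
        simp only [Fac.E0, elim_inl]
        rw [dif_pos (show r'.1 < (fr1).g1.2.1 from hr), elim_inl, MM, Matrix.add_apply]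
        rw [YY_ne e gX (emb (pls (fr1).h1) r) _ (.inl s.2.2), add_zero]
        have h2 : emb (pls (fr1).g1) ⟨r'.1, hr⟩ = emb (pls (fr1).h1) r' := rfl
        rw [h2]
        by_cases h : r = r'
        · subst h; rw [one_apply_eq, one_apply_eq]
        · rw [one_apply_ne (fun h' => h (emb_inj _ h')), one_apply_ne (fun h' => h (Sum.inl.inj h'))]
      · exact elim0 (r' : Fin 0)
    · exact elim0 (r : Fin 0)
  exact (congrArg det this).trans det_one
theorem Th_lead (hl : NLp) (e : Q1) : ∃ c : ℤ,
    Th hl gX1 e pls pls ∈ wF K Wq2 c ∧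
    Th hl gX1 e pls pls - monomial (mE ta ha α e) 1 ∈ wF K Wq1 (c + 1) ∧
    monomial (mE ta ha α e) 1 ∈ wF K (-Wq1) (-c) := by
  choose c hc1 hc2 hc3 using D_lead (K := K) (α := α) (ta := ta) (ha := ha) e (hl e)
  have hT : Th hl gX1 e pls pls = ∏ t, (fac (hl e) (.inl t)).D (MM e (gX (K := K) (ta := ta) (ha := ha) (α := α))) (pls _) (pls _) (pls _) (pls _) := by
    rw [Th, Theta, of_apply, prod_sum_type]
    rw [prod_eq_one (s := (univ : Finset {s : Sl α // s.1 ≠ ta e ∧ s.1 ≠ ha e})) fun s _ => D_off e (hl e) s, mul_one]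
  have hM : monomial (mE ta ha α e) (1 : K) = ∏ t : Fin (αhe + αte + 1),
      (∏ r : Fin (fac (hl e) (.inl t)).h1.2.1, if h : r.1 < αhe - t then (1 : PK) else
        X (⟨e, (⟨r.1, lt_of_lt_of_le r.2 (min_le_left _ _)⟩, ⟨r.1 + t - αhe, by
          have h1 : r.1 < min αhe (αhe + αte - t) := r.2
          omega⟩)⟩ : VV)) := by
    rw [mE, monomial_sum_one, ← prod_sigma']
    have key : ∀ (rc : Fin αhe × Fin αte), ∃ h1, ∃ h2 : rc.1.1 < min αhe (αhe + αte - (rc.2.1 + αhe - rc.1.1)),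
       (fun p : (t : Fin (αhe + αte + 1)) × Fin (fac (hl e) (.inl t)).h1.2.1 => if h : p.2.1 < αhe - p.1 then (1 : PK) else
        X (⟨e, (⟨p.2.1, lt_of_lt_of_le p.2.2 (min_le_left _ _)⟩, ⟨p.2.1 + p.1 - αhe, by
          have h1 : p.2.1 < min αhe (αhe + αte - p.1) := p.2.2
          omega⟩)⟩ : VV)) ⟨⟨rc.2.1 + αhe - rc.1.1, h1⟩, ⟨rc.1.1, h2⟩⟩ = monomial (Finsupp.single ⟨e, rc⟩ 1) 1 := by
      rintro ⟨r, c⟩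
      have := r.2; have := c.2
      refine ⟨by simp only; omega, by simp only; omega, ?_⟩
      simp only
      rw [dif_neg (by omega)]
      have : (⟨r.1 + (c.1 + αhe - r.1) - αhe, by omega⟩ : Fin αte) = c := Fin.ext (by simp only; omega)
      rw [this]; rfl
    choose h1 h2 h3 using key
    refine prod_bij_ne_one (fun rc _ _ => ⟨⟨rc.2.1 + αhe - rc.1.1, h1 rc⟩, ⟨rc.1.1, h2 rc⟩⟩) (by simp) ?_ ?_ ?_
    · rintro ⟨r, c⟩ - - ⟨r', c'⟩ - - h
      have e1 : c.1 + αhe - r.1 = c'.1 + αhe - r'.1 := congrArg (fun p => p.1.1) h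
      have e2 : r.1 = r'.1 := congrArg (fun p => p.2.1) h
      have := r.2; have := r'.2
      exact Prod.ext (Fin.ext e2) (Fin.ext (by simp only; omega))
    · rintro ⟨t, r⟩ - h
      have hr : r.1 < min αhe (αhe + αte - t) := r.2
      by_cases h' : r.1 < αhe - t
      · exact absurd (dif_pos h') h
      have e0 := sig_ext (f := fun t => (fac (hl e) (.inl t)).h1.2.1) t r (r.1 + t.1 - αhe + αhe - r.1) r.1 (by omega) rfl
        (by omega) (by change r.1 < min αhe (αhe + αte - (r.1 + t.1 - αhe + αhe - r.1)); omega)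
      have e1 := h3 (⟨r.1, by omega⟩, ⟨r.1 + t - αhe, by omega⟩)
      refine ⟨(⟨r.1, by omega⟩, ⟨r.1 + t - αhe, by omega⟩), mem_univ _, ?_, e0⟩
      rw [← e1]
      exact fun h4 => h (by rw [← e0]; exact h4)
    · intro rc _ _; exact (h3 rc).symm
  refine ⟨∑ t, c t, ?_, ?_, ?_⟩
  · rw [hT]; exact (wF_filt _).prod _ _ _ fun t _ => hc1 t
  · rw [hT, hM]; exact (wF_filt _).prod_cong _ _ _ _ (fun t _ => hc1 t) fun t _ => hc2 t
  · rw [hM, ← sum_neg_distrib]; exact (wF_filt _).prod _ _ _ fun t _ => hc3 t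
end LeadU
section LeadV
variable {Q0 Q1 : Type} [Fintype Q0] [DecidableEq Q0] {ta ha : Q1 → Q0} {α : Q0 → ℕ} {K : Type} [CommRing K] [Nontrivial K]
theorem mw_nsmul {ι : Type} (w : ι → ℤ) (q : ℕ) (m : ι →₀ ℕ) : mw w (q • m) = q * mw w m := by
  induction q with
  | zero => simp [mw]
  | succ q ih => rw [succ_nsmul, mw_add, ih]; push_cast; ring
theorem mw_sum {ι J : Type} (w : ι → ℤ) (s : Finset J) (m : J → ι →₀ ℕ) : mw w (∑ i ∈ s, m i) = ∑ i ∈ s, mw w (m i) := by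
  classical
  induction s using Finset.induction_on with
  | empty => simp [mw]
  | insert a s ha ih => rw [sum_insert ha, sum_insert ha, mw_add, ih]
theorem wF_mon {ι : Type} {w : ι → ℤ} {c : ℤ} {m : ι →₀ ℕ} (h : monomial m (1 : K) ∈ wF K w c) : c ≤ mw w m :=
  h m (by classical rw [mem_support_iff, coeff_monomial, if_pos rfl]; exact one_ne_zero)
theorem Th_coeff (hl : NLp) (e : Q1) : coeff (mE ta ha α e) (Th hl gX1 e pls pls) = 1 := by
  classical
  obtain ⟨c, h1, h2, h3⟩ := Th_lead (K := K) (α := α) hl e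
  have := wF_mon h3
  rw [mw_neg] at this
  have h4 := wF_coeff h2 (m := mE ta ha α e) (by omega)
  rw [coeff_sub, coeff_monomial, if_pos rfl] at h4
  linear_combination h4
theorem Th_prod_coeff [Fintype Q1] (hl : NLp) (q : ℕ) :
    coeff (q • ∑ e, mE ta ha α e) (∏ e, Th hl gX1 e pls pls ^ q) = 1 := by
  classical
  choose c h1 h2 h3 using fun e => Th_lead (K := K) (α := α) hl e
  have h4 := (wF_filt (K := K) Wq2).prod_cong univ _ _ _ (fun e _ => (wF_filt _).pow (h1 e) q)
    (fun e _ => (wF_filt _).pow_cong (h1 e) (h2 e) q)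
  have h5 : mw Wq2 (q • ∑ e, mE ta ha α e) ≤ ∑ e, (q : ℤ) * c e := by
    rw [mw_nsmul, mw_sum, Finset.mul_sum]
    refine sum_le_sum fun e _ => mul_le_mul_of_nonneg_left ?_ (by positivity)
    have := wF_mon (h3 e); rw [mw_neg] at this; omega
  have h6 := wF_coeff h4 (m := q • ∑ e, mE ta ha α e) (by omega)
  have h7 : ∏ e, monomial (mE ta ha α e) (1 : K) ^ q = monomial (q • ∑ e, mE ta ha α e) 1 := by
    rw [prod_pow, ← monomial_sum_one, monomial_pow, one_pow]
  rw [h7, coeff_sub, coeff_monomial, if_pos rfl] at h6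
  linear_combination h6
theorem HH_lt (J : JJ α) (hJ : J ≠ pls) : HH (α := α) (fun p => (p.2.1 : ℤ)) pls + 1 ≤ HH (fun p => (p.2.1 : ℤ)) J := by
  have hle : ∀ s (j : Fin s.2.1), (pls s j).1 ≤ (J s j).1 := by
    intro s
    rintro ⟨j, hj⟩
    induction j with
    | zero => exact Nat.zero_le _
    | succ j ih =>
      have h1 := ih (by omega)
      have h2 : J s ⟨j, by omega⟩ < J s ⟨j + 1, hj⟩ := (J s).strictMono (by simp [lt_def])
      have h3 : (pls s ⟨j, by omega⟩).1 = j := rfl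
      have h4 : (pls s ⟨j + 1, hj⟩).1 = j + 1 := rfl
      rw [lt_def] at h2; omega
  obtain ⟨s, hs⟩ := ne_iff.1 hJ
  obtain ⟨j, hj⟩ := DFunLike.ne_iff.1 hs
  have hlt : (pls s j).1 < (J s j).1 := lt_of_le_of_ne (hle s j) (fun h => hj (Fin.ext h.symm))
  rw [Int.add_one_le_iff]
  refine sum_lt_sum (fun s _ => sum_le_sum fun j _ => ofNat_le.2 (hle s j)) ⟨s, mem_univ _, ?_⟩
  exact sum_lt_sum (fun j _ => ofNat_le.2 (hle s j)) ⟨j, mem_univ _, Int.ofNat_lt.2 hlt⟩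
open Classical in
noncomputable def nue (e : Q1) : VV → ℤ := fun v => if v.1 = e then (v.2.2.1 : ℤ) - v.2.1.1 else 0
theorem cst_zero (hl : NLp) (e : Q1) : cst (α := α) hl e 0 = 0 := by simp [cst]
theorem HH_zero (J : JJ α) : HH (α := α) 0 J = 0 := by simp [HH]
theorem PP_nue (hl : NLp) (e : Q1) (l : List Q1) (he : e ∉ l) (J' J : JJ α) :
    PP hl gX1 l J' J ∈ wF K (nue (ta := ta) (ha := ha) (α := α) e) 0 := by
  have := PP_mem (K := K) hl 0 (nue (ta := ta) (ha := ha) (α := α) e) l (fun e' he' r c => by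
    simp only [nue, if_neg (show e' ≠ e from fun h => he (h ▸ he'))]; rfl) J' J
  simpa [cst_zero, HH_zero, Function.comp_def] using this
theorem PP_coeff_aux [Fintype Q1] (hl : NLp) (q : ℕ) (l : List Q1) (hn : l.Nodup) (A : PK)
    (hA : ∀ e ∈ l, A ∈ wF K (nue e) 0) :
    coeff (q • ∑ e, mE ta ha α e) (A * PP hl gX1 l pls pls ^ q) =
      coeff (q • ∑ e, mE ta ha α e) (A * (l.map fun e => Th hl gX1 e pls pls ^ q).prod) := by
  classical
  induction l generalizing A with
  | nil => simp [PP_nil]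
  | cons e l ih =>
    rw [List.nodup_cons] at hn
    let w : II α → ℤ := fun p => (p.2.1 : ℤ)
    have hT := fun J => Th_mem (K := K) hl e w (nue e) (fun r c => by simp [nue, w]) pls J
    have hT' := Th_mem (K := K) hl e (-w) (-nue e) (fun r c => by simp [nue, w]; ring) pls pls
    have hc := hT' _ (mem_support_iff.2 (by rw [Th_coeff]; exact one_ne_zero))
    rw [mw_neg, cst_neg] at hc
    set x := PP hl gX1 (e :: l) pls pls
    set y := Th hl gX1 e pls pls
    set z := PP hl gX1 l pls pls
    have hxy : x - y * z ∈ wF K (nue e) (cst hl e w + 1) := by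
      have : x - y * z = ∑ J ∈ univ.erase pls, Th hl gX1 e pls J * PP hl gX1 l J pls := by
        rw [sub_eq_iff_eq_add, sum_erase_add _ _ (mem_univ _)]
        simp only [x]; rw [PP_cons, mul_apply]
      rw [this]
      refine AddSubgroup.sum_mem _ fun J hJ => ?_
      have h1 := HH_lt J (ne_of_mem_erase hJ)
      have h2 := (wF_filt _).mul _ _ _ _ (hT J) (PP_nue (K := K) hl e l hn.1 J pls)
      exact (wF_filt _).anti _ _ (by simp only [w] at h1 ⊢; omega) h2
    have hy : y ∈ wF K (nue e) (cst hl e w) := by simpa using hT pls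
    have hx : x ∈ wF K (nue e) (cst hl e w) := by
      have h2 := (wF_filt _).mul _ _ _ _ hy (PP_nue (K := K) hl e l hn.1 pls pls)
      have := AddSubgroup.add_mem _ ((wF_filt _).anti _ _ (by omega) hxy) h2
      simpa [z] using this
    have h3 := (wF_filt _).mul _ _ _ _ (hA e List.mem_cons_self) ((wF_filt _).pow_cong hx hxy q)
    have hM : mw (nue (ta := ta) (ha := ha) (α := α) e) (q • ∑ e, mE ta ha α e) ≤ q * cst hl e w := by
      rw [mw_nsmul, mw_sum]
      refine mul_le_mul_of_nonneg_left ?_ (by positivity)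
      rw [sum_eq_single e]
      · linarith
      · intro e' _ he'
        rw [mE, mw_sum]
        refine sum_eq_zero fun rc _ => ?_
        simp [mw, nue, he']
      · simp
    have h4 := wF_coeff h3 (m := q • ∑ e, mE ta ha α e) (by omega)
    rw [mul_sub, coeff_sub, sub_eq_zero] at h4
    rw [h4, mul_pow, ← mul_assoc, ih hn.2, map_cons, List.prod_cons, mul_assoc]
    intro e' he'
    have hee : e' ≠ e := fun h => hn.1 (h ▸ he')
    have h5 := PP_nue (K := K) (α := α) hl e' [e] (by simpa using hee) pls pls
    rw [PP_cons, PP_nil, mul_one] at h5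
    have := (wF_filt _).mul _ _ _ _ (hA e' (List.mem_cons_of_mem _ he')) ((wF_filt _).pow h5 q)
    simpa using this
theorem PP_coeff [Fintype Q1] (hl : NLp) (q : ℕ) :
    coeff (q • ∑ e, mE ta ha α e) (PP hl gX1 univ.toList pls pls ^ q) = 1 := by
  have := PP_coeff_aux (K := K) (α := α) hl q univ.toList (Finset.nodup_toList _) 1 (fun e _ => (wF_filt _).one)
  rw [one_mul, one_mul] at this
  rw [this, Finset.prod_map_toList, Th_prod_coeff]
theorem PP_supp [Fintype Q1] (hl : NLp) (w : II α → ℤ) (q : ℕ) :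
    PP hl gX1 univ.toList pls pls ^ q ∈ wF K (fun v : VV => w v22 - w v21)
      (mw (fun v : VV => w v22 - w v21) (q • ∑ e, mE ta ha α e)) := by
  set W := fun v : VV => w v22 - w v21 with hW
  have h1 := PP_mem (K := K) hl w W univ.toList (fun e _ r c => rfl) pls pls
  have h2 := PP_mem (K := K) hl (-w) (-W) univ.toList (fun e _ r c => by simp [hW]; ring) pls pls
  have h3 := PP_coeff (K := K) (α := α) hl 1
  rw [one_smul, pow_one] at h3
  have h4 := h2 _ (mem_support_iff.2 (by rw [h3]; exact one_ne_zero))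
  have h5 : (univ.toList.map (cst hl · (-w))).sum = - (univ.toList.map (cst hl · w)).sum := by
    simp only [Finset.sum_map_toList, cst_neg, sum_neg_distrib]
  rw [h5, mw_neg] at h4
  have := (wF_filt _).pow h1 q
  refine (wF_filt _).anti _ _ ?_ this
  rw [mw_nsmul]
  exact mul_le_mul_of_nonneg_left (by linarith) (by positivity)
end LeadV
section Roots
theorem sgl_neg {n K : Type} [DecidableEq n] [Field K] (a b : n) (c : K) : single a b (-c) = - single a b c :=
  (map_neg (singleAddMonoidHom a b : K →+ Matrix n n K) c)
theorem sgl_add {n K : Type} [DecidableEq n] [Field K] (a b : n) (c d : K) : single a b (c + d) = single a b c + single a b d :=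
  (map_add (singleAddMonoidHom a b : K →+ Matrix n n K) c d)
theorem tv_comm {n K : Type} [Fintype n] [DecidableEq n] [Field K] {k l m : n} (h1 : k ≠ l) (h2 : l ≠ m) (h3 : k ≠ m) (z : K) :
    transvection k m z = transvection k l z * transvection l m 1 * transvection k l (-z) * transvection l m (-1) := by
  simp only [transvection, add_mul, mul_add, Matrix.mul_one, Matrix.one_mul, single_mul_single_same,
    single_mul_single_of_ne _ _ _ _ h2.symm, single_mul_single_of_ne _ _ _ _ h1.symm, single_mul_single_of_ne _ _ _ _ h3.symm,
    Matrix.zero_mul, add_zero, zero_add, mul_neg, neg_mul, mul_one, one_mul, Matrix.mul_zero, sgl_neg, neg_zero, neg_neg]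
  abel
theorem tv_low {n K : Type} [Fintype n] [DecidableEq n] [Field K] {k l : n} (h1 : k ≠ l) (x y : K) (hy : y = 1 + x) (h0 : y ≠ 0)
    (d : n → K) (hk : d k = y) (hl : d l = y⁻¹) (hd : ∀ j, j ≠ k → j ≠ l → d j = 1) :
    transvection k l x * transvection l k 1 = transvection l k y⁻¹ * diagonal d * transvection k l (x / y) := by
  have hD : diagonal d = 1 + single k k x + single l l (-(x / y)) := by
    ext a b
    by_cases hab : a = b
    · subst hab
      by_cases ha : a = k
      · subst ha; simp [hk, hy, h1.symm]
      by_cases hb : a = l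
      · subst hb; simp [hl, h1]; field_simp; rw [hy]; ring
      · simp [hd a ha hb, single, Ne.symm ha, Ne.symm hb]
    · rw [diagonal_apply_ne _ hab, Matrix.add_apply, Matrix.add_apply, one_apply_ne hab]
      simp only [single, of_apply]
      rw [if_neg (fun h => hab (h.1.symm.trans h.2)), if_neg (fun h => hab (h.1.symm.trans h.2))]; simp
  have e1 : x * (x / y) = x - x/y := by field_simp; rw [hy]; ring
  have e2 : y⁻¹ * x = 1 - y⁻¹ := by field_simp; rw [hy]; ring
  have e3 : (1 - y⁻¹) * (x / y) = x / y - x / y * y⁻¹ := by ring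
  have e4 : -(x / y) * y⁻¹ = 0 - x/y * y⁻¹ := by ring
  have e5 : y⁻¹ * (x/y) = x/y*y⁻¹ := by ring
  rw [hD]
  simp only [transvection, add_mul, mul_add, Matrix.mul_one, Matrix.one_mul, single_mul_single_same,
    single_mul_single_of_ne _ _ _ _ h1.symm, single_mul_single_of_ne _ _ _ _ h1,
    Matrix.zero_mul, add_zero, zero_add, Matrix.mul_zero, mul_one, e1, e2, e3, e5]
  simp only [sub_eq_add_neg, sgl_add, sgl_neg]
  abel
theorem poly_inv {K : Type} [Field K] [Infinite K] (P G : Polynomial K) (h : ∀ y : K, y ≠ 0 → P.eval y = G.eval y⁻¹) (z : K) :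
    G.eval z = G.eval 0 := by
  have h1 : Polynomial.X ^ G.natDegree * P = G.reverse := by
    apply Polynomial.eq_of_infinite_eval_eq
    refine Set.Infinite.mono (s := {(0 : K)}ᶜ) ?_ (Set.finite_singleton (0 : K)).infinite_compl
    intro y hy
    have hy : y ≠ 0 := hy
    change Polynomial.eval _ _ = _
    rw [Polynomial.eval_mul, Polynomial.eval_pow, Polynomial.eval_X, h y hy]
    letI := invertibleOfNonzero (inv_ne_zero hy)
    have := eval₂_reverse_mul_pow (RingHom.id K) y⁻¹ G
    rw [invOf_eq_inv, inv_inv, Polynomial.eval₂_id, Polynomial.eval₂_id] at this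
    rw [← this, mul_comm, mul_assoc, ← mul_pow, inv_mul_cancel₀ hy, one_pow, mul_one]
  have h2 : G.natDegree = 0 := by
    by_contra hc
    have := congrArg (Polynomial.coeff · 0) h1
    simp only [coeff_zero_reverse, Polynomial.mul_coeff_zero, Polynomial.coeff_X_pow] at this
    rw [if_neg (fun h => hc h.symm), zero_mul] at this
    rw [Polynomial.leadingCoeff_eq_zero.1 this.symm] at hc; simp at hc
  rw [eq_C_of_natDegree_eq_zero h2]; simp
variable {Q0 Q1 : Type} [Fintype Q0] [DecidableEq Q0] {ta ha : Q1 → Q0} {α : Q0 → ℕ} {K : Type} [Field K] [Infinite K]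
theorem tva_zero {R : Type} [CommRing R] (i : Q0) (k l : Fai) (v : VV → R) : tva i k l 0 v = v := by
  have : (tvm i k l (0 : R) : Mt α R) = 1 := by
    rw [tvm, transvection_zero]; exact update_eq_self i (1 : Mt α R)
  rw [tva, neg_zero, this, cact_one]
theorem aeval_tva {R R' : Type} [CommRing R] [CommRing R'] [Algebra K R] [Algebra K R'] (φ : R →ₐ[K] R') (i : Q0) (k l : Fai) (z : R)
    (v : VV → R) (g : PK) : φ (aeval (tva i k l z v) g) = aeval (tva i k l (φ z) (fun p => φ (v p))) g := by
  have := tva_map (φ : R →+* R') i k l z v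
  simp only [coe_coe] at this
  rw [← this, ← comp_aeval_apply]
theorem isL_of_simple {χ : Q0 → ℤ} {g : PK} (hw : ∀ m ∈ g.support, ∀ i k, wtm m i k = χ i)
    (hg : ∀ i (l0 l1 : Fai), l0.1 + 1 = l1.1 → ∀ (z : K) (v : VV → K), aeval (tva i l0 l1 z v) g = aeval v g) :
    IsL χ g := by
  have hD : ∀ D, dgl D ∈ goodG (F := K) χ g := by
    intro D v
    have h1 : chr χ (dgl D) = ((∏ i, (∏ k, D i k) ^ χ i : Kˣ) : K) := by
      simp [chr, dgl, det_diagonal]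
    rw [h1, gact]
    refine (aeval_diag g D v).trans ?_
    conv_rhs => rw [g.as_sum, map_sum, Finset.mul_sum]
    refine sum_congr rfl fun m hm => ?_
    congr 2
    refine prod_congr rfl fun i _ => ?_
    rw [← prod_zpow]
    exact prod_congr rfl fun k _ => by rw [hw m hm]
  have hU : ∀ i (l0 l1 : Fai) (h : l0.1 + 1 = l1.1) (h' : l0 ≠ l1) z, tgl i l0 l1 h' z ∈ goodG (F := K) χ g := by
    intro i l0 l1 h h' z v
    rw [gact_tgl, chr_tgl, one_mul, hg i l0 l1 h]
  have hLo : ∀ i (k l : Fai) (h : k.1 + 1 = l.1) (h' : l ≠ k) z, tgl i l k h' z ∈ goodG (F := K) χ g := by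
    intro i k l h h' z v
    rw [gact_tgl, chr_tgl, one_mul]
    let G : Polynomial K := aeval (tva i l k Polynomial.X (fun p => Polynomial.C (v p))) g
    let P : Polynomial K := aeval (tva i l k 1 (tva i k l (Polynomial.X - 1) (fun p => Polynomial.C (v p)))) g
    have hG : ∀ z : K, G.eval z = aeval (tva i l k z v) g := by
      intro z
      have := aeval_tva (Polynomial.aeval z) i l k Polynomial.X (fun p => Polynomial.C (v p)) g
      simpa [Polynomial.coe_aeval_eq_eval] using this
    have hP : ∀ z : K, P.eval z = aeval (tva i l k 1 (tva i k l (z - 1) v)) g := by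
      intro z
      have := aeval_tva (Polynomial.aeval z) i l k 1 (tva i k l (Polynomial.X - 1) (fun p => Polynomial.C (v p))) g
      have h2 := tva_map ((Polynomial.aeval z : Polynomial K →ₐ[K] K) : Polynomial K →+* K) i k l (Polynomial.X - 1) (fun p => Polynomial.C (v p))
      simp only [coe_coe] at h2
      rw [h2] at this
      simpa [Polynomial.coe_aeval_eq_eval] using this
    rw [← hG, poly_inv P G ?_ z, hG, tva_zero]
    intro y hy
    rw [hP, hG]
    classical
    let d : (j : Q0) → Fin (α j) → Kˣ := update 1 i (fun j => if j = k then Units.mk0 y hy else if j = l then (Units.mk0 y hy)⁻¹ else 1)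
    have hid : tgl i k l h'.symm (y - 1) * tgl i l k h' (1 : K) = tgl i l k h' y⁻¹ * dgl d * tgl i k l h'.symm ((y - 1) / y) := by
      funext j
      by_cases hj : j = i
      · subst hj
        refine Units.ext ?_
        simp only [tgl, Pi.mul_apply, mulSingle_eq_same, val_mul, dgl]
        refine tv_low h'.symm (y - 1) y (by ring) hy _ ?_ ?_ ?_
        · simp [d]
        · simp [d, h']
        · intro a h1 h2; simp [d, h1, h2]
      · have : dgl d j = 1 := by
          refine Units.ext ?_
          simp [dgl, d, hj]
        simp [tgl, Pi.mul_apply, hj, this]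
    have hdet : chr χ (dgl d) = 1 := by
      refine prod_eq_one fun j _ => ?_
      by_cases hj : j = i
      · subst hj
        have : (dgl d j).val.det = 1 := by
          simp only [dgl, det_diagonal]
          rw [← mul_prod_erase _ _ (mem_univ k), ← mul_prod_erase _ _ (mem_erase.2 ⟨h', mem_univ l⟩), prod_eq_one]
          · simp [d, h', hy]
          · intro a ha; simp only [mem_erase] at ha; simp [d, ha.1, ha.2.1]
        rw [this, _root_.one_zpow]
      · simp [dgl, d, hj]
    have e1 : aeval (gact (tgl i k l h'.symm (y - 1) * tgl i l k h' (1 : K)) v) g = aeval (tva i l k 1 (tva i k l (y - 1) v)) g := by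
      rw [gact_mul, gact_tgl, gact_tgl]
    rw [← e1, hid, gact_mul, hU i k l h h'.symm _ _, gact_mul, hD d _, chr_tgl, hdet, one_mul, one_mul, gact_tgl]
  have hA : ∀ (d : ℕ) i (k l : Fai) (h : k ≠ l), (k.1 - l.1) + (l.1 - k.1) = d + 1 → ∀ z, tgl i k l h z ∈ goodG (F := K) χ g := by
    intro d
    induction d with
    | zero =>
      intro i k l h hd z
      rcases lt_or_gt_of_ne h with h1 | h1 <;> rw [lt_def] at h1
      · exact hU i k l (by omega) h z
      · exact hLo i l k (by omega) h z
    | succ d ih =>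
      intro i k l h hd z
      obtain ⟨m, hm⟩ : ∃ m : Fai, (k.1 - m.1) + (m.1 - k.1) = 1 ∧ (m.1 - l.1) + (l.1 - m.1) = d + 1 := by
        rcases lt_or_gt_of_ne h with h1 | h1 <;> rw [lt_def] at h1
        · exact ⟨⟨k.1 + 1, by omega⟩, by simp only; omega⟩
        · exact ⟨⟨k.1 - 1, by omega⟩, by simp only; omega⟩
      have h1 : k ≠ m := fun h => by subst h; omega
      have h2 : m ≠ l := fun h => by subst h; omega
      have hkm : ∀ z, tgl i k m h1 z ∈ goodG (F := K) χ g := fun z => by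
        rcases lt_or_gt_of_ne h1 with h3 | h3 <;> rw [lt_def] at h3
        · exact hU i k m (by omega) h1 z
        · exact hLo i m k (by omega) h1 z
      have : tgl i k l h z = tgl i k m h1 z * tgl i m l h2 1 * tgl i k m h1 (-z) * tgl i m l h2 (-1) := by
        simp only [tgl, ← mulSingle_mul]
        congr 1
        exact Units.ext (tv_comm h1 h2 h z)
      rw [this]
      exact mul_mem (mul_mem (mul_mem (hkm _) (ih i m l h2 hm.2 _)) (hkm _)) (ih i m l h2 hm.2 _)
  refine ⟨hw, fun i k l h => tv_of_scalars i k l fun z => ?_⟩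
  apply MvPolynomial.funext
  intro v
  have h1 : (k.1 - l.1) + (l.1 - k.1) = ((k.1 - l.1) + (l.1 - k.1) - 1) + 1 := by
    have : k.1 ≠ l.1 := fun h' => h (Fin.ext h')
    omega
  have h2 := hA _ i k l h h1 z v
  rw [gact_tgl, chr_tgl, one_mul] at h2
  rw [← coe_aeval_eq_eval]
  refine Eq.trans ?_ h2
  have := aeval_tva (aeval v) i k l (C z) X g
  simpa using this
end Roots
section Trace
variable {V K : Type} [Fintype V] [Field K] (p : ℕ)
noncomputable def cPP : V →₀ ℕ := equivFunOnFinite.symm fun _ => p - 1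
open Classical in
noncomputable def Tr0 : MvPolynomial V K →ₗ[K] MvPolynomial V K :=
  (basisMonomials V K).constr K fun m => if ∀ v, m v % p = p - 1 then monomial (equivFunOnFinite.symm fun v => m v / p) 1 else 0
variable {p}
theorem Tr0_coeff (hp : 0 < p) (f : MvPolynomial V K) (β : V →₀ ℕ) : coeff β (Tr0 p f) = coeff (cPP p + p • β) f := by
  classical
  have : (lcoeff K β).comp (Tr0 (K := K) p) = lcoeff K (cPP p + p • β) := by
    apply (basisMonomials V K).ext
    intro m
    rw [LinearMap.comp_apply, Tr0, Basis.constr_basis, coe_basisMonomials, lcoeff_apply, lcoeff_apply, coeff_monomial]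
    have h0 : ∀ b, (p - 1 + p * b) % p = p - 1 ∧ (p - 1 + p * b) / p = b := fun b => by
      rw [Nat.add_mul_mod_self_left, mod_eq_of_lt (by omega), Nat.add_mul_div_left _ _ hp, Nat.div_eq_of_lt (by omega)]; simp
    by_cases h : m = cPP p + p • β
    · rw [if_pos h, if_pos (by intro v; rw [h]; exact (h0 _).1), coeff_monomial, if_pos]
      ext v; rw [h]; exact (h0 _).2
    · rw [if_neg h]
      split_ifs with h1
      · rw [coeff_monomial, if_neg]
        rintro rfl
        apply h; ext v
        have := Nat.mod_add_div (m v) p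
        rw [h1 v] at this; exact this.symm
      · simp
  exact LinearMap.congr_fun this f
theorem Tr0_expand (hp : 0 < p) (a y : MvPolynomial V K) : Tr0 p (expand p a * y) = a * Tr0 p y := by
  induction a using MvPolynomial.induction_on' with
  | add a b h h' => simp [add_mul, h, h']
  | monomial q c =>
    ext β
    rw [Tr0_coeff hp, expand_monomial, coeff_monomial_mul', coeff_monomial_mul']
    have h : p • q ≤ cPP p + p • β ↔ q ≤ β := by
      refine forall_congr' fun v => ?_
      change p * q v ≤ p - 1 + p * β v ↔ q v ≤ β v
      constructor
      · intro h; by_contra hc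
        have : p * (β v + 1) ≤ p * q v := Nat.mul_le_mul_left _ (by omega)
        rw [mul_add] at this; omega
      · intro h; have := Nat.mul_le_mul_left p h; omega
    rw [if_congr h rfl rfl]
    split_ifs with h1
    · rw [Tr0_coeff hp]; congr 2
      obtain ⟨c, rfl⟩ := exists_add_of_le h1
      rw [add_tsub_cancel_left, smul_add, add_left_comm, add_tsub_cancel_left]
    · rfl
theorem Tr0_equiv (hp : 0 < p) (U U' : MvPolynomial V K →ₐ[K] MvPolynomial V K) (w : V → ℤ)
    (hd : ∀ v, U (X v) ∈ wF K (fun _ => -1) (-1)) (hw : ∀ v, U (X v) - X v ∈ wF K w (w v + 1))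
    (hU : ∀ v, U (X v ^ p) = expand p (U' (X v))) (y : MvPolynomial V K) : Tr0 p (U y) = U' (Tr0 p y) := by
  classical
  have hU2 : ∀ a, U (expand p a) = expand p (U' a) := by
    intro a
    change (U.comp (expand p)) a = ((expand p).comp U') a
    congr 1
    ext1 v; simp [hU, ← map_pow]
  have hdeg : ∀ (r : V →₀ ℕ) (β : V →₀ ℕ), coeff β (U (monomial r 1)) ≠ 0 → ∑ v, β v ≤ ∑ v, r v := by
    intro r β h
    have h1 : U (monomial r 1) ∈ wF K (fun _ => -1) (∑ v, (r v : ℤ) * (-1)) := by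
      rw [monomial_eq, C_1, one_mul, prod_fintype _ _ (by simp), map_prod]
      exact (wF_filt _).prod _ _ _ fun v _ => by rw [map_pow]; exact (wF_filt _).pow (hd v) _
    have h2 := h1 β (mem_support_iff.2 h)
    rw [mw, sum_fintype _ _ (by simp)] at h2
    simp only [mul_neg, mul_one, sum_neg_distrib] at h2
    exact_mod_cast (neg_le_neg_iff.1 h2)
  have key : ∀ r : V →₀ ℕ, (∀ v, r v < p) → Tr0 p (U (monomial r 1)) = if r = cPP p then 1 else 0 := by
    intro r hr
    ext β
    rw [Tr0_coeff hp]
    by_cases hc : coeff (cPP p + p • β) (U (monomial r 1)) = 0 ∧ ¬ (r = cPP p ∧ β = 0)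
    · rw [hc.1]; split_ifs with h
      · rw [coeff_one, if_neg]; exact fun h' => hc.2 ⟨h, h'.symm⟩
      · simp
    have h2 : r = cPP p ∧ β = 0 := by
      by_contra hn
      have h1 := hdeg r _ (fun h => hc ⟨h, hn⟩)
      have h3 : ∀ v, r v ≤ (cPP p + p • β : V →₀ ℕ) v := fun v => by
        change r v ≤ p - 1 + p * β v; have := hr v; omega
      have h4 := (Finset.sum_eq_sum_iff_of_le fun v _ => h3 v).1 (le_antisymm (sum_le_sum fun v _ => h3 v) h1)
      have h5 : ∀ v, r v = p - 1 ∧ β v = 0 := fun v => by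
        have h6 : r v = p - 1 + p * β v := h4 v (mem_univ v)
        have := hr v
        have : p * β v = 0 := by omega
        rcases Nat.mul_eq_zero.1 this with h | h
        · omega
        · exact ⟨by rw [h6, h]; simp, h⟩
      exact hn ⟨Finsupp.ext fun v => (h5 v).1, Finsupp.ext fun v => (h5 v).2⟩
    obtain ⟨rfl, rfl⟩ := h2
    rw [if_pos rfl, smul_zero, add_zero, coeff_zero_one]
    have h1 : U (monomial (cPP p) 1) - monomial (cPP p) 1 ∈ wF K w (∑ v, ((cPP p : V →₀ ℕ) v : ℤ) * w v + 1) := by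
      rw [monomial_eq, C_1, one_mul, prod_fintype _ _ (by simp), map_prod]
      refine (wF_filt w).prod_cong _ _ _ _ (fun v _ => ?_) (fun v _ => ?_) <;> rw [map_pow]
      · refine (wF_filt w).pow ?_ _
        have := (wF K w (w v)).add_mem ((wF_filt w).anti _ _ (by omega) (hw v)) (wF_X w v)
        simpa using this
      · refine (wF_filt w).pow_cong ?_ (hw v) _
        have := (wF K w (w v)).add_mem ((wF_filt w).anti _ _ (by omega) (hw v)) (wF_X w v)
        simpa using this
    have h2 := wF_coeff h1 (m := cPP p) (by rw [mw, sum_fintype _ _ (by simp)]; omega)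
    rw [coeff_sub, coeff_monomial, if_pos rfl, sub_eq_zero] at h2
    exact h2
  have key0 : ∀ r : V →₀ ℕ, (∀ v, r v < p) → Tr0 p (monomial r (1 : K)) = if r = cPP p then 1 else 0 := by
    intro r hr
    ext β
    rw [Tr0_coeff hp, coeff_monomial]
    by_cases h : r = cPP p ∧ β = 0
    · obtain ⟨rfl, rfl⟩ := h; simp
    · rw [if_neg]
      · split_ifs with h'
        · rw [coeff_one, if_neg]; exact fun h2 => h ⟨h', h2.symm⟩
        · simp
      · intro h'; apply h
        have h5 : ∀ v, r v = p - 1 ∧ β v = 0 := fun v => by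
          have h6 : r v = p - 1 + p * β v := by rw [h']; rfl
          have := hr v
          have : p * β v = 0 := by omega
          rcases Nat.mul_eq_zero.1 this with h | h
          · omega
          · exact ⟨by rw [h6, h]; simp, h⟩
        exact ⟨Finsupp.ext fun v => (h5 v).1, Finsupp.ext fun v => (h5 v).2⟩
  induction y using MvPolynomial.induction_on' with
  | add a b h h' => simp [h, h']
  | monomial m c =>
    set q : V →₀ ℕ := equivFunOnFinite.symm fun v => m v / p
    set r : V →₀ ℕ := equivFunOnFinite.symm fun v => m v % p
    have hr : ∀ v, r v < p := fun v => Nat.mod_lt _ hp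
    have : monomial m c = expand p (monomial q c) * monomial r 1 := by
      rw [expand_monomial, monomial_mul, mul_one, ← (Finsupp.ext fun v => (Nat.div_add_mod (m v) p).symm : m = p • q + r)]
    rw [this, map_mul, hU2, Tr0_expand hp, Tr0_expand hp, map_mul, key r hr, key0 r hr]
    split_ifs <;> simp
end Trace
section Phi
variable {Q0 Q1 : Type} [Fintype Q0] [DecidableEq Q0] {ta ha : Q1 → Q0} {α : Q0 → ℕ} {K : Type} [Field K]
theorem YY_mem (e : Q1) (P Q : II α) (W : VV → ℤ) (b : ℤ) (h : ∀ r c, P = ⟨ha e, r⟩ → Q = ⟨ta e, c⟩ → b ≤ W ⟨e, (r, c)⟩) :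
    YY e gX1 P Q ∈ wF K W b := by
  by_cases h1 : P.1 = ha e
  · by_cases h2 : Q.1 = ta e
    · obtain ⟨P1, r⟩ := P; obtain ⟨Q1', c⟩ := Q
      simp only at h1 h2
      subst h1 h2
      rw [YY_apply]
      exact (wF_filt W).anti _ _ (h r c rfl rfl) (wF_X _ _)
    · rw [YY_ne _ _ _ _ (Or.inr h2)]; exact zero_mem _
  · rw [YY_ne _ _ _ _ (Or.inl h1)]; exact zero_mem _
theorem tva_entry (i : Q0) (l0 l1 : Fai) (z : K) (v : VV) :
    tva i l0 l1 (C z) gX1 v = X v + (if (⟨ta v.1, v.2.2⟩ : II α) = ⟨i, l1⟩ then C z * YY v.1 gX ⟨ha v.1, v.2.1⟩ ⟨i, l0⟩ else 0)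
     + (if (⟨ha v.1, v.2.1⟩ : II α) = ⟨i, l0⟩ then C (-z) * (YY v.1 gX ⟨i, l1⟩ ⟨ta v.1, v.2.2⟩ +
        if (⟨ta v.1, v.2.2⟩ : II α) = ⟨i, l1⟩ then C z * YY v.1 gX ⟨i, l1⟩ ⟨i, l0⟩ else 0) else 0) := by
  rw [show tva i l0 l1 (C z) gX1 v = YY v.1 (tva i l0 l1 (C z) gX1) ⟨ha v.1, v.2.1⟩ ⟨ta v.1, v.2.2⟩ from (YY_apply _ _ _ _).symm,
    tva, YY_cact, bd_tvm, bd_tvm, Matrix.mul_assoc, ← colop_eq, ← rowop_eq]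
  simp only [rowop, colop, transpose_apply, of_apply, YY_apply, map_neg]
theorem tva_deg (i : Q0) (l0 l1 : Fai) (z : K) (v : VV) :
    tva i l0 l1 (C z) gX1 v ∈ wF K (fun _ => -1) (-1) := by
  have hY : ∀ P Q, YY v.1 gX1 P Q ∈ wF K (fun _ : VV => -1) (-1) := fun P Q => YY_mem _ _ _ _ _ fun _ _ _ _ => le_rfl
  have hC : ∀ (z : K) y, y ∈ wF K (fun _ : VV => -1) (-1) → C z * y ∈ wF K (fun _ : VV => -1) (-1) := fun z y hy => by
    have := (wF_filt _).mul _ _ _ _ (wF_C _ z) hy; rwa [zero_add] at this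
  rw [tva_entry]
  refine add_mem (add_mem (wF_X _ _) ?_) ?_
  · split_ifs
    exacts [hC _ _ (hY _ _), zero_mem _]
  · split_ifs
    exacts [hC _ _ (add_mem (hY _ _) (hC _ _ (hY _ _))), by rw [add_zero]; exact hC _ _ (hY _ _), zero_mem _]
theorem tva_tri (i : Q0) (l0 l1 : Fai) (hl : l0 ≠ l1) (z : K) (v : VV) (u : II α → ℤ) (hu : u = fun P => if P = ⟨i, l0⟩ then 1 else 0) :
    tva i l0 l1 (C z) gX1 v - X v ∈ wF K (fun v => u v22 - u v21) (u v22 - u v21 + 1) := by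
  have hY : ∀ P Q, YY v.1 gX1 P Q ∈ wF K (fun v : VV => u v22 - u v21) (u Q - u P) :=
    fun P Q => YY_mem _ _ _ _ _ fun _ _ h1 h2 => by rw [h1, h2]
  have hC : ∀ (z : K) (b c) y, c ≤ b → y ∈ wF K (fun v : VV => u v22 - u v21) b →
      C z * y ∈ wF K (fun v : VV => u v22 - u v21) c := fun z b c y hb hy => by
    have := (wF_filt _).mul _ _ _ _ (wF_C _ z) hy; rw [zero_add] at this; exact (wF_filt _).anti _ _ hb this
  have u0 : u ⟨i, l0⟩ = 1 := by simp [hu]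
  have u1 : u ⟨i, l1⟩ = 0 := by simp [hu, hl.symm]
  rw [tva_entry, add_assoc, add_sub_cancel_left]
  refine add_mem ?_ ?_
  · split_ifs with h
    · exact hC _ _ _ _ (by rw [h, u0, u1]; omega) (hY _ _)
    · exact zero_mem _
  · split_ifs with h h'
    · rw [mul_add]
      refine add_mem (hC _ _ _ _ (by rw [h, h', u0, u1]; omega) (hY _ _)) (hC _ _ _ _ le_rfl (hC _ _ _ _ (by rw [h, h', u0, u1]; omega) (hY _ _)))
    · rw [add_zero]; exact hC _ _ _ _ (by rw [h, u0, u1]; omega) (hY _ _)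
    · exact zero_mem _
theorem wtm_mw (m : VV →₀ ℕ) (i : Q0) (k : Fai) (u : II α → ℤ) (hu : u = fun P => if P = ⟨i, k⟩ then 1 else 0) :
    wtm m i k = mw (fun v : VV => u v22 - u v21) m := by
  subst hu; rfl
theorem poly_pow {p : ℕ} (hp : 1 < p) [Infinite K] [CharP K p] [Fact p.Prime] (G D : Polynomial K) (hD : D.natDegree < p) (h : ∀ z, G.eval (z ^ p) = D.eval z) (z : K) :
    G.eval z = G.eval 0 := by
  have h1 : Polynomial.expand K p G = D := by
    apply Polynomial.funext; intro z; rw [Polynomial.expand_eval, h]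
  have h2 : G.natDegree = 0 := by
    by_contra hc
    rw [← h1, Polynomial.natDegree_expand] at hD
    have := Nat.mul_le_mul_right p (Nat.one_le_iff_ne_zero.2 hc)
    omega
  rw [eq_C_of_natDegree_eq_zero h2]; simp
variable [Fintype Q1]
theorem split_exists (p : ℕ) [Fact p.Prime] [CharP K p] [PerfectRing K p] [Infinite K] (hl : NLp) (ht : Q0 → ℤ)
    (hh : ∀ e, ht (ta e) < ht (ha e)) : ∃ φ : PK →+ PK,
    (∀ f y, φ (f ^ p * y) = f * φ y) ∧ φ 1 = 1 ∧ ∀ (χ : Q0 → ℤ) y, IsL (fun i => p * χ i) y → IsL χ (φ y) := by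
  classical
  have hp : 0 < p := (Fact.out : p.Prime).pos
  set s1 := PP hl gX1 univ.toList (pls (α := α)) pls with hs1
  set fr := (frobeniusEquiv K p).symm.toRingHom with hfr
  have hfp : ∀ z : K, fr (z ^ p) = z := fun z => frobeniusEquiv_symm_pow K p z
  have hpf : ∀ z : K, fr z ^ p = z := fun z => frobeniusEquiv_symm_pow_p K p z
  have hcP : ∑ e, mE ta ha α e = equivFunOnFinite.symm (fun _ => 1) := by
    simp only [mE]
    rw [← Fintype.sum_sigma']
    ext v; simp [Finsupp.finsetSum_apply, Finsupp.single_apply]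
  have hcP' : (p - 1) • ∑ e, mE ta ha α e = cPP p := by
    rw [hcP]; ext v; simp [cPP]
  have hcoef := PP_coeff (K := K) (α := α) hl (p - 1)
  have hsup := fun w => PP_supp (K := K) (α := α) hl w (p - 1)
  rw [hcP'] at hcoef hsup
  rw [← hs1] at hcoef hsup
  have hsup' : ∀ (w : II α → ℤ) m, coeff m (s1 ^ (p - 1)) ≠ 0 → mw (fun v : VV => w v22 - w v21) m =
     mw (fun v : VV => w v22 - w v21) (cPP p) := by
    intro w m hm
    have h1 := hsup w m (mem_support_iff.2 hm)
    have h2 := hsup (-w) m (mem_support_iff.2 hm)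
    have h3 : (fun v : VV => (-w) v22 - (-w) v21) = - (fun v : VV => w v22 - w v21) := by
      ext v; simp; ring
    rw [h3, mw_neg, mw_neg] at h2
    omega
  have hz : ∀ w (β : VV →₀ ℕ), mw w (cPP p + p • β) = mw w (cPP p) + p * mw w β := fun w β => by rw [mw_add, mw_nsmul]
  let φ : PK →+ PK :=
    (map fr : PK →+* _).toAddMonoidHom.comp ((Tr0 p).toAddMonoidHom.comp (AddMonoidHom.mulLeft (s1 ^ (p - 1))))
  have hφ : ∀ y, φ y = map fr (Tr0 p (s1 ^ (p - 1) * y)) := fun y => rfl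
  refine ⟨φ, fun f y => ?_, ?_, fun χ y hy => ?_⟩
  · have h1 : f ^ p = expand p (map (frobenius K p) f) := by rw [← MvPolynomial.map_expand, map_frobenius_expand]
    rw [hφ, hφ, mul_left_comm, h1, Tr0_expand hp, map_mul, MvPolynomial.map_map]
    congr 1
    have : fr.comp (frobenius K p) = RingHom.id K := by ext z; exact hfp z
    rw [this, MvPolynomial.map_id]
  · have : Tr0 p (s1 ^ (p - 1)) = 1 := by
      ext β
      rw [Tr0_coeff hp]
      by_cases hβ : β = 0
      · subst hβ; simp [hcoef]
      · rw [coeff_one, if_neg (Ne.symm hβ)]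
        by_contra hc
        have := hsup' (fun P => - ht P.1) _ hc
        rw [hz] at this
        have h0 : mw (fun v : VV => - ht (ta v.1) - - ht (ha v.1)) β = 0 := by
          have : (p : ℤ) ≠ 0 := by omega
          simp_all
        rw [mw, Finsupp.sum, Finset.sum_eq_zero_iff_of_nonneg] at h0
        · obtain ⟨v, hv⟩ := Finsupp.support_nonempty_iff.2 hβ
          have := h0 v hv
          have h2 := hh v.1
          rw [mul_eq_zero] at this
          rcases this with h | h
          · exact Finsupp.mem_support_iff.1 hv (by exact_mod_cast h)
          · omega
        · intro v _
          have h2 := hh v.1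
          exact mul_nonneg (by positivity) (by omega)
    rw [hφ, mul_one, this, map_one]
  · refine isL_of_simple (fun m hm i k => ?_) (fun i l0 l1 h z v => ?_)
    · rw [mem_support_iff, hφ, coeff_map, Tr0_coeff hp] at hm
      have hm : coeff (cPP p + p • m) (s1 ^ (p - 1) * y) ≠ 0 := fun h => hm (by rw [h, map_zero])
      rw [coeff_mul] at hm
      obtain ⟨⟨a, b⟩, hab, hne⟩ := Finset.exists_ne_zero_of_sum_ne_zero hm
      rw [Finset.HasAntidiagonal.mem_antidiagonal] at hab
      have h1 := hsup' (fun P => if P = ⟨i, k⟩ then 1 else 0) _ (left_ne_zero_of_mul hne)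
      have h2 := hy.1 b (mem_support_iff.2 (right_ne_zero_of_mul hne)) i k
      have h3 := congrArg (mw (fun v : VV => (if (v22 : II α) = ⟨i, k⟩ then 1 else 0) - (if (v21 : II α) = ⟨i, k⟩ then 1 else 0))) hab
      rw [wtm_mw _ _ _ _ rfl] at h2 ⊢
      simp only at h3
      rw [mw_add, hz, h1, h2] at h3
      have : (p : ℤ) ≠ 0 := by omega
      exact (mul_left_cancel₀ this (by linarith)).symm
    · have hne : l0 ≠ l1 := fun h' => by subst h'; omega
      obtain ⟨a, b, hab⟩ := PP_lin (K := K) (α := α) hl univ.toList i l0 l1 h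
      have hT : ∀ ζ : K, aeval (tva i l0 l1 (C (ζ ^ p)) gX) (Tr0 p (s1 ^ (p - 1) * y)) = Tr0 p ((a + C ζ * b) ^ (p - 1) * y) := by
        intro ζ
        have h1 := Tr0_equiv hp (aeval (tva i l0 l1 (C ζ) (gX (ta := ta) (ha := ha)))) (aeval (tva i l0 l1 (C (ζ ^ p)) gX))
          _ (fun v => by rw [aeval_X]; exact tva_deg i l0 l1 ζ v) (fun v => by rw [aeval_X]; exact tva_tri i l0 l1 hne ζ v _ rfl) ?_ (s1 ^ (p - 1) * y)
        · rw [← h1, map_mul, map_pow, hab]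
          congr 2
          have := hy.tv i l0 l1 hne (C ζ) gX
          rw [this]; simp
        · intro v
          rw [map_pow, aeval_X, aeval_X]
          have h2 := congrFun (tva_map (frobenius PK p) i l0 l1 (C ζ) gX) v
          have h3 := congrFun (tva_map (expand p : PK →ₐ[K] _).toRingHom i l0 l1 (C (ζ ^ p)) gX) v
          simp only [frobenius_def, toRingHom_eq_coe, coe_coe, expand_C, expand_X] at h2 h3
          rw [h2, h3, C_pow]
      set t := Tr0 p (s1 ^ (p - 1) * y) with ht
      have hinv : ∀ (z' : K) (v' : VV → K), aeval (tva i l0 l1 z' v') t = aeval v' t := by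
        intro z' v'
        let G : Polynomial K := aeval (tva i l0 l1 Polynomial.X (fun p => Polynomial.C (v' p))) t
        have hG : ∀ z : K, G.eval z = aeval (tva i l0 l1 z v') t := fun z => by
          have := aeval_tva (Polynomial.aeval z) i l0 l1 Polynomial.X (fun p => Polynomial.C (v' p)) t
          simpa [Polynomial.coe_aeval_eq_eval] using this
        let D : Polynomial K := ∑ j ∈ Finset.range (p - 1 + 1), Polynomial.C (aeval v' (Tr0 p (b ^ j * a ^ (p - 1 - j) * ((p - 1).choose j : PK) * y))) * Polynomial.X ^ j
        rw [← hG, poly_pow (Fact.out : p.Prime).one_lt G D ?_ ?_, hG, tva_zero]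
        · refine lt_of_le_of_lt (natDegree_sum_le_of_forall_le _ _ (n := p - 1) fun j hj => ?_) (by omega)
          exact (Polynomial.natDegree_C_mul_X_pow_le _ _).trans (by have := mem_range.1 hj; omega)
        · intro ζ
          rw [hG]
          have h1 := aeval_tva (aeval v') i l0 l1 (C (ζ ^ p)) gX t
          simp only [aeval_C, aeval_X, Algebra.algebraMap_self, id_apply] at h1
          rw [← h1, hT, add_comm, add_pow, Finset.sum_mul, map_sum, map_sum, Polynomial.eval_finsetSum]
          refine sum_congr rfl fun j _ => ?_
          rw [mul_pow, ← C_pow, mul_assoc, mul_assoc, mul_assoc, C_mul', LinearMap.map_smul, _root_.map_smul]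
          rw [Polynomial.eval_mul, Polynomial.eval_C, Polynomial.eval_pow, Polynomial.eval_X, smul_eq_mul, mul_comm, mul_assoc, mul_assoc]
      have hpow : ∀ u : VV → K, (aeval u (map fr t)) ^ p = aeval (fun q => u q ^ p) t := by
        intro u
        change ((frobenius K p).comp ((aeval u).toRingHom.comp (map fr))) t = (aeval (fun q => u q ^ p)).toRingHom t
        congr 1
        apply ringHom_ext
        · intro r; simp [frobenius_def, hpf]
        · intro q; simp [frobenius_def]
      rw [hφ]
      apply frobenius_inj K p
      rw [frobenius_def, frobenius_def, hpow, hpow, ← hinv (z ^ p) (fun q => v q ^ p)]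
      congr 2
      have := tva_map (frobenius K p) i l0 l1 z v
      simpa only [frobenius_def] using this
end Phi
section Paths
variable {Q0 Q1 : Type} {ta ha : Q1 → Q0}
theorem path_cons {x y : Q0} {a : Q1} {l : List Q1} : IsQuiverPath ta ha x y (a :: l) ↔ ta a = x ∧ IsQuiverPath ta ha (ha a) y l := by
  cases l with
  | nil => simp [IsQuiverPath, Chain']
  | cons b l =>
    simp only [IsQuiverPath, Chain']
    rw [List.isChain_cons_cons, List.getLast_cons_cons]
    constructor
    · rintro ⟨h1, ⟨h2, h3⟩, h4⟩; exact ⟨h1, h2.symm, h3, h4⟩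
    · rintro ⟨h1, h2, h3, h4⟩; exact ⟨h1, ⟨h2.symm, h3⟩, h4⟩
theorem path_snoc {y : Q0} {a : Q1} (ha' : ta a = y) (l : List Q1) : ∀ {x : Q0}, IsQuiverPath ta ha x y l → IsQuiverPath ta ha x (ha a) (l ++ [a]) := by
  induction l with
  | nil => intro x h; cases h; exact path_cons.2 ⟨ha', rfl⟩
  | cons b l ih => intro x h; rw [path_cons] at h; exact path_cons.2 ⟨h.1, ih h.2⟩
theorem height_exists [Fintype Q0] (hQ : HasNoOrientedCycles ta ha) : ∃ h : Q0 → ℕ, HTp := by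
  classical
  let r : Q0 → Q0 → Prop := TransGen fun x y => ∃ a, ta a = x ∧ ha a = y
  have hr : ∀ x y, r x y → ∃ l, l ≠ [] ∧ IsQuiverPath ta ha x y l := by
    intro x y h
    induction h using TransGen.head_induction_on with
    | single h => obtain ⟨a, rfl, rfl⟩ := h; exact ⟨[a], by simp, path_cons.2 ⟨rfl, rfl⟩⟩
    | head h _ ih =>
      obtain ⟨a, rfl, rfl⟩ := h
      obtain ⟨l, -, hl⟩ := ih
      exact ⟨a :: l, by simp, path_cons.2 ⟨rfl, hl⟩⟩
  refine ⟨fun x => (univ.filter fun z => r z x).card, fun a => Finset.card_lt_card ?_⟩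
  have h1 : r (ta a) (ha a) := TransGen.single ⟨a, rfl, rfl⟩
  rw [Finset.ssubset_iff_of_subset]
  · refine ⟨ta a, by simpa using h1, ?_⟩
    simp only [mem_filter, mem_univ, true_and]
    intro h
    obtain ⟨l, h2, h3⟩ := hr _ _ h
    exact hQ _ l h2 h3
  · intro z hz
    simp only [mem_filter, mem_univ, true_and] at hz ⊢
    exact hz.trans h1
theorem path_finite [Fintype Q1] (h : Q0 → ℕ) (hh : HTp) (x y : Q0) : Finite {l // IsQuiverPath ta ha x y l} := by
  have key : ∀ (l : List Q1) x, IsQuiverPath ta ha x y l → l.length + h x ≤ h y := by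
    intro l
    induction l with
    | nil => intro x hx; cases hx; simp
    | cons a l ih =>
      intro x hx; rw [path_cons] at hx
      have := ih _ hx.2; have := hh a; rw [hx.1] at this; simp; omega
  exact Set.Finite.subset (List.finite_length_le Q1 (h y)) fun l hl => by
    have := key l x hl
    change l.length ≤ h y; omega
def PM {S : Type} [CommRing S] [Fintype Q0] [DecidableEq Q0] {α : Q0 → ℕ} (v : VV → S) : List Q1 → MII
  | [] => 1
  | a :: l => PM v l * YY a v
variable [Fintype Q0] [DecidableEq Q0] {α : Q0 → ℕ} {S : Type} [CommRing S]
theorem PM_snoc (v : VV → S) (l : List Q1) (a : Q1) : PM v (l ++ [a]) = YY a v * PM v l := by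
  induction l with
  | nil => simp [PM]
  | cons b l ih => rw [List.cons_append, PM, ih, PM, Matrix.mul_assoc]
theorem YY_map {S' : Type} [CommRing S'] (φ : S →+* S') (e : Q1) (v : VV → S) :
    (YY e v).map φ = YY e (fun p => φ (v p)) := by
  have := MM_map φ e v
  rw [MM, MM, Matrix.map_add _ (map_add φ), Matrix.map_one _ (map_zero φ) (map_one φ)] at this
  exact add_left_cancel this
theorem PM_map {S' : Type} [CommRing S'] (φ : S →+* S') (v : VV → S) (l : List Q1) :
    (PM v l).map φ = PM (fun p => φ (v p)) l := by
  induction l with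
  | nil => exact Matrix.map_one _ (map_zero φ) (map_one φ)
  | cons b l ih => rw [PM, PM, Matrix.map_mul, ih, YY_map]
theorem PM_cact (B A : Mt α S) (h : ∀ i, A i * B i = 1) (v : VV → S) (l : List Q1) :
    PM (cact B A v) l = blockDiagonal' B * PM v l * blockDiagonal' A := by
  have h1 : blockDiagonal' A * blockDiagonal' B = (1 : MII) := by
    rw [← blockDiagonal'_mul, ← blockDiagonal'_one]; congr 1; funext i; exact h i
  have h2 := mul_eq_one_comm.1 h1
  induction l with
  | nil => rw [PM, PM, Matrix.mul_one, h2]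
  | cons b l ih =>
    rw [PM, PM, ih, YY_cact]
    calc _ = blockDiagonal' B * PM v l * (blockDiagonal' A * blockDiagonal' B) * YY b v * blockDiagonal' A := by simp only [Matrix.mul_assoc]
      _ = _ := by rw [h1, Matrix.mul_one]; simp only [Matrix.mul_assoc]
end Paths
section XXs
variable {Q0 Q1 : Type} (ta ha : Q1 → Q0) (α : Q0 → ℕ) (σ : Q0 → ℤ)
abbrev Tp := Σ x : Q0, Fin (σ x).toNat
abbrev Cc := Σ t : Tp σ, Fin (α t.1)
abbrev Kp := Σ (s : Tp σ) (t : Tp (-σ)), {l // IsQuiverPath ta ha s.1 t.1 l}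
variable {ta ha α σ} [Fintype Q0] [DecidableEq Q0] {S : Type} [CommRing S]
def XX (v : VV → S) (k : Kp ta ha σ) : Matrix (Cc α (-σ)) (Cc α σ) S :=
  of fun r c => if r.1 = k.2.1 ∧ c.1 = k.1 then PM v k.2.2.1 ⟨r.1.1, r.2⟩ ⟨c.1.1, c.2⟩ else 0
section
variable (ta ha α σ U v k : ℕ)
set_option hygiene false
notation "sUX" => (⨆ e : Kp ta ha σ, U.map (XX v e).mulVecLin : Submodule k (Cc α (-σ) → k))
end
theorem XX_map {S' : Type} [CommRing S'] (φ : S →+* S') (v : VV → S) (k : Kp ta ha σ) :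
    (XX v k).map φ = XX (fun p => φ (v p)) k := by
  ext r c
  simp only [XX, map_apply, of_apply, apply_ite φ, map_zero]
  rw [← PM_map]; rfl
theorem XX_cact (B A : Mt α S) (h : ∀ i, A i * B i = 1) (v : VV → S) (k : Kp ta ha σ) :
    XX (cact B A v) k = blockDiagonal' (fun t : Tp (-σ) => B t.1) * XX v k * blockDiagonal' (fun t : Tp σ => A t.1) := by
  ext ⟨t, r⟩ ⟨s, c⟩
  have h1 : (blockDiagonal' (fun t : Tp (-σ) => B t.1) * XX v k * blockDiagonal' (fun t : Tp σ => A t.1)) ⟨t, r⟩ ⟨s, c⟩ =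
     ∑ c', ∑ r', B t.1 r r' * XX v k ⟨t, r'⟩ ⟨s, c'⟩ * A s.1 c' c := by
    rw [Matrix.mul_apply, sum_sigma, sum_eq_single s]
    · refine sum_congr rfl fun c' _ => ?_
      rw [blockDiagonal'_apply_eq, Matrix.mul_apply, Finset.sum_mul, sum_sigma, sum_eq_single t]
      · simp
      · intro b _ hb; simp [blockDiagonal'_apply_ne _ _ _ hb.symm]
      · simp
    · intro b _ hb; simp [blockDiagonal'_apply_ne _ _ _ hb]
    · simp
  have h2 : ∀ (l : List Q1), (blockDiagonal' B * PM v l * blockDiagonal' A) ⟨t.1, r⟩ ⟨s.1, c⟩ =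
     ∑ c', ∑ r', B t.1 r r' * PM v l ⟨t.1, r'⟩ ⟨s.1, c'⟩ * A s.1 c' c := by
    intro l
    rw [Matrix.mul_apply, sum_sigma, sum_eq_single s.1]
    · refine sum_congr rfl fun c' _ => ?_
      rw [blockDiagonal'_apply_eq, Matrix.mul_apply, Finset.sum_mul, sum_sigma, sum_eq_single t.1]
      · simp
      · intro b _ hb; simp [blockDiagonal'_apply_ne _ _ _ hb.symm]
      · simp
    · intro b _ hb; simp [blockDiagonal'_apply_ne _ _ _ hb]
    · simp
  rw [h1]
  simp only [XX, of_apply]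
  split_ifs with h3
  · rw [PM_cact _ _ h, h2]
  · simp
end XXs
section GGs
variable {κ R C I : Type} [Fintype κ] [Fintype R] [Fintype C] [Fintype I] [DecidableEq I] [DecidableEq R] [DecidableEq C]
theorem bl_mul {k L : Type} [CommRing k] [CommRing L] (ι : k →+* L) (A : Matrix R R k) (B : Matrix C C k)
    (X : κ → Matrix R C k) (T : κ → Matrix I I L) :
    bl ι (fun e => A * X e * B) T = kroneckerMap (· * ·) (A.map ι) (1 : Matrix I I L) * bl ι X T * kroneckerMap (· * ·) (B.map ι) (1 : Matrix I I L) := by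
  ext ⟨p, i⟩ ⟨q, j⟩
  simp only [bl, Matrix.mul_apply, of_apply, kroneckerMap_apply, sum_prod_type, Matrix.map_apply, Matrix.one_apply,
    mul_ite, ite_mul, mul_one, mul_zero, zero_mul, sum_ite_eq, sum_ite_eq', mem_univ, if_true, map_sum, map_mul,
    Finset.sum_mul, Finset.mul_sum]
  rw [sum_comm]
  refine sum_congr rfl fun c _ => ?_
  rw [sum_comm]
  refine sum_congr rfl fun r _ => ?_
  rw [sum_comm]
  simp only [sum_ite_eq, mem_univ, if_true]
  exact sum_congr rfl fun e _ => by ring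
noncomputable def GG {S : Type} [CommRing S] (e : R ≃ C) (I : Type) [Fintype I] [DecidableEq I] (X : κ → Matrix R C S) : MvPolynomial (κ × I × I) S :=
  ((bl MvPolynomial.C X (fun c => of fun i j => MvPolynomial.X (c, i, j))).submatrix (e.symm.prodCongr (Equiv.refl I)) (Equiv.refl (C × I))).det
theorem GG_map {S S' : Type} [CommRing S] [CommRing S'] (φ : S →+* S') (e : R ≃ C) (X : κ → Matrix R C S) :
    MvPolynomial.map φ (GG e I X) = GG e I (fun k => (X k).map φ) := by
  rw [GG, GG, map_det]
  congr 1
  ext1 p q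
  simp [bl]
theorem GG_mul {S : Type} [CommRing S] (e : R ≃ C) (A : Matrix R R S) (B : Matrix C C S) (X : κ → Matrix R C S) :
    GG e I (fun k => A * X k * B) = MvPolynomial.C ((A.det * B.det) ^ Fintype.card I) * GG e I X := by
  have hk : ∀ {n : Type} [Fintype n] [DecidableEq n] (M : Matrix n n S), (kroneckerMap (· * ·) (M.map MvPolynomial.C) (1 : Matrix I I (MvPolynomial (κ × I × I) S))).det = MvPolynomial.C (M.det ^ Fintype.card I) := by
    intro n _ _ M
    have := Matrix.det_kronecker (M.map (MvPolynomial.C (σ := κ × I × I))) (1 : Matrix I I (MvPolynomial (κ × I × I) S))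
    rw [det_one, one_pow, mul_one, ← mapMatrix_apply, ← map_det, ← map_pow] at this
    exact this
  rw [GG, bl_mul, ← submatrix_mul_equiv _ _ _ (Equiv.refl (C × I)), ← submatrix_mul_equiv _ _ _ (e.symm.prodCongr (Equiv.refl I)),
    det_mul, det_mul, det_submatrix_equiv_self, det_submatrix_equiv_self, hk, hk, mul_pow, map_mul, GG]
  ring
theorem GG_adjoin {K S : Type} [CommRing K] [CommRing S] [Algebra K S] (e : R ≃ C) (X : κ → Matrix R C S) (μ) :
    coeff μ (GG e I X) ∈ adjoin K (Set.range fun t : κ × R × C => X t.1 t.2.1 t.2.2) := by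
  set A := adjoin K (Set.range fun t : κ × R × C => X t.1 t.2.1 t.2.2)
  let X' : κ → Matrix R C A := fun k => of fun r c => ⟨X k r c, subset_adjoin ⟨(k, r, c), rfl⟩⟩
  have h := GG_map (I := I) (A.val.toRingHom) e X'
  have h2 : (fun k => (X' k).map A.val.toRingHom) = X := rfl
  rw [h2] at h
  rw [← h, coeff_map]
  exact (coeff μ (GG e I X')).2
theorem GG_ne {k : Type} [Field k] [Infinite k] (e : R ≃ C) (X : κ → Matrix R C k) (hC : 0 < Fintype.card C)
    (hs : ∀ U : Submodule k (C → k), finrank k U ≤ finrank k (⨆ e, U.map (X e).mulVecLin : Submodule k (R → k))) :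
    GG e (Fin (Fintype.card C)) X ≠ 0 := by
  obtain ⟨T, hT⟩ := nc_rank X (card_congr e) hC hs
  intro h0
  have h := congrArg (eval₂Hom (RingHom.id k) (fun v : κ × _ × _ => T v.1 v.2.1 v.2.2)) h0
  rw [map_zero, GG, map_det] at h
  have h1 : (eval₂Hom (RingHom.id k) (fun v : κ × _ × _ => T v.1 v.2.1 v.2.2)).mapMatrix
     ((bl MvPolynomial.C X (fun c => of fun i j => MvPolynomial.X (c, i, j))).submatrix (e.symm.prodCongr (Equiv.refl (Fin (Fintype.card C)))) (Equiv.refl (C × Fin (Fintype.card C))))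
     = (bk X T).submatrix (e.symm.prodCongr (Equiv.refl (Fin (Fintype.card C)))) (Equiv.refl _) := by
    ext p q; simp [bl]
  rw [h1] at h
  obtain ⟨w, hw, hw2⟩ := exists_mulVec_eq_zero_iff.2 h
  apply hw
  have : w ∈ LinearMap.ker (bk X T).mulVecLin := by
    rw [mem_ker, mulVecLin_apply]
    funext p
    have := congrFun hw2 ((e.prodCongr (Equiv.refl _)) p)
    rw [Pi.zero_apply] at this ⊢
    rw [← this, mulVec, mulVec, submatrix]; simp [Prod.map]
  rw [hT] at this
  exact this
end GGs
section SS
variable {Q0 Q1 : Type} {ta ha : Q1 → Q0} {α : Q0 → ℕ} {σ : Q0 → ℤ} [Fintype Q0] [DecidableEq Q0]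
theorem det_blockDiagonal' {o : Type} [Fintype o] [DecidableEq o] {m : o → ℕ} {S : Type} [CommRing S] (d : (i : o) → Matrix (Fin (m i)) (Fin (m i)) S) :
    (blockDiagonal' d).det = ∏ i, (d i).det := by
  let e := equivFin o
  let _ : LinearOrder o := LinearOrder.lift' e e.injective
  have h := (blockTriangular_blockDiagonal' (R := S) d).det_fintype
  rw [show (blockDiagonal' d).det = _ by convert h]
  refine prod_congr rfl fun k _ => ?_
  let E : Fin (m k) ≃ {p : Σ i, Fin (m i) // p.1 = k} := ⟨fun j => ⟨⟨k, j⟩, rfl⟩, fun p => p.2 ▸ p.1.2, fun j => rfl, by rintro ⟨⟨_, _⟩, rfl⟩; rfl⟩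
  rw [← det_submatrix_equiv_self E]
  congr 1
  ext i j
  simp only [submatrix_apply, toSquareBlock_def, of_apply, E, Equiv.coe_fn_mk]
  convert blockDiagonal'_apply_eq d k i j
def bm {S : Type} (v : VV → S) (a : Q1) : Matrix (Fin (α (ha a))) (Fin (α (ta a))) S := of fun r c => v ⟨a, (r, c)⟩
def PB {S : Type} [CommRing S] (v : VV → S) (l : List Q1) (x y : Q0) : Matrix (Fin (α y)) (Fin (α x)) S :=
  of fun r c => PM v l ⟨y, r⟩ ⟨x, c⟩
theorem PB_snoc {S : Type} [CommRing S] (v : VV → S) (l : List Q1) (x : Q0) (a : Q1) :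
    PB v (l ++ [a]) x (ha a) = bm v a * PB v l x (ta a) := by
  ext r c
  rw [PB, of_apply, PM_snoc, Matrix.mul_apply, Matrix.mul_apply, sum_sigma, sum_eq_single (ta a)]
  · exact sum_congr rfl fun j _ => by rw [YY_apply]; rfl
  · intro b _ hb
    exact sum_eq_zero fun j _ => by rw [YY_ne _ _ _ _ (Or.inr hb), zero_mul]
  · simp
theorem PB_nil {S : Type} [CommRing S] (v : VV → S) (x : Q0) : PB v [] x x = 1 := by
  ext r c; simp [PB, PM, Matrix.one_apply]
def Sst {k : Type} [Field k] (σ : Q0 → ℤ) (v : VV → k) : Prop :=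
  ∀ W : (x : Q0) → Submodule k (Fin (α x) → k), (∀ a, (W (ta a)).map (bm v a).mulVecLin ≤ W (ha a)) →
    ∑ x, σ x * (finrank k (W x) : ℤ) ≤ 0
theorem tp_sum (f : Q0 → ℕ) : ∑ t : Tp σ, f t.1 = ∑ x, (σ x).toNat * f x := by
  rw [sum_sigma]; simp
theorem rank_cond {k : Type} [Field k] [Fintype (Kp ta ha σ)] (v : VV → k) (hv : Sst σ v) (U : Submodule k (Cc α σ → k)) :
    finrank k U ≤ finrank k sUX := by
  let sl : (s : Tp σ) → (Cc α σ → k) →ₗ[k] (Fin (α s.1) → k) := fun s => funLeft k k (fun i => (⟨s, i⟩ : Cc α σ))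
  let W : (x : Q0) → Submodule k (Fin (α x) → k) := fun z => ⨆ s : Tp σ, ⨆ l : {l // IsQuiverPath ta ha s.1 z l},
    U.map ((PB v l.1 s.1 z).mulVecLin ∘ₗ sl s)
  have hW := hv W (by
    intro a
    simp only [W, Submodule.map_iSup]
    refine iSup_le fun s => iSup_le fun l => ?_
    refine le_trans ?_ (le_iSup_of_le s (le_iSup_of_le ⟨l.1 ++ [a], path_snoc rfl l.1 l.2⟩ le_rfl))
    rw [← map_comp]
    apply le_of_eq; congr 1
    rw [PB_snoc, Matrix.mulVecLin_mul, LinearMap.comp_assoc])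
  have h1 : finrank k U ≤ ∑ x, (σ x).toNat * finrank k (W x) := by
    rw [← tp_sum, ← finrank_pi_fintype]
    have hm : ∀ (u : U) (s : Tp σ), sl s u.1 ∈ W s.1 := fun u s =>
      (le_iSup_of_le (f := fun s : Tp σ => ⨆ l : {l // IsQuiverPath ta ha s.1 _ l}, U.map ((PB v l.1 s.1 _).mulVecLin ∘ₗ sl s)) s
        (le_iSup_of_le (f := fun l : {l // IsQuiverPath ta ha s.1 s.1 l} => U.map ((PB v l.1 s.1 s.1).mulVecLin ∘ₗ sl s)) ⟨[], rfl⟩ le_rfl)) ⟨u.1, u.2, by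
          simp [PB_nil]⟩
    let f : U →ₗ[k] ((s : Tp σ) → W s.1) := LinearMap.pi fun s => codRestrict _ (sl s ∘ₗ U.subtype) (fun u => hm u s)
    refine finrank_le_finrank_of_injective (f := f) fun u w h => Subtype.ext (funext fun ⟨s, i⟩ => ?_)
    exact congrFun (congrArg Subtype.val (congrFun h s)) i
  have h2 : ∑ x, (-σ x).toNat * finrank k (W x) ≤ finrank k sUX := by
    rw [show ∑ x, (-σ x).toNat * finrank k (W x) = ∑ t : Tp (-σ), finrank k (W t.1) from (tp_sum (σ := -σ) fun x => finrank k (W x)).symm, ← finrank_pi_fintype]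
    let ι : (t : Tp (-σ)) → (Fin (α t.1) → k) →ₗ[k] (Cc α (-σ) → k) := fun t =>
      (of fun (r : Cc α (-σ)) (j : Fin (α t.1)) => if r = ⟨t, j⟩ then (1 : k) else 0).mulVecLin
    have hι : ∀ t w r, ι t w r = if h : r.1 = t then w (h ▸ r.2) else 0 := by
      rintro t w ⟨s, i⟩
      simp only [ι, mulVecLin_apply, mulVec, dotProduct, of_apply]
      split_ifs with h
      · cases h; simp
      · exact sum_eq_zero fun j _ => by rw [if_neg, zero_mul]; intro h'; exact h (congrArg Sigma.fst h')
    let g : ((t : Tp (-σ)) → W t.1) →ₗ[k] (Cc α (-σ) → k) := ∑ t, ι t ∘ₗ (W t.1).subtype ∘ₗ LinearMap.proj t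
    have hg : ∀ w r, g w r = (w r.1).1 r.2 := by
      intro w r
      simp only [g, LinearMap.sum_apply, Finset.sum_apply, LinearMap.comp_apply, hι]
      rw [sum_eq_single r.1]
      · simp
      · intro b _ hb; rw [dif_neg hb.symm]
      · simp
    have hr : ∀ w, g w ∈ sUX := by
      intro w
      simp only [g, LinearMap.sum_apply, LinearMap.comp_apply]
      refine Submodule.sum_mem _ fun t _ => ?_
      have : (W t.1).map (ι t) ≤ sUX := by
        simp only [W, Submodule.map_iSup]
        refine iSup_le fun s => iSup_le fun l => ?_
        refine le_trans ?_ (le_iSup_of_le (⟨s, t, l⟩ : Kp ta ha σ) le_rfl)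
        rw [← map_comp]
        apply le_of_eq; congr 1
        refine LinearMap.ext fun u => funext fun r => ?_
        rw [LinearMap.comp_apply, hι]
        change _ = ∑ c, XX v ⟨s, t, l⟩ r c * u c
        rw [sum_sigma, sum_eq_single s]
        · obtain ⟨t', r⟩ := r
          simp only [XX, of_apply]
          by_cases h : t' = t
          · cases h; simp only [true_and, if_true]; rfl
          · rw [dif_neg h]; exact (sum_eq_zero fun j _ => by rw [if_neg (fun h' => h h'.1), zero_mul]).symm
        · intro b _ hb
          exact sum_eq_zero fun j _ => by rw [XX, of_apply, if_neg (fun h' => hb h'.2), zero_mul]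
        · simp
      exact this ⟨_, (w t).2, rfl⟩
    refine finrank_le_finrank_of_injective (f := codRestrict _ g hr) fun u w h => funext fun t => Subtype.ext (funext fun i => ?_)
    have := congrFun (congrArg Subtype.val h) ⟨t, i⟩
    change g u _ = g w _ at this
    rwa [hg, hg] at this
  refine h1.trans (le_trans ?_ h2)
  have h3 : ∀ x, (σ x) = ((σ x).toNat : ℤ) - ((-σ x).toNat : ℤ) := fun x => by omega
  zify
  rw [← sub_nonpos, ← sum_sub_distrib]
  refine le_of_eq_of_le (sum_congr rfl fun x _ => ?_) hW
  linear_combination (-(finrank k (W x) : ℤ)) * h3 x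
noncomputable def cc (K : Type) [Field K] [Fintype (Kp ta ha σ)] (e : Cc α (-σ) ≃ Cc α σ) (μ : Kp ta ha σ × Fin (Fintype.card (Cc α σ)) × Fin (Fintype.card (Cc α σ)) →₀ ℕ) :
    PK := coeff μ (GG e (Fin (Fintype.card (Cc α σ))) (XX (MvPolynomial.X)))
theorem cc_aeval {K F : Type} [Field K] [CommRing F] [Algebra K F] [Fintype (Kp ta ha σ)] (e : Cc α (-σ) ≃ Cc α σ) (μ) (v : VV → F) :
    aeval v (cc K e μ) = coeff μ (GG e (Fin (Fintype.card (Cc α σ))) (XX v)) := by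
  have h := GG_map (I := Fin (Fintype.card (Cc α σ))) (aeval v : PK →ₐ[K] F).toRingHom e (XX (MvPolynomial.X))
  rw [show (fun k => (XX MvPolynomial.X k).map (aeval v : PK →ₐ[K] F).toRingHom) = XX v from funext fun k => by rw [XX_map]; congr 1; funext p; simp] at h
  rw [← h, coeff_map]; rfl
theorem cc_isL {K : Type} [Field K] [Infinite K] [Fintype (Kp ta ha σ)] (e : Cc α (-σ) ≃ Cc α σ) (μ) :
    IsL (fun i => (Fintype.card (Cc α σ) : ℤ) * σ i) (cc (ta := ta) (ha := ha) K e μ) := by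
  refine isL_of_gl fun A v => ?_
  rw [cc_aeval, cc_aeval]
  have h : XX (gact A v) = fun k : Kp ta ha σ => blockDiagonal' (fun t : Tp (-σ) => ((A t.1)⁻¹).val) * XX v k * blockDiagonal' (fun t : Tp σ => (A t.1).val) :=
    funext fun k => XX_cact _ _ (fun i => by simp) v k
  rw [h, GG_mul, coeff_C_mul, det_blockDiagonal', det_blockDiagonal', card_fin]
  congr 1
  rw [prod_sigma, prod_sigma]
  rw [← prod_mul_distrib, ← prod_pow, chr]
  refine prod_congr rfl fun x _ => ?_
  have hd : (A x).val.det ≠ 0 := by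
    have := (Matrix.isUnit_iff_isUnit_det _).1 (A x).isUnit
    exact this.ne_zero
  have h2 : ((A x)⁻¹).val.det = ((A x).val.det)⁻¹ := by
    rw [Matrix.coe_units_inv, Matrix.det_nonsing_inv, Ring.inverse_eq_inv']
  have h3 : (σ x) = ((σ x).toNat : ℤ) - (((-σ) x).toNat : ℤ) := by simp only [Pi.neg_apply]; omega
  change ((∏ y : Fin ((-σ) x).toNat, ((A x)⁻¹).val.det) * ∏ y : Fin (σ x).toNat, (A x).val.det) ^ _ = _
  rw [prod_const, prod_const, card_univ, card_univ, card_fin, card_fin]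
  generalize (σ x).toNat = a at h3 ⊢
  generalize ((-σ) x).toNat = b at h3 ⊢
  rw [show ((A x)⁻¹).val.det = ((A x).val.det)⁻¹ from h2, mul_comm (_ : ℤ), _root_.zpow_mul, zpow_natCast, h3, _root_.zpow_sub₀ hd, zpow_natCast, zpow_natCast, inv_pow, div_eq_mul_inv, mul_comm]
theorem cc_ne {K F : Type} [Field K] [Field F] [Infinite F] [Algebra K F] [Fintype (Kp ta ha σ)] (e : Cc α (-σ) ≃ Cc α σ)
    (hC : 0 < Fintype.card (Cc α σ)) (v : VV → F) (hv : Sst σ v) : ∃ μ, aeval v (cc K e μ) ≠ 0 := by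
  have := GG_ne e (XX v) hC (rank_cond v hv)
  obtain ⟨μ, hμ⟩ := MvPolynomial.ne_zero_iff.1 this
  exact ⟨μ, by rwa [cc_aeval]⟩
theorem card_Cc : Fintype.card (Cc α σ) = ∑ x, (σ x).toNat * α x := by
  rw [Fintype.card_sigma, ← tp_sum]; simp
theorem card_Kp (h : Q0 → ℕ) (hh : HTp) [Fintype Q1] [Fintype (Kp ta ha σ)] :
    Fintype.card (Kp ta ha σ) = ∑ x, ∑ y, (σ x).toNat * numQuiverPaths ta ha x y * (-(σ y)).toNat := by
  have := path_finite h hh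
  rw [← card_eq_fintype_card, card_sigma]
  simp_rw [card_sigma]
  rw [tp_sum (σ := σ) (fun x => ∑ t : Tp (-σ), Nat.card {l // IsQuiverPath ta ha x t.1 l})]
  refine sum_congr rfl fun x _ => ?_
  rw [tp_sum (σ := -σ) (fun y => Nat.card {l // IsQuiverPath ta ha x y l}), Finset.mul_sum]
  exact sum_congr rfl fun y _ => by rw [numQuiverPaths, Pi.neg_apply]; ring
end SS
theorem val_sum_eq {F Γ ι : Type} [Field F] [LinearOrderedCommGroupWithZero Γ] (v : Valuation F Γ) (s : Finset ι) (t : ι → F)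
    (h0 : ∑ i ∈ s, t i = 0) (hne : ∃ i ∈ s, t i ≠ 0) : ∃ i ∈ s, ∃ j ∈ s, i ≠ j ∧ v (t i) = v (t j) ∧ t i ≠ 0 := by
  classical
  obtain ⟨i0, h1, h2⟩ := hne
  obtain ⟨i, hi, hm⟩ := s.exists_max_image (fun i => v (t i)) ⟨i0, h1⟩
  have hi0 : v (t i) ≠ 0 := fun h => by
    have := hm i0 h1; rw [h, le_zero_iff, v.zero_iff] at this; exact h2 this
  by_contra! hc
  have hlt : v (∑ j ∈ s.erase i, t j) < v (t i) := by
    refine Valuation.map_sum_lt v hi0 fun j hj => ?_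
    rw [mem_erase] at hj
    exact lt_of_le_of_ne (hm j hj.2) fun h => hc i hi j hj.2 hj.1.symm h.symm |> v.ne_zero_iff.1 hi0
  rw [← add_sum_erase _ _ hi] at h0
  rw [eq_neg_of_add_eq_zero_right h0, Valuation.map_neg] at hlt
  exact lt_irrefl _ hlt
theorem dvr_val {D Kz F : Type} [CommRing D] [IsDomain D] [IsDiscreteValuationRing D] [Field Kz] [Field F] [Algebra D Kz] [IsFractionRing D Kz]
    [Algebra D F] [Algebra Kz F] [IsScalarTower D Kz F] [FiniteDimensional Kz F] (f : F) (hf : ¬ IsIntegral D f) :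
    ∃ (O : ValuationSubring F) (w : F → ℤ), (∀ x y, x ≠ 0 → y ≠ 0 → w (x * y) = w x + w y) ∧ (∀ x, x ≠ 0 → (x ∈ O ↔ 0 ≤ w x)) ∧
      (∀ r : D, algebraMap D F r ∈ O) ∧ f ∉ O := by
  obtain ⟨O, hO, hfO⟩ : ∃ O : ValuationSubring F, (∀ r : D, algebraMap D F r ∈ O) ∧ f ∉ O := by
    have : IsIntegrallyClosedIn (integralClosure D F).toSubring F := inferInstanceAs (IsIntegrallyClosedIn (integralClosure D F) F)
    obtain ⟨V, h1, h2⟩ := Subring.exists_le_valuationSubring_of_isIntegrallyClosedIn (R := (integralClosure D F).toSubring) (x := f) hf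
    exact ⟨V, fun r => h1 (isIntegral_algebraMap (A := F) (x := r)), h2⟩
  obtain ⟨π, hπ⟩ := IsDiscreteValuationRing.exists_irreducible D
  set v := O.valuation
  have hv : ∀ x, x ∈ O ↔ v x ≤ 1 := fun x => (O.valuation_le_one_iff x).symm
  have hu : ∀ u : Dˣ, v (algebraMap D F u) = 1 := fun u => by
    apply le_antisymm ((hv _).1 (hO _))
    have h1 : v (algebraMap D F u) * v (algebraMap D F (u⁻¹ : Dˣ)) = 1 := by rw [← map_mul, ← map_mul, Units.mul_inv, map_one, map_one]
    rw [← h1]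
    exact mul_le_of_le_one_right' ((hv _).1 (hO _))
  have hinj : Injective (algebraMap D F) := by
    rw [IsScalarTower.algebraMap_eq D Kz F]; exact (algebraMap Kz F).injective.comp (injective D Kz)
  set P := v (algebraMap D F π)
  have hP0 : P ≠ 0 := v.ne_zero_iff.2 fun h => hπ.ne_zero (hinj (by rw [h, map_zero]))
  have hP1 : P ≤ 1 := (hv _).1 (hO _)
  have hD : ∀ r : D, r ≠ 0 → ∃ n : ℕ, v (algebraMap D F r) = P ^ n := fun r hr => by
    obtain ⟨n, u, h⟩ := IsDiscreteValuationRing.eq_unit_mul_pow_irreducible hr hπ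
    exact ⟨n, by rw [h, map_mul, map_mul, hu, one_mul, map_pow, map_pow]⟩
  have hK : ∀ a : Kz, a ≠ 0 → ∃ k : ℤ, v (algebraMap Kz F a) = P ^ k := fun a ha => by
    obtain ⟨r, s, hs, rfl⟩ := IsFractionRing.div_surjective (A := D) a
    have hs0 : s ≠ 0 := nonZeroDivisors.ne_zero hs
    have hr0 : r ≠ 0 := by rintro rfl; simp at ha
    obtain ⟨n, hn⟩ := hD r hr0
    obtain ⟨m, hm⟩ := hD s hs0
    refine ⟨n - m, ?_⟩
    rw [map_div₀, ← IsScalarTower.algebraMap_apply, ← IsScalarTower.algebraMap_apply, map_div₀, hn, hm, zpow_sub₀ hP0, zpow_natCast, zpow_natCast]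
  have hx : ∀ x : F, x ≠ 0 → ∃ k : ℤ, v x ^ (finrank Kz F).factorial = P ^ k := by
    intro x hx
    have hxi : IsIntegral Kz x := Algebra.IsIntegral.isIntegral x
    have h0 := minpoly.aeval Kz x
    rw [Polynomial.aeval_eq_sum_range] at h0
    obtain ⟨i, hi, j, hj, hij, he, hne⟩ := val_sum_eq v _ _ h0 ⟨(minpoly Kz x).natDegree, by simp, by
      rw [Polynomial.coeff_natDegree, (minpoly.monic hxi).leadingCoeff, one_smul]; exact pow_ne_zero _ hx⟩
    have key : ∀ i j : ℕ, i < j → j ≤ (minpoly Kz x).natDegree → v ((minpoly Kz x).coeff i • x ^ i) = v ((minpoly Kz x).coeff j • x ^ j) → 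
       (minpoly Kz x).coeff i • x ^ i ≠ 0 → ∃ k : ℤ, v x ^ (finrank Kz F).factorial = P ^ k := by
      intro i j hij hj he hne
      have hne' : (minpoly Kz x).coeff j • x ^ j ≠ 0 := v.ne_zero_iff.1 (he ▸ v.ne_zero_iff.2 hne)
      obtain ⟨k, hk⟩ := hK _ (left_ne_zero_of_smul hne)
      obtain ⟨l, hl⟩ := hK _ (left_ne_zero_of_smul hne')
      rw [Algebra.smul_def, Algebra.smul_def, map_mul, map_mul, map_pow, map_pow, hk, hl, show j = (j - i) + i by omega, pow_add, ← mul_assoc] at he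
      have h2 := mul_right_cancel₀ (pow_ne_zero i (v.ne_zero_iff.2 hx)) he
      have h3 : v x ^ (j - i) = P ^ (k - l) := by
        rw [zpow_sub₀ hP0, h2, mul_comm, mul_div_cancel_right₀ _ (zpow_ne_zero _ hP0)]
      obtain ⟨q, hq⟩ := Nat.dvd_factorial (show 0 < j - i by omega) ((Nat.sub_le j i).trans (hj.trans (minpoly.natDegree_le x)))
      exact ⟨(k - l) * q, by rw [hq, pow_mul, h3, _root_.zpow_mul, zpow_natCast]⟩
    rw [mem_range] at hi hj
    rcases lt_or_gt_of_ne hij with h | h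
    · exact key i j h (by omega) he hne
    · exact key j i h (by omega) he.symm (v.ne_zero_iff.1 (he ▸ v.ne_zero_iff.2 hne))
  have hM : (finrank Kz F).factorial ≠ 0 := Nat.factorial_ne_zero _
  have hf1 : 1 < v f := by rw [hv] at hfO; exact not_le.1 hfO
  have hP : P < 1 := by
    refine lt_of_le_of_ne hP1 fun h => ?_
    obtain ⟨k, hk⟩ := hx f (fun h => by rw [h] at hfO; exact hfO O.zero_mem)
    rw [h, _root_.one_zpow, pow_eq_one_iff_of_nonneg zero_le' hM] at hk
    exact hf1.ne' hk
  have hinj2 : ∀ a b : ℤ, P ^ a ≤ P ^ b ↔ b ≤ a := fun a b => (zpow_right_strictAnti₀ (zero_lt_iff.2 hP0) hP).le_iff_ge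
  choose! w hw using hx
  refine ⟨O, w, fun x y h h' => ?_, fun x h => ?_, hO, hfO⟩
  · have : P ^ (w (x * y)) = P ^ (w x + w y) := by
      rw [zpow_add₀ hP0, ← hw x h, ← hw y h', ← hw _ (mul_ne_zero h h'), map_mul, mul_pow]
    exact le_antisymm ((hinj2 _ _).1 this.ge) ((hinj2 _ _).1 this.le)
  · rw [hv, ← pow_le_one_iff_of_nonneg zero_le' hM, hw x h, ← zpow_zero P, hinj2]
theorem ufd_val {R Kz F : Type} [CommRing R] [IsDomain R] [IsNoetherianRing R] [UniqueFactorizationMonoid R] [Field Kz] [Field F] [Algebra R Kz] [IsFractionRing R Kz]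
    [Algebra R F] [Algebra Kz F] [IsScalarTower R Kz F] [FiniteDimensional Kz F] (f : F) (hf : ¬ IsIntegral R f) :
    ∃ (O : ValuationSubring F) (w : F → ℤ), (∀ x y, x ≠ 0 → y ≠ 0 → w (x * y) = w x + w y) ∧ (∀ x, x ≠ 0 → (x ∈ O ↔ 0 ≤ w x)) ∧
      (∀ r : R, algebraMap R F r ∈ O) ∧ f ∉ O := by
  have hfi : IsIntegral Kz f := Algebra.IsIntegral.isIntegral f
  obtain ⟨i, hi⟩ : ∃ i, (minpoly Kz f).coeff i ∉ (algebraMap R Kz).range := by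
    by_contra! hc
    apply hf
    have hl : minpoly Kz f ∈ Polynomial.lifts (algebraMap R Kz) := (Polynomial.lifts_iff_coeff_lifts _).2 hc
    obtain ⟨q, hq, -, hq2⟩ := Polynomial.lifts_and_natDegree_eq_and_monic hl (minpoly.monic hfi)
    refine ⟨q, hq2, ?_⟩
    rw [← Polynomial.aeval_def, ← Polynomial.aeval_map_algebraMap Kz, hq, minpoly.aeval]
  obtain ⟨a, b, hab, hx⟩ := IsFractionRing.exists_reduced_fraction (A := R) ((minpoly Kz f).coeff i)
  have hb : ¬ IsUnit (b : R) := fun h => hi (by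
    obtain ⟨u, hu⟩ := h
    refine ⟨a * (u⁻¹ : Rˣ), ?_⟩
    rw [← hx, IsLocalization.eq_mk'_iff_mul_eq, ← hu, ← map_mul, mul_assoc, Units.inv_mul, mul_one])
  obtain ⟨π, hπ, hπb⟩ := WfDvdMonoid.exists_irreducible_factor hb (nonZeroDivisors.coe_ne_zero b)
  have hπp : Prime π := hπ.prime
  have hπa : ¬ π ∣ a := fun h => hπ.not_isUnit (hab h hπb)
  have hPp : (Ideal.span {π}).IsPrime := (Ideal.span_singleton_prime hπp.ne_zero).2 hπp
  set P := Ideal.span {π}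
  have hle : P.primeCompl ≤ nonZeroDivisors R := P.primeCompl_le_nonZeroDivisors
  let D := subalgebra.ofField Kz P.primeCompl hle
  have hloc : AtPrime D P := subalgebra.isLocalization_ofField Kz P.primeCompl hle
  have : IsLocalRing D := AtPrime.isLocalRing D P
  have : IsNoetherianRing D := IsLocalization.isNoetherianRing P.primeCompl D inferInstance
  have : IsIntegrallyClosed D := isIntegrallyClosed_of_isLocalization (R := R) D P.primeCompl hle
  have hmax : P.map (algebraMap R D) = IsLocalRing.maximalIdeal D := AtPrime.map_eq_maximalIdeal P D
  have hinj : Injective (algebraMap R D) := IsLocalization.injective D hle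
  have hnf : ¬ IsField D := by
    rw [IsLocalRing.isField_iff_maximalIdeal_eq, ← hmax]
    intro h
    have : algebraMap R D π ∈ P.map (algebraMap R D) := Ideal.mem_map_of_mem _ (Ideal.mem_span_singleton_self π)
    rw [h, Ideal.mem_bot] at this
    exact hπp.ne_zero (hinj (by rw [this, map_zero]))
  have : IsDiscreteValuationRing D := ((IsDiscreteValuationRing.TFAE D hnf).out 0 4).2 (by
    rw [← hmax, Ideal.map_span, Set.image_singleton]; exact ⟨_, rfl⟩)
  have hnI : ¬ IsIntegral D f := by
    intro h
    have h2 := minpoly.isIntegrallyClosed_eq_field_fractions' (R := D) Kz h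
    rw [h2, Polynomial.coeff_map] at hx
    obtain ⟨a', s, hs, h3⟩ := ((minpoly D f).coeff i).2
    change _ = (((minpoly D f).coeff i : D) : Kz) at hx
    rw [h3, IsLocalization.mk'_eq_iff_eq_mul] at hx
    have hs0 : algebraMap R Kz s ≠ 0 := fun h => hs (by
      rw [injective R Kz (h.trans (map_zero _).symm)]; exact P.zero_mem)
    rw [mul_right_comm, ← div_eq_mul_inv, eq_div_iff hs0, ← map_mul, ← map_mul] at hx
    have h4 : π ∣ a * s := by rw [injective R Kz hx]; exact hπb.mul_left _
    rcases hπp.dvd_or_dvd h4 with h | h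
    · exact hπa h
    · exact hs (Ideal.mem_span_singleton.2 h)
  obtain ⟨O, w, h1, h2, h3, h4⟩ := dvr_val (D := D) (Kz := Kz) f hnI
  refine ⟨O, w, h1, h2, fun r => ?_, h4⟩
  have := h3 (algebraMap R D r)
  rwa [IsScalarTower.algebraMap_apply D Kz F, ← IsScalarTower.algebraMap_apply R D Kz, ← IsScalarTower.algebraMap_apply] at this
theorem adapted {k : Type} [Field k] {a : ℕ} (W : Submodule k (Fin a → k)) :
    ∃ (b : GeneralLinearGroup (Fin a) k) (J : Finset (Fin a)), J.card = finrank k W ∧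
      (∀ c ∈ J, (fun r => b.val r c) ∈ W) ∧ ∀ w ∈ W, ∀ r ∉ J, ((b⁻¹).val *ᵥ w) r = 0 := by
  classical
  obtain ⟨W', hW⟩ := Submodule.exists_isCompl W
  let β0 := ((finBasis k W).prod (finBasis k W')).map (prodEquivOfIsCompl W W' hW)
  have hc : Fintype.card (Fin (finrank k W) ⊕ Fin (finrank k W')) = Fintype.card (Fin a) := by
    rw [← Module.finrank_eq_card_basis β0, finrank_fin_fun, card_fin]
  let E := equivOfCardEq hc
  let β := β0.reindex E
  let B := Pi.basisFun k (Fin a)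
  refine ⟨⟨B.toMatrix β, β.toMatrix B, B.toMatrix_mul_toMatrix_flip β, β.toMatrix_mul_toMatrix_flip B⟩,
    univ.map (Embedding.inl.trans E.toEmbedding), by simp, ?_, ?_⟩
  · intro c hc
    obtain ⟨j, -, rfl⟩ := mem_map.1 hc
    have : (fun r => B.toMatrix β r ((Embedding.inl.trans E.toEmbedding) j)) = ((finBasis k W j : W) : Fin a → k) := by
      ext r; simp [B, β, β0, Basis.toMatrix_apply]
    exact this ▸ (finBasis k W j).2
  · intro w hw r hr
    have h1 : β.toMatrix B *ᵥ w = β.repr w := by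
      have := Basis.toMatrix_mulVec_repr B β w
      rwa [show (B.repr w : Fin a → k) = w by ext; simp [B]] at this
    change (β.toMatrix B *ᵥ w) r = 0
    rw [h1]
    obtain ⟨s, rfl⟩ := E.surjective r
    rcases s with s | s
    · exact absurd (mem_map.2 ⟨s, mem_univ _, rfl⟩) hr
    · have : (prodEquivOfIsCompl W W' hW).symm w = (⟨w, hw⟩, 0) := by
        rw [LinearEquiv.symm_apply_eq]; simp
      simp [β, β0, this]
section Red
variable {Q0 Q1 : Type} {ta ha : Q1 → Q0} {α : Q0 → ℕ} {σ : Q0 → ℤ} [Fintype Q0] [DecidableEq Q0]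
theorem ssred {K F ι : Type} [Field K] [Infinite K] [Field F] [Algebra K F] [Fintype Q1] (h : Q0 → ℕ) (hh : HTp)
    (O : ValuationSubring F) (w : F → ℤ) (w2 : ∀ x y, x ≠ 0 → y ≠ 0 → w (x * y) = w x + w y)
    (wO : ∀ x, x ≠ 0 → (x ∈ O ↔ 0 ≤ w x)) (hK : ∀ a : K, algebraMap K F a ∈ O) (V : VV → F)
    (d : ℕ) (hd : 0 < d) (f : PK) (hf : IsL (fun i => (d : ℤ) * σ i) f) (hfV : aeval V f ∉ O)
    (N : ℕ) (hN : 0 < N) (c : ι → PK) (hc : ∀ μ, IsL (fun i => (N : ℤ) * σ i) (c μ))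
    (hcO : ∀ μ, aeval V (c μ) ∈ O)
    (hs : ∀ (k : Type) [Field k] [Infinite k] [Algebra K k] (v : VV → k), Sst σ v → ∃ μ, aeval v (c μ) ≠ 0) : False := by
  classical
  have w1 : w 1 = 0 := by have := w2 1 1 one_ne_zero one_ne_zero; rw [mul_one] at this; omega
  have wi : ∀ x, x ≠ 0 → w x⁻¹ = - w x := fun x hx => by
    have := w2 x x⁻¹ hx (inv_ne_zero hx); rw [mul_inv_cancel₀ hx, w1] at this; omega
  have wn : ∀ x, x ≠ 0 → ∀ e : ℕ, w (x ^ e) = e * w x := fun x hx e => by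
    induction e with
    | zero => simp [w1]
    | succ e ih => rw [pow_succ, w2 _ _ (pow_ne_zero _ hx) hx, ih]; push_cast; ring
  have wz : ∀ x, x ≠ 0 → ∀ z : ℤ, w (x ^ z) = z * w x := fun x hx z => by
    obtain ⟨e, rfl | rfl⟩ := z.eq_nat_or_neg
    · rw [zpow_natCast, wn x hx]
    · rw [_root_.zpow_neg, zpow_natCast, wi _ (pow_ne_zero _ hx), wn x hx]; ring
  have wp : ∀ {I : Type} (s : Finset I) (g : I → F), (∀ i, g i ≠ 0) → w (∏ i ∈ s, g i) = ∑ i ∈ s, w (g i) := fun s g hg => by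
    induction s using Finset.induction_on with
    | empty => simp [w1]
    | insert a s ha ih => rw [prod_insert ha, sum_insert ha, w2 _ _ (hg a) (prod_ne_zero_iff.2 fun i _ => hg i), ih]
  have hdet : ∀ (g : GLa α F) i, (g i).val.det ≠ 0 := fun g i => (g i).det.ne_zero
  let ξ : GLa α F → ℤ := fun g => ∑ i, σ i * w (g i).val.det
  have ξm : ∀ g g', ξ (g * g') = ξ g + ξ g' := fun g g' => by
    simp only [ξ, ← sum_add_distrib]
    refine sum_congr rfl fun i _ => ?_
    rw [Pi.mul_apply, val_mul, det_mul, w2 _ _ (hdet g i) (hdet g' i)]; ring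
  have chr0 : ∀ (χ : Q0 → ℤ) (g : GLa α F), chr χ g ≠ 0 := fun χ g => prod_ne_zero_iff.2 fun i _ => zpow_ne_zero _ (hdet g i)
  have ξc : ∀ (e : ℕ) g, w (chr (fun i => (e : ℤ) * σ i) g) = e * ξ g := fun e g => by
    rw [chr, wp _ _ fun i => zpow_ne_zero _ (hdet g i), Finset.mul_sum]
    exact sum_congr rfl fun i _ => by rw [wz _ (hdet g i)]; ring
  have h0 : aeval V f ≠ 0 := fun h => hfV (h ▸ O.zero_mem)
  have hf0 : w (aeval V f) < 0 := by have := (wO _ h0).not.1 hfV; omega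
  letI algO : Algebra K O := ((algebraMap K F).codRestrict O.toSubring hK).toAlgebra
  haveI : IsScalarTower K O F := of_algebraMap_eq fun _ => rfl
  let G : GLa α F → Prop := fun g => ∀ p, gact g V p ∈ O
  have G1 : ∀ g, G g → 1 ≤ ξ g := by
    intro g hg
    let U : VV → O := fun p => ⟨gact g V p, hg p⟩
    have h1 : aeval (gact g V) f ∈ O := by
      rw [show gact g V = algebraMap O F ∘ U from rfl, aeval_algebraMap_apply]; exact (aeval U f).2
    rw [hf.gl, wO _ (mul_ne_zero (chr0 _ _) h0), w2 _ _ (chr0 _ _) h0, ξc] at h1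
    have : 0 < (d : ℤ) * ξ g := by omega
    have := pos_of_mul_pos_right this (by omega)
    omega
  have gd : ∀ (D : (i : Q0) → Fai → Fˣ) v p, gact (dgl D) v p = (((D (ha p.1) p.2.1)⁻¹ * D (ta p.1) p.2.2 : Fˣ) : F) * v p :=
    fun D v p => cact_diag D v p
  obtain ⟨g0, hg0⟩ : ∃ g, G g := by
    let t : Fˣ := Units.mk0 (aeval V f) h0
    obtain ⟨e, he⟩ : ∃ e : ℕ, ∀ p, V p ≠ 0 → 0 ≤ e + w (V p) :=
      ⟨∑ p, (w (V p)).natAbs, fun p _ => by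
        have := Finset.single_le_sum (f := fun p => (w (V p)).natAbs) (fun _ _ => Nat.zero_le _) (mem_univ p)
        omega⟩
    refine ⟨dgl fun i _ => t ^ (e * h i), fun p => ?_⟩
    rw [gd]
    by_cases hp : V p = 0
    · rw [hp, mul_zero]; exact O.zero_mem
    rw [wO _ (mul_ne_zero (ne_zero _) hp), w2 _ _ (ne_zero _) hp, val_mul, w2 _ _ (ne_zero _) (ne_zero _),
      Units.val_inv_eq_inv_val, wi _ (ne_zero _), val_pow_eq_pow_val, val_pow_eq_pow_val, wn _ t.ne_zero, wn _ t.ne_zero, show (t : F) = aeval V f from rfl]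
    have h1 := he p hp
    have h2 : (h (ta p.1) : ℤ) + 1 ≤ h (ha p.1) := by have := hh p.1; omega
    push_cast
    have : (0:ℤ) ≤ e * ((h (ha p.1) - h (ta p.1)) * (- w (aeval V f)) - 1) := mul_nonneg (by omega) (by nlinarith)
    linarith
  obtain ⟨ϖ, ⟨hϖ0, hϖ⟩, hϖm⟩ : ∃ ϖ : F, (ϖ ≠ 0 ∧ 0 < w ϖ) ∧ ∀ y, y ≠ 0 → 0 < w y → w ϖ ≤ w y := by
    obtain ⟨z, ⟨ϖ, h1, h2, rfl⟩, h3⟩ := exists_least_of_bdd (P := fun z => ∃ y : F, y ≠ 0 ∧ 0 < w y ∧ w y = z)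
      ⟨0, by rintro _ ⟨y, _, h, rfl⟩; exact h.le⟩ ⟨_, (aeval V f)⁻¹, inv_ne_zero h0, by rw [wi _ h0]; omega, rfl⟩
    exact ⟨ϖ, ⟨h1, h2⟩, fun y hy hy' => h3 _ ⟨y, hy, hy', rfl⟩⟩
  obtain ⟨z, ⟨g, hg, rfl⟩, hmin⟩ := exists_least_of_bdd (P := fun z => ∃ g, G g ∧ ξ g = z)
    ⟨1, by rintro _ ⟨g, hg, rfl⟩; exact G1 g hg⟩ ⟨_, g0, hg0, rfl⟩
  let U : VV → O := fun p => ⟨gact g V p, hg p⟩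
  let res := IsLocalRing.residue O
  have unitw : ∀ u : O, IsUnit u → (u : F) ≠ 0 ∧ w u = 0 := fun u hu => by
    obtain ⟨u, rfl⟩ := hu
    have h1 : ((u : O) : F) * ((u⁻¹ : Oˣ) : O) = 1 := by exact_mod_cast congrArg (Subtype.val) u.mul_inv
    have h2 := left_ne_zero_of_mul_eq_one h1
    have h3 := right_ne_zero_of_mul_eq_one h1
    have h4 := w2 _ _ h2 h3
    rw [h1, w1] at h4
    have := (wO _ h2).1 (u : O).2
    have := (wO _ h3).1 ((u⁻¹ : Oˣ) : O).2
    exact ⟨h2, by omega⟩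
  have nonu : ∀ u : O, res u = 0 → ((ϖ⁻¹ : F) * u) ∈ O := fun u hu => by
    by_cases hu0 : (u : F) = 0
    · rw [hu0, mul_zero]; exact O.zero_mem
    rw [wO _ (mul_ne_zero (inv_ne_zero hϖ0) hu0), w2 _ _ (inv_ne_zero hϖ0) hu0, wi _ hϖ0]
    have h1 := (wO _ hu0).1 u.2
    rcases h1.lt_or_eq with h1 | h1
    · have := hϖm _ hu0 h1; omega
    · exfalso
      have h2 : (u : F)⁻¹ ∈ O := (wO _ (inv_ne_zero hu0)).2 (by rw [wi _ hu0]; omega)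
      rw [IsLocalRing.residue_eq_zero_iff, IsLocalRing.mem_maximalIdeal] at hu
      exact hu (IsUnit.of_mul_eq_one (⟨_, h2⟩ : O) (Subtype.ext (mul_inv_cancel₀ hu0)))
  haveI : Infinite (ResidueField O) := Infinite.of_injective (algebraMap K _) (algebraMap K _).injective
  have hss : Sst σ (fun p => res (U p)) := by
    intro W hW
    by_contra hpos
    push Not at hpos
    choose b J hJ hb hb' using fun i => adapted (W i)
    have hB : ∀ i, ∃ B : GeneralLinearGroup Fai O, GeneralLinearGroup.map res B = b i := fun i => by
      choose M hM using fun r c => IsLocalRing.residue_surjective ((b i).val r c)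
      have h1 : (of M).map res = (b i).val := by ext r c; exact hM r c
      refine ⟨GeneralLinearGroup.mk'' (of M) ?_, Units.ext h1⟩
      rw [← isUnit_map_iff res, map_det, mapMatrix_apply, h1]
      exact (b i).det.isUnit
    choose B hB using hB
    let ϖu : Fˣ := Units.mk0 ϖ hϖ0
    let D : (i : Q0) → Fai → Fˣ := fun i k => if k ∈ J i then ϖu⁻¹ else 1
    let BF : GLa α F := fun i => GeneralLinearGroup.map (algebraMap O F) (B i)
    let U' := cact (fun i => ((B i)⁻¹).val) (fun i => (B i).val) U
    have e1 : gact BF (gact g V) = fun p => (U' p : F) := by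
      have := cact_map (algebraMap O F) (fun i => ((B i)⁻¹).val) (fun i => (B i).val) U
      refine Eq.trans ?_ this.symm
      rw [gact]
      congr 1
    have e2 : (fun p => res (U' p)) = cact (fun i => ((b i)⁻¹).val) (fun i => (b i).val) (fun p => res (U p)) := by
      rw [cact_map]
      congr 1
      · funext i; rw [← hB i, ← _root_.map_inv]; rfl
      · funext i; rw [← hB i]; rfl
    have hG : G (g * (BF * dgl D)) := by
      intro p
      rw [gact_mul, gact_mul, e1, gd]
      simp only [D]
      by_cases hr : p.2.1 ∈ J (ha p.1) <;> by_cases hc : p.2.2 ∈ J (ta p.1)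
      · rw [if_pos hr, if_pos hc, inv_mul_cancel, val_one, one_mul]; exact (U' p).2
      · rw [if_pos hr, if_neg hc, inv_inv, mul_one]; exact O.mul_mem _ _ ((wO _ hϖ0).2 hϖ.le) (U' p).2
      · rw [if_neg hr, if_pos hc, inv_one, one_mul]
        convert nonu (U' p) ?_
        · simp [ϖu]
        rw [congrFun e2 p]
        have := hb' _ _ (hW p.1 ⟨_, hb _ _ hc, rfl⟩) _ hr
        rw [← this, cact, Matrix.mul_assoc, mul_apply]
        rfl
      · rw [if_neg hr, if_neg hc, inv_one, mul_one, val_one, one_mul]; exact (U' p).2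
    have hlt := hmin _ ⟨_, hG, rfl⟩
    rw [ξm, ξm] at hlt
    have x1 : ξ BF = 0 := sum_eq_zero fun i _ => by
      have : ((BF i).val.det : F) = ((B i).val.det : O) := by
        change ((B i).val.map (algebraMap O F)).det = _
        rw [← mapMatrix_apply, ← map_det]; rfl
      rw [this, (unitw (B i).val.det (B i).det.isUnit).2, mul_zero]
    have x2 : ξ (dgl D) = - w ϖ * ∑ i, σ i * (finrank (ResidueField O) (W i) : ℤ) := by
      rw [Finset.mul_sum]
      refine sum_congr rfl fun i _ => ?_
      have : (dgl D i).val.det = (ϖ⁻¹) ^ (J i).card := by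
        change (diagonal fun k => (D i k).1).det = _
        rw [det_diagonal, ← prod_const, ← Finset.prod_filter_mul_prod_filter_not _ (· ∈ J i), Finset.filter_mem_eq_inter, Finset.univ_inter,
          prod_congr rfl (g := fun _ => ϖ⁻¹) (fun k hk => by simp [D, hk, ϖu]), prod_eq_one (s := Finset.filter _ _) (fun k hk => by simp [D, (mem_filter.1 hk).2]), mul_one]
      rw [this, wn _ (inv_ne_zero hϖ0), wi _ hϖ0, hJ]; ring
    rw [x1, x2] at hlt
    nlinarith [mul_pos hϖ hpos]
  obtain ⟨μ, hμ⟩ := hs _ _ hss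
  have h1 : IsUnit (aeval U (c μ)) := by
    rw [← isUnit_map_iff res, isUnit_iff_ne_zero]
    rw [show (fun p => res (U p)) = algebraMap O (ResidueField O) ∘ U from rfl, aeval_algebraMap_apply] at hμ
    exact hμ
  have h2 := unitw _ h1
  have h3 : ((aeval U (c μ) : O) : F) = aeval (gact g V) (c μ) := by
    rw [show gact g V = algebraMap O F ∘ U from rfl, aeval_algebraMap_apply]; rfl
  rw [h3, (hc μ).gl] at h2
  have h4 := right_ne_zero_of_mul h2.1
  rw [w2 _ _ (chr0 _ _) h4, ξc] at h2
  have h5 := (wO _ h4).1 (hcO μ)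
  have h6 := G1 g hg
  have : (0:ℤ) < N * ξ g := mul_pos (by omega) (by omega)
  omega
end Red
theorem int_inv {A L : Type} [CommRing A] [Field L] [Algebra A L] (f : L) (h0 : f ≠ 0) (B : Subalgebra A L) (hB : adjoin A {f⁻¹} = B)
    (h : IsIntegral B f) :
    IsIntegral A f := by
  have hi : f⁻¹ ∈ B := hB ▸ subset_adjoin rfl
  have key : ∀ {B : Type} [CommRing B] [Algebra B L] (p : Polynomial B), Polynomial.aeval f⁻¹ p.reverse * f ^ p.natDegree = Polynomial.aeval f p := by
    intro B _ _ p
    letI := invertibleOfNonzero h0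
    have := eval₂_reverse_mul_pow (algebraMap B L) f p
    rwa [invOf_eq_inv] at this
  have hm : f ∈ B := by
    obtain ⟨p, hp, hp0⟩ := h
    have h1 := key p
    rw [Polynomial.aeval_def, Polynomial.aeval_def, hp0, mul_eq_zero, or_iff_left (pow_ne_zero _ h0), ← Polynomial.divX_mul_X_add p.reverse, coeff_zero_reverse,
      hp.leadingCoeff] at h1
    simp only [Polynomial.eval₂_add, Polynomial.eval₂_mul, Polynomial.eval₂_X, map_one, Polynomial.eval₂_one] at h1
    have h2 : - Polynomial.eval₂ (algebraMap B L) f⁻¹ p.reverse.divX = f := by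
      linear_combination (-f) * h1 + (Polynomial.eval₂ (algebraMap B L) f⁻¹ p.reverse.divX) * (mul_inv_cancel₀ h0)
    refine Set.mem_of_eq_of_mem h2.symm (neg_mem ?_)
    rw [show f⁻¹ = algebraMap B L ⟨_, hi⟩ from rfl, Polynomial.eval₂_at_apply]
    exact Subtype.property _
  obtain ⟨Q, hQ⟩ := Algebra.adjoin_singleton_eq_range_aeval A f⁻¹ ▸ (hB.symm ▸ hm : f ∈ adjoin A {f⁻¹})
  have hQ : Polynomial.aeval f⁻¹ Q = f := hQ
  letI := invertibleOfNonzero (inv_ne_zero h0)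
  have h3 := eval₂_reverse_mul_pow (algebraMap A L) f⁻¹ Q
  rw [invOf_eq_inv, inv_inv, ← Polynomial.aeval_def f⁻¹, hQ] at h3
  refine ⟨Polynomial.X ^ (Q.natDegree + 1) - Q.reverse, Polynomial.monic_X_pow_sub (lt_of_le_of_lt Polynomial.degree_le_natDegree
    (by exact_mod_cast lt_succ_of_le (Polynomial.reverse_natDegree_le Q))), ?_⟩
  rw [Polynomial.eval₂_sub, Polynomial.eval₂_X_pow]
  have : f ^ Q.natDegree * (f⁻¹) ^ Q.natDegree = 1 := by rw [← mul_pow, mul_inv_cancel₀ h0, one_pow]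
  linear_combination (-f ^ Q.natDegree) * h3 + (Polynomial.eval₂ (algebraMap A L) f Q.reverse) * this
theorem memO {R F : Type} [CommRing R] [Field F] [Algebra R F] (O : ValuationSubring F) (hRO : ∀ r : R, algebraMap R F r ∈ O) (x : F) (hx : IsIntegral R x) : x ∈ O := by
  letI : Algebra R O := ((algebraMap R F).codRestrict O.toSubring hRO).toAlgebra
  haveI : IsScalarTower R O F := of_algebraMap_eq fun _ => rfl
  obtain ⟨y, hy⟩ := IsIntegrallyClosed.isIntegral_iff.1 (hx.tower_top (A := O))
  rw [← hy]; exact y.2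
theorem noeth {K S L : Type} [Field K] [CommRing S] [Algebra K S] [Field L] [Algebra S L] [Algebra K L] [IsScalarTower K S L]
    (hinj : Injective (algebraMap S L)) (A : Subalgebra K S) (hA : A.FG) (f : S) (hf : ¬ IsIntegral A f) :
    ∃ s, ∃ gL : Pfs →ₐ[K] L, Injective gL ∧ (∀ a ∈ A, gL.toRingHom.IsIntegralElem (algebraMap S L a)) ∧
      ¬ gL.toRingHom.IsIntegralElem (algebraMap S L f) ∧ gL.toRingHom.IsIntegralElem (algebraMap S L f)⁻¹ := by
  have h0 : algebraMap S L f ≠ 0 := fun h => hf (by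
    rw [hinj (h.trans (map_zero _).symm)]; exact isIntegral_zero)
  generalize hB : (adjoin A {(algebraMap S L f)⁻¹} : Subalgebra A L) = B
  have hfB : ¬ IsIntegral B (algebraMap S L f) := fun h => hf ((isIntegral_algebraMap_iff hinj).1 (int_inv _ h0 B hB h))
  haveI : FiniteType K A := (fg_iff_finiteType _).1 hA
  haveI : FiniteType A B := (fg_iff_finiteType _).1 ⟨{(algebraMap S L f)⁻¹}, by simp [hB]⟩
  haveI : FiniteType K B := FiniteType.trans (S := A) inferInstance inferInstance
  obtain ⟨s, g, ginj, gint⟩ := exists_integral_inj_algHom_of_fg K B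
  have hBR : ∀ b : B, ((toAlgHom K B L).comp g).toRingHom.IsIntegralElem (b : L) := fun b => by
    obtain ⟨p, hp, hp0⟩ := gint b
    refine ⟨p, hp, ?_⟩
    have := congrArg (algebraMap B L) hp0
    rw [Polynomial.hom_eval₂, map_zero] at this
    exact this
  refine ⟨s, (toAlgHom K B L).comp g, val_injective.comp ginj, fun a ha => hBR (algebraMap A B ⟨a, ha⟩), ?_,
    hBR ⟨_, hB ▸ subset_adjoin rfl⟩⟩
  rintro ⟨p, hp, hp0⟩
  exact hfB ⟨p.map g.toRingHom, hp.map _, by rw [Polynomial.eval₂_map]; exact hp0⟩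
theorem pt_aux {K R Kz L V ι : Type} [Field K] [Field L] [Algebra K L] [CommRing R] [IsDomain R] [IsNoetherianRing R] [UniqueFactorizationMonoid R]
    [Algebra K R] [Algebra R L] [IsScalarTower K R L] [Field Kz] [Algebra R Kz] [IsFractionRing R Kz] [Algebra K Kz] [IsScalarTower K R Kz]
    [Algebra Kz L] [IsScalarTower R Kz L] [IsScalarTower K Kz L] [Finite V] (x : V → L) (c : ι → MvPolynomial V K) (f : MvPolynomial V K)
    (hc : ∀ μ, IsIntegral R (aeval x (c μ))) (hfR : ¬ IsIntegral R (aeval x f)) (hfi : IsIntegral R (aeval x f)⁻¹) :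
    ∃ (F : Type) (_ : Field F) (_ : Algebra K F) (O : ValuationSubring F) (w : F → ℤ),
      (∀ x y, x ≠ 0 → y ≠ 0 → w (x * y) = w x + w y) ∧ (∀ x, x ≠ 0 → (x ∈ O ↔ 0 ≤ w x)) ∧ (∀ a : K, algebraMap K F a ∈ O) ∧
      ∃ v : V → F, (∀ μ, aeval v (c μ) ∈ O) ∧ aeval v f ∉ O := by
  have hfKz : IsIntegral Kz (aeval x f) := by simpa using (hfi.tower_top (A := Kz)).inv
  let D : Subalgebra Kz L := adjoin Kz (Set.range x)
  haveI : FiniteType Kz D := (fg_iff_finiteType _).1 ⟨(finite_range x).toFinset, by simp [D]⟩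
  obtain ⟨M, hM⟩ := Ideal.exists_maximal D
  letI : Field (D ⧸ M) := Ideal.Quotient.field M
  haveI : FiniteType Kz (D ⧸ M) := FiniteType.of_surjective (Ideal.Quotient.mkₐ Kz M) (Ideal.Quotient.mkₐ_surjective Kz M)
  haveI : Module.Finite Kz (D ⧸ M) := finite_of_finite_type_of_isJacobsonRing Kz (D ⧸ M)
  let xD : V → D := fun v => ⟨x v, subset_adjoin ⟨v, rfl⟩⟩
  have hxD : ∀ g : MvPolynomial V K, ((aeval xD g : D) : L) = aeval x g := fun g => by
    have h1 := aeval_algebraMap_apply (B := L) xD g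
    rw [show algebraMap D L (aeval xD g) = ((aeval xD g : D) : L) from rfl] at h1
    exact h1.symm
  let mk : D →ₐ[Kz] D ⧸ M := Ideal.Quotient.mkₐ Kz M
  let mkK : D →ₐ[K] D ⧸ M := Ideal.Quotient.mkₐ K M
  have hmk : ∀ g : MvPolynomial V K, aeval (fun v => mk (xD v)) g = mk (aeval xD g) := fun g =>
    (MvPolynomial.comp_aeval_apply (f := xD) mkK g).symm
  have hfm : ¬ IsIntegral R (mk (aeval xD f)) := by
    rintro ⟨p, hp, hp0⟩
    let P : D := Polynomial.aeval (aeval xD f) p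
    have hP : mk P = 0 := by
      rw [← hp0, ← Polynomial.aeval_def]
      exact (aeval_algHom_apply (mk.restrictScalars R) _ p).symm
    have hPM : P ∈ M := Ideal.Quotient.eq_zero_iff_mem.1 hP
    have hPL : (P : L) = Polynomial.aeval (aeval x f) p := by
      rw [← hxD f]
      exact (aeval_algHom_apply (D.val.restrictScalars R) _ p).symm
    have hPi : IsIntegral Kz P := by
      rw [← isIntegral_algHom_iff D.val val_injective]
      change IsIntegral Kz (P : L)
      rw [hPL, ← Polynomial.aeval_map_algebraMap Kz]
      exact adjoin_le_integralClosure hfKz (Polynomial.aeval_mem_adjoin_singleton _ _)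
    by_cases hP0 : P = 0
    · exact hfR ⟨p, hp, by rw [← Polynomial.aeval_def, ← hPL, hP0]; rfl⟩
    · exact hM.ne_top (Ideal.eq_top_of_isUnit_mem _ hPM (hPi.isUnit hP0))
  obtain ⟨O, w, w2, wO, hRO, hfO⟩ := ufd_val (R := R) (Kz := Kz) (F := D ⧸ M) _ hfm
  refine ⟨D ⧸ M, inferInstance, inferInstance, O, w, w2, wO, fun a => ?_, fun v => mk (xD v), fun μ => ?_, ?_⟩
  · have := hRO (algebraMap K R a)
    rwa [← IsScalarTower.algebraMap_apply K R (D ⧸ M)] at this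
  · have h1 : IsIntegral R (aeval xD (c μ)) := by
      rw [← isIntegral_algHom_iff (D.val.restrictScalars R) val_injective]
      have := hc μ
      rw [← hxD (c μ)] at this
      exact this
    have h2 := h1.map (mk.restrictScalars R)
    change IsIntegral R (mk (aeval xD (c μ))) at h2
    rw [hmk]
    exact memO O hRO _ h2
  · rw [hmk]; exact hfO
theorem pt_val {K V ι : Type} [Field K] [Finite V] [Finite ι] (c : ι → MvPolynomial V K) (f : MvPolynomial V K)
    (hf : ¬ IsIntegral (adjoin K (Set.range c)) f) :
    ∃ (F : Type) (_ : Field F) (_ : Algebra K F) (O : ValuationSubring F) (w : F → ℤ),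
      (∀ x y, x ≠ 0 → y ≠ 0 → w (x * y) = w x + w y) ∧ (∀ x, x ≠ 0 → (x ∈ O ↔ 0 ≤ w x)) ∧ (∀ a : K, algebraMap K F a ∈ O) ∧
      ∃ v : V → F, (∀ μ, aeval v (c μ) ∈ O) ∧ aeval v f ∉ O := by
  obtain ⟨s, gL, gi, gA, gf, gf'⟩ := noeth (injective (MvPolynomial V K) FPV) _
    (Subalgebra.fg_def.2 ⟨_, finite_range c, rfl⟩) f hf
  letI : Algebra Pfs FPV := gL.toAlgebra
  haveI : IsScalarTower K Pfs FPV := of_algebraMap_eq fun x => (gL.commutes x).symm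
  haveI : FaithfulSMul Pfs FPV := (faithfulSMul_iff_algebraMap_injective _ _).2 gi
  letI := FractionRing.liftAlgebra Pfs FPV
  haveI := FractionRing.isScalarTower_liftAlgebra Pfs FPV
  haveI : IsScalarTower K (FractionRing Pfs) FPV := of_algebraMap_eq fun x => by
    rw [IsScalarTower.algebraMap_apply K Pfs (FractionRing Pfs), ← IsScalarTower.algebraMap_apply Pfs (FractionRing Pfs) _, ← IsScalarTower.algebraMap_apply K Pfs _]
  have hx : ∀ g : MvPolynomial V K, aeval (fun v => algebraMap (MvPolynomial V K) FPV (X v)) g = algebraMap _ _ g := fun g => by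
    have h2 := aeval_algebraMap_apply (B := FPV) (X : V → MvPolynomial V K) g
    rwa [aeval_X_left_apply] at h2
  refine pt_aux (R := Pfs) (Kz := FractionRing Pfs) (L := FPV) (fun v => algebraMap (MvPolynomial V K) _ (X v)) c f (fun μ => ?_) ?_ ?_
  · rw [hx]; exact gA _ (subset_adjoin ⟨μ, rfl⟩)
  · rw [hx]; exact gf
  · rw [hx]; exact gf'
theorem integ {Q0 Q1 : Type} {ta ha : Q1 → Q0} {α : Q0 → ℕ} {σ : Q0 → ℤ} [Fintype Q0] [DecidableEq Q0] {K ι : Type} [Field K] [Infinite K] [Fintype Q1] [Finite ι] (h : Q0 → ℕ) (hh : HTp)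
    (d : ℕ) (hd : 0 < d) (f : PK) (hf : IsL (fun i => (d : ℤ) * σ i) f)
    (N : ℕ) (hN : 0 < N) (c : ι → PK) (hc : ∀ μ, IsL (fun i => (N : ℤ) * σ i) (c μ))
    (hs : ∀ (k : Type) [Field k] [Infinite k] [Algebra K k] (v : VV → k), Sst σ v → ∃ μ, aeval v (c μ) ≠ 0) :
    IsIntegral (adjoin K (Set.range c)) f := by
  by_contra hfi
  obtain ⟨F, _, _, O, w, w2, wO, hK, v, hcO, hfO⟩ := pt_val c f hfi
  exact ssred h hh O w w2 wO hK v d hd f hf hfO N hN c hc hcO hs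
theorem alg_dep {K S E : Type} [Field K] [CommRing S] [Algebra K S] [Fintype E] (g : E → S) {s : ℕ} (c : Fin s → S)
    (hc : ∀ j, c j ∈ adjoin K (Set.range g)) (hs : Fintype.card E < s) : ∃ P : Pfs, P ≠ 0 ∧ aeval c P = 0 := by
  have : ∀ j, ∃ q : MvPolynomial E K, aeval g q = c j := fun j => by
    have := hc j; rwa [adjoin_range_eq_range_aeval] at this
  choose q hq using this
  have hn : ¬ AlgebraicIndependent K q := fun h => by
    have := h.lift_cardinalMk_le_trdeg
    simp [MvPolynomial.trdeg_of_isDomain] at this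
    omega
  rw [algebraicIndependent_iff] at hn
  push Not at hn
  obtain ⟨P, hP, h0⟩ := hn
  refine ⟨P, h0, ?_⟩
  have h1 : (aeval c : Pfs →ₐ[K] S) = (aeval g).comp (aeval q) := by ext j; simp [hq]
  rw [h1, AlgHom.comp_apply, hP, map_zero]
theorem lin_int {K S ι : Type} [Field K] [CommRing S] [Algebra K S] (A : Subalgebra K S) (c : ι → S) (y : ι → A) (a : ι → K) (t : S)
    (hc : ∀ j, c j = y j + a j • t) (P : MvPolynomial ι K) (hP : aeval c P = 0) (hP' : eval a (homogeneousComponent P.totalDegree P) ≠ 0) :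
    IsIntegral A t := by
  let φ : MvPolynomial ι K →ₐ[K] Polynomial A := aeval fun j => Polynomial.C (y j) + Polynomial.C (algebraMap K A (a j)) * Polynomial.X
  have h1 : ∀ Q, Polynomial.aeval t (φ Q) = aeval c Q := fun Q => by
    have : ((Polynomial.aeval t).restrictScalars K).comp φ = (aeval c : MvPolynomial ι K →ₐ[K] S) := by
      ext j
      simp only [φ, AlgHom.comp_apply, aeval_X, AlgHom.restrictScalars_apply, map_add, map_mul, Polynomial.aeval_C, Polynomial.aeval_X, hc, Algebra.smul_def]
      rfl
    exact DFunLike.congr_fun this Q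
  have h2 : ∀ m : ι →₀ ℕ, (φ (monomial m 1)).natDegree ≤ m.degree ∧ (φ (monomial m 1)).coeff m.degree = algebraMap K A (eval a (monomial m 1)) := by
    intro m
    induction m using induction_linear with
    | zero => simp [Finsupp.degree]
    | add f g hf hg =>
      rw [show monomial (f + g) (1 : K) = monomial f 1 * monomial g 1 by simp [monomial_mul], map_mul, map_mul, map_mul, map_add]
      exact ⟨Polynomial.natDegree_mul_le_of_le hf.1 hg.1, by rw [Polynomial.coeff_mul_add_eq_of_natDegree_le hf.1 hg.1, hf.2, hg.2]⟩
    | single i e =>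
      have hd : (Polynomial.C (y i) + Polynomial.C (algebraMap K A (a i)) * Polynomial.X).natDegree ≤ 1 := by
        rw [add_comm]; exact Polynomial.natDegree_linear_le
      rw [← X_pow_eq_monomial, map_pow, map_pow, eval_X, map_pow, degree_single]
      simp only [φ, aeval_X]
      refine ⟨(Polynomial.natDegree_pow_le_of_le e hd).trans (by simp), ?_⟩
      have := Polynomial.coeff_pow_of_natDegree_le (m := e) hd
      rw [mul_one] at this
      simp [this]
  set e := P.totalDegree
  have hs : φ P = ∑ m ∈ P.support, Polynomial.C (algebraMap K A (coeff m P)) * φ (monomial m 1) := by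
    conv_lhs => rw [P.as_sum, map_sum]
    refine sum_congr rfl fun m _ => ?_
    rw [show monomial m (coeff m P) = (coeff m P) • monomial m (1 : K) by simp [smul_monomial], _root_.map_smul, Algebra.smul_def]; rfl
  have hdg : ∀ m ∈ P.support, m.degree ≤ e := fun m hm => le_totalDegree hm
  have hn : (φ P).natDegree ≤ e := by
    rw [hs]
    refine natDegree_sum_le_of_forall_le _ _ fun m hm => ?_
    exact (natDegree_C_mul_le _ _).trans ((h2 m).1.trans (hdg m hm))
  have hcf : (φ P).coeff e = algebraMap K A (eval a (homogeneousComponent e P)) := by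
    rw [hs, Polynomial.finsetSum_coeff, homogeneousComponent_apply, map_sum, map_sum, Finset.sum_filter]
    refine sum_congr rfl fun m hm => ?_
    rw [Polynomial.coeff_C_mul]
    split_ifs with h
    · rw [← h, (h2 m).2, ← map_mul]; simp [eval_monomial]
    · rw [Polynomial.coeff_eq_zero_of_natDegree_lt (lt_of_le_of_lt (h2 m).1 (lt_of_le_of_ne (hdg m hm) h)), mul_zero]
  set u := eval a (homogeneousComponent e P)
  refine ⟨Polynomial.C (algebraMap K A u⁻¹) * φ P, Polynomial.monic_of_natDegree_le_of_coeff_eq_one e ((natDegree_C_mul_le _ _).trans hn) ?_, ?_⟩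
  · rw [Polynomial.coeff_C_mul, hcf, ← map_mul, inv_mul_cancel₀ hP', map_one]
  · rw [← Polynomial.aeval_def, map_mul, h1, hP, mul_zero]
theorem int_tr {K S : Type} [Field K] [CommRing S] [Algebra K S] (A C : Subalgebra K S) (h : ∀ x ∈ C, IsIntegral A x) (f : S)
    (hf : IsIntegral C f) : IsIntegral A f := by
  obtain ⟨p, hp, h0⟩ := hf
  have h1 : IsIntegral (integralClosure A S) f := by
    let i : C →+* integralClosure A S := C.val.toRingHom.codRestrict _ fun x => h x x.2
    exact ⟨p.map i, hp.map i, by rw [Polynomial.eval₂_map]; exact h0⟩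
  exact isIntegral_trans f h1
theorem int_adj {K S ι : Type} [Field K] [CommRing S] [Algebra K S] (A : Subalgebra K S) (c : ι → S) (h : ∀ j, IsIntegral A (c j)) :
    ∀ x ∈ adjoin K (Set.range c), IsIntegral A x := by
  have : adjoin K (Set.range c) ≤ (integralClosure A S).restrictScalars K := Algebra.adjoin_le (by rintro _ ⟨j, rfl⟩; exact h j)
  exact fun x hx => this hx
theorem noeth_lin {K S E : Type} [Field K] [Infinite K] [CommRing S] [Algebra K S] [Fintype E] (g : E → S) (W : Submodule K S)
    (hW : ∀ x ∈ W, x ∈ adjoin K (Set.range g)) : ∀ (s : ℕ) (c : Fin s → S), (∀ j, c j ∈ W) → ∃ r ≤ Fintype.card E, ∃ c' : Fin r → S,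
      (∀ j, c' j ∈ W) ∧ ∀ x ∈ adjoin K (Set.range c), IsIntegral (adjoin K (Set.range c')) x := by
  intro s
  induction s with
  | zero => exact fun c hc => ⟨0, by simp, c, hc, fun x hx => isIntegral_algebraMap (x := (⟨x, hx⟩ : adjoin K (Set.range c)))⟩
  | succ s ih =>
    intro c hc
    by_cases hs : s + 1 ≤ Fintype.card E
    · exact ⟨_, hs, c, hc, fun x hx => isIntegral_algebraMap (x := (⟨x, hx⟩ : adjoin K (Set.range c)))⟩
    obtain ⟨P, h0, hP⟩ := alg_dep g c (fun j => hW _ (hc j)) (by omega)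
    have hH : homogeneousComponent P.totalDegree P ≠ 0 := by
      have hne : P.support.Nonempty := support_nonempty.2 h0
      obtain ⟨m, hm, hd⟩ := Finset.exists_mem_eq_sup P.support hne (fun m => m.sum fun _ e => e)
      intro h
      have := congr_arg (coeff m) h
      rw [coeff_homogeneousComponent, if_pos, coeff_zero] at this
      · exact mem_support_iff.1 hm this
      · rw [totalDegree, hd]; rfl
    obtain ⟨a, ha⟩ : ∃ a, eval a (homogeneousComponent P.totalDegree P * X (last s)) ≠ 0 := by
      by_contra! h
      exact (mul_ne_zero hH (X_ne_zero _)) (MvPolynomial.funext fun a => by rw [h, map_zero])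
    rw [map_mul, eval_X] at ha
    let l := last s
    have hal : a l ≠ 0 := right_ne_zero_of_mul ha
    let z : Fin s → S := fun j => c j.castSucc - (a j.castSucc / a l) • c l
    obtain ⟨r, hr, c', hc', hi⟩ := ih z fun j => W.sub_mem (hc _) (W.smul_mem _ (hc _))
    refine ⟨r, hr, c', hc', fun x hx => int_tr _ (adjoin K (Set.range z)) hi x ?_⟩
    let y : Fin (s + 1) → adjoin K (Set.range z) := lastCases 0 fun j => ⟨z j, subset_adjoin ⟨j, rfl⟩⟩
    have hcy : ∀ j, c j = y j + a j • ((a l)⁻¹ • c l) := by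
      refine lastCases ?_ fun j => ?_
      · simp only [y, Fin.lastCases_last]
        rw [smul_smul, mul_inv_cancel₀ hal]; simp [l]
      · simp only [y, Fin.lastCases_castSucc, z]
        rw [smul_smul, ← div_eq_mul_inv, sub_add_cancel]
    have ht := lin_int _ c y a _ hcy P hP (left_ne_zero_of_mul ha)
    refine int_adj _ c (fun j => ?_) x hx
    rw [hcy j]
    exact (isIntegral_algebraMap (x := y j)).add (ht.smul _)
theorem int_span {K S : Type} [Field K] [CommRing S] [Algebra K S] {r : ℕ} (c : Fin r → S) (f : S)
    (hf : IsIntegral (adjoin K (Set.range c)) f) : ∃ k : ℕ, ∀ q : ℕ, f ^ q ∈ Submodule.span K {x | ∃ ν : Fin r → ℕ, ∃ j ≤ k, x = (∏ i, c i ^ ν i) * f ^ j} := by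
  obtain ⟨p, hp, h0⟩ := hf
  rw [← Polynomial.aeval_def] at h0
  refine ⟨p.natDegree, fun q => ?_⟩
  have h1 : f ^ q = Polynomial.aeval f (Polynomial.X ^ q %ₘ p) := by
    rw [Polynomial.aeval_modByMonic_eq_self_of_root h0]; simp
  rw [h1, Polynomial.aeval_eq_sum_range' (lt_succ_of_le (Polynomial.natDegree_modByMonic_le _ hp))]
  refine Submodule.sum_mem _ fun j hj => ?_
  obtain ⟨a, ha⟩ := (Polynomial.X ^ q %ₘ p).coeff j
  rw [adjoin_range_eq_range_aeval] at ha
  obtain ⟨Q, hQ⟩ := ha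
  change a * f ^ j ∈ _
  rw [← hQ]
  change aeval c Q * _ ∈ _
  rw [aeval_def, eval₂_eq', Finset.sum_mul]
  refine Submodule.sum_mem _ fun ν _ => ?_
  rw [mul_assoc, ← Algebra.smul_def]
  exact smul_mem _ _ (subset_span ⟨ν, j, Nat.lt_succ_iff.1 (mem_range.1 hj), rfl⟩)
theorem ar1 {S N r q d j : ℕ} (h1 : S * N + j * d = q * d) (h2 : S ≤ r * q) (h3 : j * (r * N + 1) < q) (h4 : r * N < d) : False := by
  have a2 : j ≤ q := (le_mul_of_pos_right j (succ_pos (r * N))).trans h3.le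
  obtain ⟨t, rfl⟩ := exists_eq_add_of_le a2
  have a3 := Nat.mul_le_mul_right N h2
  have a4 := Nat.mul_le_mul_left t h4
  nlinarith
section PP
variable {Q0 Q1 : Type} {ta ha : Q1 → Q0} {α : Q0 → ℕ} {σ : Q0 → ℤ} [Fintype Q0] [DecidableEq Q0] {K : Type} [Field K] [Infinite K] [Fintype Q1]
theorem split_pow (p : ℕ) [Fact p.Prime] [CharP K p] [PerfectRing K p] (h : Q0 → ℕ) (hh : HTp) (E : ℕ) :
    ∃ φ : PK →+ PK,
    (∀ f y, φ (f ^ p ^ E * y) = f * φ y) ∧ φ 1 = 1 ∧ ∀ (χ : Q0 → ℤ) y, IsL (fun i => (p ^ E : ℕ) * χ i) y → IsL χ (φ y) := by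
  obtain ⟨φ, h1, h2, h3⟩ := split_exists (K := K) (α := α) (ta := ta) (ha := ha) p (fun e he => absurd (hh e) (by rw [he]; omega)) (fun i => (h i : ℤ)) (fun e => by exact_mod_cast hh e)
  induction E with
  | zero => exact ⟨AddMonoidHom.id _, by simp, rfl, fun χ y hy => hy.congr (by simp)⟩
  | succ E ih =>
    obtain ⟨ψ, g1, g2, g3⟩ := ih
    refine ⟨ψ.comp φ, fun f y => ?_, by simp [h2, g2], fun χ y hy => g3 _ _ (h3 _ _ (hy.congr ?_))⟩
    · rw [AddMonoidHom.comp_apply, pow_succ, pow_mul, h1, g1]; rfl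
    · ext i; push_cast; ring
theorem IsL.pd {R ι : Type} [CommRing R] {χ : Q0 → ℤ} {c : ι → PR} (hc : ∀ i, IsL χ (c i)) (ν : ι → ℕ) (s : Finset ι) :
    IsL ((∑ i ∈ s, ν i : ℕ) • χ) (∏ i ∈ s, c i ^ ν i) := by
  classical
  induction s using Finset.induction with
  | empty => simpa using IsL.C_ (1 : R)
  | insert a s ha ih => rw [prod_insert ha, sum_insert ha, add_smul]; exact (((hc a).pow _).congr (by simp)).mul ih
noncomputable def PS (K : Type) [Field K] (χ ψ : Q0 → ℤ) : Submodule K PK :=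
  Submodule.span K {x | ∃ a b, IsL χ a ∧ IsL ψ b ∧ x = a * b}
theorem IsL.xx {d N r : ℕ} {c : Fin r → PK} (hc : ∀ i, IsL fNσ (c i))
    {f : PK} (hf : IsL fdσ f) (ν : Fin r → ℕ) (j : ℕ) : IsL (fun x => ((∑ i, ν i : ℕ) * N + j * d : ℤ) * σ x) ((∏ i, c i ^ ν i) * f ^ j) :=
  ((IsL.pd hc ν univ).mul (hf.pow j)).congr (by ext x; simp; ring)
theorem key_int (i0 : Q0) (k0 : Fin (α i0)) (h0 : σ i0 ≠ 0) {d N r : ℕ} {c : Fin r → PK} (hc : ∀ i, IsL fNσ (c i))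
    {f : PK} (hf : IsL fdσ f) (hi : IsIntegral (adjoin K (Set.range c)) f) : ∃ k : ℕ, ∀ q : ℕ,
    f ^ q ∈ Submodule.span K {x | ∃ ν : Fin r → ℕ, ∃ j ≤ k, (∑ i, ν i) * N + j * d = q * d ∧ x = (∏ i, c i ^ ν i) * f ^ j} := by
  obtain ⟨k, hk⟩ := int_span c f hi
  have hx := IsL.xx hc hf
  refine ⟨k, fun q => ?_⟩
  let w : VV → ℤ := fun v => (if (⟨ta v.1, v.2.2⟩ : Σ i, Fai) = ⟨i0, k0⟩ then 1 else 0) - if (⟨ha v.1, v.2.1⟩ : Σ i, Fai) = ⟨i0, k0⟩ then 1 else 0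
  have hw : ∀ {χ : Q0 → ℤ} {g : PK}, IsL χ g → IsWeightedHomogeneous w g (χ i0) := fun hg m hm => by
    rw [← hg.1 m (mem_support_iff.2 hm) i0 k0, Finsupp.weight_apply, wtm]
    exact Finsupp.sum_congr fun v _ => by simp [w]
  let π := weightedHomogeneousComponent (R := K) w ((q : ℤ) * (d * σ i0))
  have e1 : π (f ^ q) = f ^ q := (hw ((hf.pow q).congr (χ' := fun x => (q : ℤ) * (d * σ x)) (by ext x; simp))).weightedHomogeneousComponent_same
  rw [← e1]
  have e2 := mem_map_of_mem (f := π) (hk q)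
  rw [Submodule.map_span] at e2
  refine span_le.2 ?_ e2
  rintro _ ⟨_, ⟨ν, j, hj, rfl⟩, rfl⟩
  have e3 := hw (hx ν j)
  by_cases hqd : (q : ℤ) * (d * σ i0) = ((∑ i, ν i : ℕ) * N + j * d : ℤ) * σ i0
  · rw [← hqd] at e3
    rw [mem_coe, show π _ = _ from e3.weightedHomogeneousComponent_same]
    refine subset_span ⟨ν, j, hj, ?_, rfl⟩
    rw [← mul_assoc] at hqd
    exact_mod_cast (mul_right_cancel₀ h0 hqd).symm
  · rw [mem_coe, show π _ = _ from e3.weightedHomogeneousComponent_ne _ hqd]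
    exact zero_mem _
theorem core_int (p : ℕ) [Fact p.Prime] [CharP K p] [PerfectRing K p] (h : Q0 → ℕ) (hh : HTp) (i0 : Q0) (k0 : Fin (α i0)) (h0 : σ i0 ≠ 0)
    (d N r : ℕ) (hd : r * N < d) (c : Fin r → PK) (hc : ∀ i, IsL fNσ (c i))
    (f : PK) (hf : IsL fdσ f) (hi : IsIntegral (adjoin K (Set.range c)) f) :
    f ∈ PS K fNσ fNd := by
  obtain ⟨k, key⟩ := key_int i0 k0 h0 hc hf hi
  have hx := IsL.xx hc hf
  let E := k * (r * N + 1)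
  have hq : E < p ^ E := Nat.lt_pow_self (Fact.out : p.Prime).one_lt
  obtain ⟨φ, h1, h2, h3⟩ := split_pow (K := K) (α := α) p h hh E
  set q := p ^ E
  have e4 : f = φ (C 1 * f ^ q) := by rw [C_1, one_mul, ← mul_one (f ^ q), h1, h2, mul_one]
  rw [e4]
  refine span_induction (p := fun z _ => ∀ s : K, φ (C s * z) ∈ PS K fNσ fNd) ?_ ?_ ?_ ?_ (key q) 1
  · rintro _ ⟨ν, j, hj, hν, rfl⟩ s
    obtain ⟨i, -, hi⟩ : ∃ i ∈ univ, q < ν i := by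
      apply Finset.exists_lt_of_sum_lt
      rw [sum_const, card_univ, card_fin, smul_eq_mul]
      by_contra! hcon
      have a1 : j * (r * N + 1) < q := lt_of_le_of_lt (Nat.mul_le_mul_right _ hj) hq
      exact ar1 hν hcon a1 hd
    obtain ⟨t, ht⟩ := exists_eq_add_of_le hi.le
    have e5 : ∏ i, c i ^ ν i = c i ^ q * ∏ l, c l ^ (update ν i t) l := by
      rw [← mul_prod_erase _ _ (mem_univ i), ← mul_prod_erase _ (fun l => c l ^ (update ν i t) l) (mem_univ i), ht, pow_add, update_self, mul_assoc]
      congr 2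
      exact prod_congr rfl fun l hl => by rw [update_of_ne (ne_of_mem_erase hl)]
    have e6 : ∑ i, ν i = q + ∑ l, update ν i t l := by
      rw [← add_sum_erase _ _ (mem_univ i), ← add_sum_erase _ (update ν i t) (mem_univ i), ht, update_self, add_assoc]
      congr 2
      exact sum_congr rfl fun l hl => by rw [update_of_ne (ne_of_mem_erase hl)]
    rw [e5, mul_assoc, mul_left_comm, h1]
    refine subset_span ⟨_, _, hc i, h3 _ _ (((hx (update ν i t) j).smul s).congr ?_), rfl⟩
    ext x
    rw [e6] at hν
    zify at hν
    rw [← mul_assoc]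
    push_cast
    congr 1
    linarith
  · simp
  · intro a b _ _ h1 h2 s
    rw [mul_add, map_add]; exact add_mem (h1 s) (h2 s)
  · intro a b _ h1 s
    rw [smul_eq_C_mul, ← mul_assoc, ← C_mul]; exact h1 _
theorem XX_adj [Fintype (Kp ta ha σ)] (e : Cc α (-σ) ≃ Cc α σ) (μ) : cc K e μ ∈ adjoin K
    (Set.range fun t : Kp ta ha σ × Cc α (-σ) × Cc α σ => XX (X : VV → PK) t.1 t.2.1 t.2.2) :=
  GG_adjoin e _ μ
theorem core_fam (h : Q0 → ℕ) (hh : HTp) [Fintype (Kp ta ha σ)] (e : Cc α (-σ) ≃ Cc α σ)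
    (N : ℕ) (hN : N = Fintype.card (Cc α σ)) (hN0 : 0 < N) (d : ℕ) (hd : 0 < d) (f : PK) (hf : IsL fdσ f) :
    ∃ r ≤ Fintype.card (Kp ta ha σ) * (N * N), ∃ c : Fin r → PK, (∀ i, IsL fNσ (c i)) ∧ IsIntegral (adjoin K (Set.range c)) f := by
  let gg := GG e (Fin (Fintype.card (Cc α σ))) (XX (X : VV → PK) (σ := σ))
  let c0 : gg.support → PK := fun μ => cc K e μ
  let ε := equivFin gg.support
  have hc0 : ∀ μ, IsL fNσ (c0 μ) := fun μ => hN ▸ cc_isL e μ.1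
  have hi := integ h hh d hd f hf N hN0 (c0 ∘ ε.symm) (fun j => hc0 _) (fun k _ _ _ v hv => by
    obtain ⟨μ, hμ⟩ := cc_ne (K := K) e (hN ▸ hN0) v hv
    have h1 : μ ∈ gg.support := mem_support_iff.2 fun h0 => hμ (by rw [show cc K e μ = 0 from h0, map_zero])
    exact ⟨ε ⟨μ, h1⟩, by simpa [c0] using hμ⟩)
  let W : Submodule K PK :=
    { carrier := {x | IsL fNσ x}, add_mem' := fun a b => a.add b, zero_mem' := IsL.zero, smul_mem' := fun s x hx => by rw [smul_eq_C_mul]; exact IsL.smul s hx }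
  let g := fun t : Kp ta ha σ × Cc α (-σ) × Cc α σ => XX (X : VV → PK) t.1 t.2.1 t.2.2
  obtain ⟨r, hr, c', hc', hi'⟩ := noeth_lin g (W ⊓ (adjoin K (Set.range g)).toSubmodule) (fun x hx => hx.2) _ (c0 ∘ ε.symm)
    fun j => ⟨hc0 _, XX_adj e _⟩
  rw [card_prod, card_prod, card_congr e, ← hN] at hr
  exact ⟨r, hr, c', fun i => (hc' i).1, int_tr _ _ hi' f hi⟩
theorem exz (hN0 : 0 < Fintype.card (Cc α σ)) : ∃ i0, σ i0 ≠ 0 ∧ Nonempty (Fin (α i0)) := by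
  obtain ⟨z⟩ := Fintype.card_pos_iff.1 hN0
  exact ⟨z.1.1, fun hz => by have := z.1.2.2; simp [hz] at this, ⟨z.2⟩⟩
theorem core_0 (h : Q0 → ℕ) (hh : HTp) [Fintype (Kp ta ha σ)] (e : Cc α (-σ) ≃ Cc α σ)
    (hN0 : 0 < Fintype.card (Cc α σ)) (hK : Fintype.card (Kp ta ha σ) = 0) (d : ℕ) (hd : 0 < d) (f : PK) (hf : IsL fdσ f) : f = 0 := by
  obtain ⟨i0, h0, ⟨k0⟩⟩ := exz hN0
  obtain ⟨r, hr, c, hc, hi⟩ := core_fam h hh e _ rfl hN0 d hd f hf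
  obtain rfl : r = 0 := by simpa [hK] using hr
  obtain ⟨k, hk⟩ := key_int i0 k0 h0 hc hf hi
  refine pow_eq_zero_iff (Nat.succ_ne_zero k) |>.1 ((Submodule.span_eq_bot.2 ?_).le (hk (k + 1)))
  rintro x ⟨ν, j, hj, hν, -⟩
  simp only [Finset.univ_eq_empty, Finset.sum_empty, zero_mul, zero_add] at hν
  have := Nat.eq_of_mul_eq_mul_right hd hν
  omega
theorem core_p (p : ℕ) [Fact p.Prime] [CharP K p] [PerfectRing K p] (h : Q0 → ℕ) (hh : HTp) [Fintype (Kp ta ha σ)] (e : Cc α (-σ) ≃ Cc α σ)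
    (N : ℕ) (hN : N = Fintype.card (Cc α σ)) (hN0 : 0 < N) (d : ℕ) (hd : Fintype.card (Kp ta ha σ) * N ^ 3 < d) (f : PK) (hf : IsL fdσ f) :
    f ∈ PS K fNσ fNd := by
  obtain ⟨i0, h0, ⟨k0⟩⟩ := exz (hN ▸ hN0)
  obtain ⟨r, hr, c, hc, hi⟩ := core_fam h hh e N hN hN0 d (by omega) f hf
  refine core_int p h hh i0 k0 h0 d N r (lt_of_le_of_lt ?_ hd) c hc f hf hi
  nlinarith [Nat.mul_le_mul_right N hr]
end PP
theorem lin_alg {R M : Type} [Fintype M] [DecidableEq M] (Z : R → M → ℤ) : ∃ t : ℤ, t ≠ 0 ∧ ∃ h : M → M → ℤ,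
    (∀ m, h m ∈ Submodule.span ℤ (Set.range Z)) ∧ ∀ r m', t * Z r m' = ∑ m, Z r m * h m m' := by
  let c : (M → ℤ) → M → ℚ := fun v m => v m
  let U := Submodule.span ℚ (Set.range fun r => c (Z r))
  obtain ⟨π, hπ⟩ := exists_leftInverse_of_injective U.subtype (ker_eq_bot.2 val_injective)
  have h1 : ∀ g ∈ U, ∃ t : ℤ, t ≠ 0 ∧ ∃ h ∈ Submodule.span ℤ (Set.range Z), (t : ℚ) • g = c h := by
    intro g hg
    induction hg using span_induction with
    | mem x hx => obtain ⟨r, rfl⟩ := hx; exact ⟨1, one_ne_zero, Z r, subset_span ⟨r, rfl⟩, by simp⟩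
    | zero => exact ⟨1, one_ne_zero, 0, zero_mem _, by ext; simp [c]⟩
    | add x y _ _ hx hy =>
      obtain ⟨t, ht, h, hh, e⟩ := hx
      obtain ⟨s, hs, k, hk, e'⟩ := hy
      refine ⟨t * s, mul_ne_zero ht hs, s • h + t • k, add_mem (smul_mem _ _ hh) (smul_mem _ _ hk), ?_⟩
      ext m
      have e1 := congrFun e m
      have e2 := congrFun e' m
      simp only [c, Pi.smul_apply, smul_eq_mul, Pi.add_apply] at e1 e2 ⊢
      push_cast; rw [← e1, ← e2]; ring
    | smul a x _ hx =>
      obtain ⟨t, ht, h, hh, e⟩ := hx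
      refine ⟨a.den * t, mul_ne_zero (by exact_mod_cast a.den_nz) ht, a.num • h, smul_mem _ _ hh, ?_⟩
      ext m
      have e1 := congrFun e m
      simp only [c, Pi.smul_apply, smul_eq_mul] at e1 ⊢
      push_cast; rw [← e1]; nth_rw 2 [← Rat.num_div_den a]
      have : (a.den : ℚ) ≠ 0 := by exact_mod_cast a.den_nz
      field_simp
  choose t ht h hh e using fun m : M => h1 (π (Pi.single m 1)) (π (Pi.single m 1)).2
  refine ⟨∏ m, t m, prod_ne_zero_iff.2 fun m _ => ht m, fun m => (∏ l ∈ univ.erase m, t l) • h m, fun m => smul_mem _ _ (hh m), fun r m' => ?_⟩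
  have e2 : c (Z r) = ∑ m, (Z r m : ℚ) • (π (Pi.single m 1) : M → ℚ) := by
    have e3 : c (Z r) ∈ U := subset_span ⟨r, rfl⟩
    have e4 := congr_arg Subtype.val (LinearMap.congr_fun hπ ⟨_, e3⟩)
    change (π (c (Z r)) : M → ℚ) = c (Z r) at e4
    conv_lhs => rw [← e4, pi_eq_sum_univ' (c (Z r)), map_sum]
    simp [c, Pi.single_apply, Pi.single, update_apply]
  have e5 := congrFun e2 m'
  simp only [c, Finset.sum_apply, Pi.smul_apply, smul_eq_mul] at e5
  have : ((∏ m, t m : ℤ) : ℚ) * Z r m' = ∑ m, (Z r m : ℚ) * (((∏ l ∈ univ.erase m, t l : ℤ) : ℚ) * h m m') := by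
    rw [e5, Finset.mul_sum]
    refine sum_congr rfl fun m _ => ?_
    have := congrFun (e m) m'
    simp only [c, Pi.smul_apply, smul_eq_mul] at this
    rw [← this, ← mul_prod_erase _ _ (mem_univ m)]
    push_cast; ring
  exact_mod_cast this
section KK
variable {Q0 Q1 : Type} {ta ha : Q1 → Q0} {α : Q0 → ℕ} {σ : Q0 → ℤ} [DecidableEq Q0]
abbrev Mw (ta ha : Q1 → Q0) (α : Q0 → ℕ) (χ : Q0 → ℤ) := {m : VV →₀ ℕ // ∀ i k, wtm m i k = χ i}
theorem Mw_fin [Fintype Q0] [Fintype Q1] (h : Q0 → ℕ) (hh : HTp) (χ : Q0 → ℤ) : Finite (Mw ta ha α χ) := by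
  have h1 : ∀ m : VV →₀ ℕ, (m.degree : ℤ) ≤ -∑ x : (Σ i, Fai), (h x.1 : ℤ) * wtm m x.1 x.2 := by
    intro m
    induction m using induction_linear with
    | zero => simp [wtm_zero]
    | add f g hf hg => simp only [wtm_add, mul_add, sum_add_distrib, map_add]; push_cast; linarith
    | single p e =>
      have w1 : ∀ i k, wtm (Finsupp.single p e) i k = _ := fun i k => sum_single_index (by simp)
      simp only [w1, degree_single, Sigma.eta, mul_sub, sum_sub_distrib, mul_ite, mul_one, mul_zero, sum_ite_eq, mem_univ, if_true]
      have : (h (ta p.1) : ℤ) + 1 ≤ h (ha p.1) := by exact_mod_cast hh p.1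
      nlinarith
  refine Set.Finite.to_subtype (Set.Finite.subset (Finsupp.finite_of_degree_le (-∑ x : (Σ i, Fai), (h x.1 : ℤ) * χ x.1).toNat) fun m hm => ?_)
  have := h1 m
  rw [sum_congr rfl fun x _ => by rw [hm x.1 x.2]] at this
  change m.degree ≤ _
  omega
abbrev Rw (ta ha : Q1 → Q0) (α : Q0 → ℕ) := {x : (Σ i, Fai × Fai) × ℕ × (VV →₀ ℕ) // x.1.2.1 ≠ x.1.2.2}
noncomputable def ZF (R : Type) [CommRing R] (r : Rw ta ha α) : PR →ₗ[R] R where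
  toFun f := coeff r.1.2.2 ((aeval (tvX R r.1.1.1 r.1.1.2.1 r.1.1.2.2) f - Polynomial.C f).coeff r.1.2.1)
  map_add' f g := by simp only [map_add, Polynomial.coeff_sub, Polynomial.coeff_add, coeff_sub, coeff_add]; ring
  map_smul' s f := by
    rw [_root_.map_smul, show Polynomial.C (s • f) = s • Polynomial.C f from (Polynomial.smul_C _ _).symm, ← smul_sub, Polynomial.coeff_smul, coeff_smul]; rfl
theorem ZF_apply {R : Type} [CommRing R] (r : Rw ta ha α) (f : PR) :
    ZF R r f = coeff r.1.2.2 ((aeval (tvX R r.1.1.1 r.1.1.2.1 r.1.1.2.2) f - Polynomial.C f).coeff r.1.2.1) := rfl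
theorem isL_ZF {R : Type} [CommRing R] {χ : Q0 → ℤ} {f : PR} :
    IsL χ f ↔ (∀ m ∈ f.support, ∀ i k, wtm m i k = χ i) ∧ ∀ r, ZF R r f = 0 := by
  refine and_congr_right fun _ => ⟨fun h r => ?_, fun h i k l hkl => ?_⟩
  · rw [ZF_apply, h _ _ _ r.2, sub_self]; rfl
  · rw [← sub_eq_zero]
    ext j m
    exact h ⟨⟨⟨i, k, l⟩, j, m⟩, hkl⟩
theorem ZF_map {R : Type} [CommRing R] (r : Rw ta ha α) (g : MvPolynomial VV ℤ) :
    ZF R r (map (castRingHom R) g) = (ZF ℤ r g : R) := by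
  rw [ZF_apply, ZF_apply, ← eq_intCast (castRingHom R), ← coeff_map, ← Polynomial.coeff_map]
  congr 2
  rw [Polynomial.map_sub, Polynomial.map_C]
  congr 1
  have h := tva_map (Polynomial.mapRingHom (map (σ := VV) (castRingHom R))) r.1.1.1 r.1.1.2.1 r.1.1.2.2 Polynomial.X (fun p => Polynomial.C (X p))
  simp only [Polynomial.coe_mapRingHom, Polynomial.map_X, Polynomial.map_C, map_X] at h
  rw [tvX, ← h]
  induction g using MvPolynomial.induction_on with
  | C a => simp [Polynomial.algebraMap_apply, algebraMap_eq]
  | add p q hp hq => simp only [map_add, hp, hq, Polynomial.map_add]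
  | mul_X p v hp => simp only [map_mul, hp, Polynomial.map_mul, map_X, aeval_X]
theorem sup_sum {R : Type} [CommRing R] {χ : Q0 → ℤ} [Fintype (Mw ta ha α χ)] {f : PR} (hf : ∀ m ∈ f.support, ∀ i k, wtm m i k = χ i) :
    ∑ m : Mw ta ha α χ, monomial m.1 (coeff m.1 f) = f := by
  classical
  ext m
  rw [coeff_sum]
  simp only [coeff_monomial]
  by_cases hm : ∀ i k, wtm m i k = χ i
  · rw [sum_eq_single ⟨m, hm⟩] <;> simp +contextual [Subtype.ext_iff]
  · rw [sum_eq_zero fun x _ => if_neg fun h : x.1 = m => hm (h ▸ x.2)]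
    by_contra h
    exact hm (hf m (mem_support_iff.2 (Ne.symm h)))
theorem ZF_sum {R : Type} [CommRing R] {χ : Q0 → ℤ} [Fintype (Mw ta ha α χ)] (r : Rw ta ha α) (v : Mw ta ha α χ → R) :
    ZF R r (∑ m, monomial m.1 (v m)) = ∑ m, v m * (ZF ℤ r (monomial m.1 1) : R) := by
  rw [map_sum]
  refine sum_congr rfl fun m _ => ?_
  rw [← ZF_map, map_monomial, map_one, ← smul_eq_mul, ← _root_.map_smul, smul_monomial, smul_eq_mul, mul_one]
theorem ker_b {χ : Q0 → ℤ} [Fintype (Mw ta ha α χ)] : ∃ t : ℤ, t ≠ 0 ∧ ∃ b : Mw ta ha α χ → MvPolynomial VV ℤ, (∀ m, IsL χ (b m)) ∧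
    ∀ (F : Type) [Field F] (f : MvPolynomial VV F), IsL χ f → C (t : F) * f = ∑ m, C (coeff m.1 f) * map (castRingHom F) (b m) := by
  classical
  obtain ⟨t, ht, h, hh, e⟩ := lin_alg fun (r : Rw ta ha α) (m : Mw ta ha α χ) => ZF ℤ r (monomial m.1 1)
  let b : Mw ta ha α χ → Mw ta ha α χ → ℤ := fun m' m => (if m = m' then t else 0) - h m m'
  refine ⟨t, ht, fun m' => ∑ m, monomial m.1 (b m' m), fun m' => isL_ZF.2 ⟨fun m hm => ?_, fun r => ?_⟩, fun F _ f hf => ?_⟩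
  · obtain ⟨x, -, hx⟩ := Finset.mem_biUnion.1 (support_sum hm)
    rw [Finset.mem_singleton.1 (support_monomial_subset hx)]; exact x.2
  · rw [ZF_sum]
    simp only [b, sub_mul, ite_mul, zero_mul, sum_sub_distrib, sum_ite_eq', mem_univ, if_true, Int.cast_id]
    rw [e r m', sub_eq_zero]
    exact sum_congr rfl fun _ _ => mul_comm _ _
  · obtain ⟨h1, h2⟩ := isL_ZF.1 hf
    have h3 : ∀ g ∈ Submodule.span ℤ (Set.range fun (r : Rw ta ha α) (m : Mw ta ha α χ) => ZF ℤ r (monomial m.1 1)), ∑ m, coeff m.1 f * (g m : F) = 0 := by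
      intro g hg
      induction hg using span_induction with
      | mem x hx => obtain ⟨r, rfl⟩ := hx; rw [← ZF_sum, sup_sum h1, h2]
      | zero => simp
      | add x y _ _ hx hy => simp only [Pi.add_apply, Int.cast_add, mul_add, sum_add_distrib, hx, hy, add_zero]
      | smul a x _ hx => simp only [Pi.smul_apply, smul_eq_mul, Int.cast_mul, mul_left_comm _ (a : F), ← Finset.mul_sum, hx, mul_zero]
    conv_lhs => rw [← sup_sum h1, Finset.mul_sum]
    simp only [map_sum, Finset.mul_sum, map_monomial, C_mul_monomial]
    rw [sum_comm]
    refine sum_congr rfl fun m _ => ?_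
    rw [← map_sum]
    congr 1
    simp only [b, map_sub, mul_sub, sum_sub_distrib, apply_ite (castRingHom F), map_zero, mul_ite, mul_zero, sum_ite_eq, mem_univ, if_true, eq_intCast]
    rw [h3 _ (hh m), sub_zero, mul_comm]
end KK
section TT
variable {Q0 Q1 : Type} {ta ha : Q1 → Q0} {α : Q0 → ℕ} {σ : Q0 → ℤ} [DecidableEq Q0]
theorem IsL.mapZ {χ : Q0 → ℤ} {g : MvPolynomial VV ℤ} (hg : IsL χ g) (R : Type) [CommRing R] : IsL χ (map (castRingHom R) g) := by
  rw [isL_ZF] at hg ⊢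
  exact ⟨fun m hm => hg.1 m (support_map_subset _ _ hm), fun r => by rw [ZF_map, hg.2, cast_zero]⟩
theorem PS_mul {K : Type} [Field K] {χ ψ : Q0 → ℤ} {f : PK} (t : K) (ht : t ≠ 0) (h : C t * f ∈ PS K χ ψ) : f ∈ PS K χ ψ := by
  have := (PS K χ ψ).smul_mem t⁻¹ h
  rwa [smul_eq_C_mul, ← mul_assoc, ← C_mul, inv_mul_cancel₀ ht, C_1, one_mul] at this
theorem cast_ne {p : ℕ} {k : Type} [Field k] [CharP k p] {t : ℤ} (ht : t ≠ 0) (h : t.natAbs < p) : (t : k) ≠ 0 := by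
  rw [Ne, CharP.intCast_eq_zero_iff k p]
  intro hd
  exact absurd (Nat.le_of_dvd (natAbs_pos.2 ht) (Int.natCast_dvd.1 hd)) (by omega)
theorem transfer [Fintype Q0] [Fintype Q1] (h : Q0 → ℕ) (hh : HTp) (K : Type) [Field K] [CharZero K] (χ ψ ω : Q0 → ℤ) (hω : χ + ψ = ω)
    (H : ∀ (p : ℕ) [Fact p.Prime] (f : MvPolynomial VV (AlgebraicClosure (ZMod p))), IsL ω f → f ∈ PS _ χ ψ)
    (f : PK) (hf : IsL ω f) : f ∈ PS K χ ψ := by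
  classical
  have i1 := Mw_fin (α := α) h hh χ
  have i2 := Mw_fin (α := α) h hh ψ
  have i3 := Mw_fin (α := α) h hh ω
  have j1 := ofFinite (Mw ta ha α χ)
  have j2 := ofFinite (Mw ta ha α ψ)
  have j3 := ofFinite (Mw ta ha α ω)
  obtain ⟨t1, ht1, b1, hb1, hs1⟩ := ker_b (ta := ta) (ha := ha) (α := α) (χ := χ)
  obtain ⟨t2, ht2, b2, hb2, hs2⟩ := ker_b (ta := ta) (ha := ha) (α := α) (χ := ψ)
  obtain ⟨t3, ht3, b3, hb3, hs3⟩ := ker_b (ta := ta) (ha := ha) (α := α) (χ := ω)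
  let D : Mw ta ha α χ × Mw ta ha α ψ → MvPolynomial VV ℤ := fun r => b1 r.1 * b2 r.2
  have hD : ∀ r, IsL ω (D r) := fun r => ((hb1 r.1).mul (hb2 r.2)).congr hω
  obtain ⟨t, ht, g, hg, e⟩ := lin_alg fun r (m : Mw ta ha α ω) => coeff m.1 (D r)
  have key : ∀ n m', t * coeff m'.1 (b3 n) = ∑ m, coeff m.1 (b3 n) * g m m' := by
    intro n m'
    by_contra hδ
    rw [← sub_eq_zero] at hδ
    obtain ⟨p, hpl, hp⟩ := Nat.exists_infinite_primes (t1.natAbs + t2.natAbs + (t * coeff m'.1 (b3 n) - ∑ m, coeff m.1 (b3 n) * g m m').natAbs + 1)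
    have : Fact p.Prime := ⟨hp⟩
    obtain ⟨k, _, _, H⟩ : ∃ (k : Type) (_ : Field k) (_ : CharP k p), ∀ f : MvPolynomial VV k, IsL ω f → f ∈ PS k χ ψ := ⟨_, _, inferInstance, H p⟩
    let l : MvPolynomial VV k →ₗ[k] k := (t : k) • lcoeff k m'.1 - ∑ m : Mw ta ha α ω, (g m m' : k) • lcoeff k m.1
    have hl : ∀ x : MvPolynomial VV ℤ, l (map (castRingHom k) x) = ((t * coeff m'.1 x - ∑ m : Mw ta ha α ω, coeff m.1 x * g m m' : ℤ) : k) := fun x => by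
      simp only [l, LinearMap.sub_apply, LinearMap.smul_apply, LinearMap.sum_apply, lcoeff_apply, coeff_map, smul_eq_mul, eq_intCast]
      push_cast
      simp only [mul_comm]
    refine cast_ne (p := p) (k := k) hδ (by omega) ?_
    rw [← hl]
    refine span_induction (p := fun x _ => l x = 0) ?_ (map_zero _) (fun x y _ _ hx hy => by rw [map_add, hx, hy, add_zero]) (fun a x _ hx => by rw [_root_.map_smul, hx, smul_zero]) (H _ ((hb3 n).mapZ k))
    rintro _ ⟨a, b, ha, hb, rfl⟩
    have c1 : ((t1 : k) * t2) * l (a * b) = 0 := by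
      rw [← smul_eq_mul, ← _root_.map_smul, smul_eq_C_mul, C_mul, mul_mul_mul_comm, hs1 k a ha, hs2 k b hb, Finset.sum_mul_sum, map_sum]
      refine sum_eq_zero fun i _ => ?_
      rw [map_sum]
      refine sum_eq_zero fun j _ => ?_
      rw [mul_mul_mul_comm, ← C_mul, ← map_mul, ← smul_eq_C_mul, _root_.map_smul, hl, e (i, j) m', sub_self, cast_zero, smul_zero]
    exact (mul_eq_zero.1 c1).resolve_left (mul_ne_zero (cast_ne (p := p) ht1 (by omega)) (cast_ne (p := p) ht2 (by omega)))
  let rc : (Mw ta ha α ω → ℤ) → PK := fun v => ∑ m, monomial m.1 (v m : K)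
  have hrc : ∀ v ∈ Submodule.span ℤ (Set.range fun r (m : Mw ta ha α ω) => coeff m.1 (D r)), rc v ∈ PS K χ ψ := by
    intro v hv
    induction hv using span_induction with
    | mem x hx =>
      obtain ⟨r, rfl⟩ := hx
      have := sup_sum ((hD r).mapZ K).1
      simp only [coeff_map, eq_intCast] at this
      change ∑ m : Mw ta ha α ω, monomial m.1 ((coeff m.1 (D r) : ℤ) : K) ∈ _
      rw [this, map_mul]
      exact subset_span ⟨_, _, (hb1 r.1).mapZ K, (hb2 r.2).mapZ K, rfl⟩
    | zero => simp [rc]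
    | add x y _ _ hx hy => simpa [rc, sum_add_distrib] using add_mem hx hy
    | smul a x _ hx =>
      have := (PS K χ ψ).smul_mem (a : K) hx
      simpa [rc, smul_sum, smul_monomial] using this
  refine PS_mul (t3 : K) (by exact_mod_cast ht3) ?_
  rw [hs3 K f hf]
  refine Submodule.sum_mem _ fun n _ => ?_
  rw [← smul_eq_C_mul]
  refine smul_mem _ _ (PS_mul (t : K) (by exact_mod_cast ht) ?_)
  have e7 : C (t : K) * map (castRingHom K) (b3 n) = ∑ m : Mw ta ha α ω, ((coeff m.1 (b3 n) : ℤ) : K) • rc (g m) := by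
    conv_lhs => rw [← sup_sum ((hb3 n).mapZ K).1, Finset.mul_sum]
    simp only [rc, smul_sum]
    rw [sum_comm]
    refine sum_congr rfl fun m' _ => ?_
    simp only [smul_monomial, C_mul_monomial, coeff_map, eq_intCast, smul_eq_mul]
    rw [← map_sum]
    congr 1
    exact_mod_cast key n m'
  rw [e7]
  exact Submodule.sum_mem _ fun m _ => smul_mem _ _ (hrc _ (hg m))
theorem core [Fintype Q0] [Fintype Q1] {K : Type} [Field K] [IsAlgClosed K] (h : Q0 → ℕ) (hh : HTp) [Fintype (Kp ta ha σ)] (e : Cc α (-σ) ≃ Cc α σ)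
    (N : ℕ) (hN : N = Fintype.card (Cc α σ)) (hN0 : 0 < N) (d : ℕ) (hd : Fintype.card (Kp ta ha σ) * N ^ 3 < d) (f : PK) (hf : IsL fdσ f) :
    f ∈ PS K fNσ fNd := by
  have : Infinite K := instInfinite
  obtain ⟨p, hp⟩ := CharP.exists K
  rcases CharP.char_is_prime_or_zero K p with hp' | rfl
  · have : Fact p.Prime := ⟨hp'⟩
    exact core_p p h hh e N hN hN0 d hd f hf
  · have := CharP.charP_to_charZero K
    exact transfer h hh K _ _ _ (by ext x; simp only [Pi.add_apply]; ring) (fun p _ f hf => core_p p h hh e N hN hN0 d hd f hf) f hf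
end TT
section FF
variable {Q0 Q1 : Type} {ta ha : Q1 → Q0} {α : Q0 → ℕ} {σ : Q0 → ℤ} [DecidableEq Q0]
theorem wtm_tot [Fintype Q0] (m : VV →₀ ℕ) : ∑ x : (Σ i, Fai), wtm m x.1 x.2 = 0 := by
  induction m using induction_linear with
  | zero => simp [wtm_zero]
  | add f g hf hg => simp only [wtm_add, sum_add_distrib]; linarith
  | single p e =>
    have w1 : ∀ i k, wtm (Finsupp.single p e) i k = _ := fun i k => sum_single_index (by simp)
    simp only [w1, Sigma.eta, mul_sub, sum_sub_distrib, mul_ite, mul_one, mul_zero, sum_ite_eq, mem_univ, if_true, sub_self]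
theorem final_ind [Fintype Q0] [Fintype Q1] {K : Type} [Field K] [IsAlgClosed K] (hQ : HasNoOrientedCycles ta ha)
    (n : ℚ) (hn : n = (1 / 2 : ℚ) * ∑ i : Q0, (|σ i| : ℚ) * (α i : ℚ)) (m : ℕ)
    (hm : m = ∑ x : Q0, ∑ y : Q0, (σ x).toNat * numQuiverPaths ta ha x y * (-(σ y)).toNat)
    (A : Subalgebra K PK)
    (hA : ∀ (d : ℕ) (f : PK), (d : ℚ) ≤ (m : ℚ) * n ^ 3 → IsL (fun i => (d : ℤ) * σ i) f → f ∈ A) (d : ℕ) :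
    ∀ f : PK, IsL (fun i => (d : ℤ) * σ i) f → f ∈ A := by
  have hK : Infinite K := instInfinite
  obtain ⟨h, hh⟩ := height_exists hQ
  have := path_finite (ta := ta) (ha := ha) h hh
  have : Finite (Kp ta ha σ) := by unfold Kp; infer_instance
  have : Fintype (Kp ta ha σ) := ofFinite _
  have hn0 : 0 ≤ n := by rw [hn]; positivity
  have hb0 : 0 ≤ (m : ℚ) * n ^ 3 := by positivity
  induction d using Nat.strong_induction_on with
  | _ d ih =>
  intro f hf
  by_cases hd : (d : ℚ) ≤ m * n ^ 3
  · exact hA d f hd hf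
  push Not at hd
  have hd0 : 0 < d := by
    have : (0 : ℚ) < d := lt_of_le_of_lt hb0 hd
    exact_mod_cast this
  by_cases hs : ∑ i, σ i * α i = 0
  · have c1 := card_Cc (α := α) (σ := σ)
    have c2 := card_Cc (α := α) (σ := -σ)
    have ce : Fintype.card (Cc α (-σ)) = Fintype.card (Cc α σ) := by
      rw [c1, c2]
      zify
      rw [← sub_eq_zero, ← sum_sub_distrib, ← neg_eq_zero, ← hs, ← sum_neg_distrib]
      refine sum_congr rfl fun i _ => ?_
      have : ((σ i).toNat : ℤ) - ((-σ) i).toNat = σ i := by simp only [Pi.neg_apply]; omega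
      linear_combination α i * this
    have hnN : n = Fintype.card (Cc α σ) := by
      have : ((Fintype.card (Cc α σ) : ℚ) + Fintype.card (Cc α (-σ))) = ∑ i : Q0, (|σ i| : ℚ) * (α i : ℚ) := by
        rw [c1, c2]
        push_cast
        rw [← sum_add_distrib]
        refine sum_congr rfl fun i _ => ?_
        have : ((σ i).toNat : ℤ) + ((-σ) i).toNat = |σ i| := by
          simp only [Pi.neg_apply]
          rcases abs_cases (σ i) with h | h <;> omega
        have : ((σ i).toNat : ℚ) + ((-σ) i).toNat = |(σ i : ℚ)| := by exact_mod_cast this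
        rw [← this]; ring
      rw [hn, ← this, ce]; ring
    have hmK : m = Fintype.card (Kp ta ha σ) := by rw [hm, card_Kp h hh]
    have e : Cc α (-σ) ≃ Cc α σ := equivOfCardEq ce
    generalize hN : Fintype.card (Cc α σ) = N at *
    subst hnN
    rcases Nat.eq_zero_or_pos N with h0 | h0
    · refine hA 0 f (by simpa using hb0) ⟨fun t ht i k => ?_, hf.2⟩
      rw [hf.1 t ht i k]
      have hα : 0 < α i := k.pos
      have z1 : (σ i).toNat * α i = 0 := sum_eq_zero_iff.1 (c1.symm.trans h0) i (mem_univ i)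
      have z2 : ((-σ) i).toNat * α i = 0 := sum_eq_zero_iff.1 (c2.symm.trans (ce.trans h0)) i (mem_univ i)
      simp only [Pi.neg_apply, mul_eq_zero, hα.ne', or_false] at z1 z2
      have : σ i = 0 := by omega
      simp [this]
    rcases Nat.eq_zero_or_pos m with hm0 | hm0
    · rw [core_0 h hh e (by omega) (by omega) d hd0 f hf]
      exact A.zero_mem
    have hd' : m * N ^ 3 < d := by exact_mod_cast hd
    have hNm : N ≤ m * N ^ 3 := (Nat.le_self_pow (by norm_num) N).trans (Nat.le_mul_of_pos_left _ hm0)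
    have := core h hh e N hN.symm h0 d (by rw [← hmK]; exact hd') f hf
    refine (span_le (p := Subalgebra.toSubmodule A)).2 ?_ this
    rintro x ⟨a, b, ha, hb, rfl⟩
    refine A.mul_mem (hA N a (by exact_mod_cast hNm) ha) (ih (d - N) (by omega) b ?_)
    rw [Nat.cast_sub (by omega)]
    exact hb
  · have : f = 0 := by
      by_contra h0
      obtain ⟨t, ht⟩ := Finset.nonempty_iff_ne_empty.2 (mt support_eq_empty.1 h0)
      have h1 := wtm_tot t
      rw [sum_congr rfl (fun x _ => hf.1 t ht x.1 x.2), sum_sigma] at h1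
      simp only [sum_const, card_univ, card_fin, nsmul_eq_mul] at h1
      have h2 : (d : ℤ) * ∑ i, σ i * α i = 0 := by
        rw [← h1, Finset.mul_sum]; exact sum_congr rfl fun i _ => by ring
      rcases mul_eq_zero.1 h2 with h3 | h3
      · omega
      · exact hs h3
    rw [this]; exact A.zero_mem
end FF

theorem stmt_5 (K : Type) [Field K] [IsAlgClosed K] {Q0 Q1 : Type} [Fintype Q0] [Fintype Q1]
    (ta ha : Q1 → Q0) (α : Q0 → ℕ) (σ : Q0 → ℤ)
    (hQ : HasNoOrientedCycles ta ha)
    (n : ℚ) (hn : n = (1 / 2 : ℚ) * ∑ i : Q0, (|σ i| : ℚ) * (α i : ℚ))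
    (m : ℕ)
    (hm : m = ∑ x : Q0, ∑ y : Q0, (σ x).toNat * numQuiverPaths ta ha x y * (-(σ y)).toNat) :
    Algebra.adjoin K
        {f | ∃ d : ℕ, (d : ℚ) ≤ (m : ℚ) * n ^ 3 ∧
          f ∈ quiverSemiInvariantsOfWeight K ta ha α fun i => (d : ℤ) * σ i}
      = Algebra.adjoin K
        {f | ∃ d : ℕ, f ∈ quiverSemiInvariantsOfWeight K ta ha α fun i => (d : ℤ) * σ i} := by
  classical
  have hK : Infinite K := IsAlgClosed.instInfinite
  refine le_antisymm (Algebra.adjoin_mono ?_) (Algebra.adjoin_le ?_)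
  · rintro f ⟨d, _, hf⟩
    exact ⟨d, hf⟩
  · rintro f ⟨d, hf⟩
    refine final_ind hQ n hn m hm _ (fun d f hd hf => ?_) d f (mem_SI_iff.1 hf)
    exact Algebra.subset_adjoin ⟨d, hd, mem_SI_iff.2 hf⟩
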